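/- Let Δ be a simplicial complex and let R = 𝕜[Δ] be its Stanley–Reisner ring over a field 𝕜, and assume R is Cohen–Macaulay. Then tr(ω_R) = 𝔐_R (equivalently, R is nearly Gorenstein but not Gorenstein) if and only if Δ is isomorphic either to a disjoint union of n ≥ 3 vertices or to a path of length n ≥ 3. -/

import Mathlib

/-! # Preliminaries

Self-contained definitions: simplicial complexes, simplicial homology, Stanley–Reisner rings,
canonical modules, canonical traces, and the various Gorenstein-type conditions. -/

open CategoryTheory

/-- An abstract simplicial complex on the vertex set `Fin n` (the empty set is a face). -/
structure SC (n : ℕ) where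
  faces : Finset (Finset (Fin n))
  empty_mem : ∅ ∈ faces
  down_closed : ∀ {σ τ : Finset (Fin n)}, σ ∈ faces → τ ⊆ σ → τ ∈ faces

namespace SC

variable {n : ℕ} (Δ : SC n)

/-- The dimension of a simplicial complex, as an integer (the complex `{∅}` has
dimension `-1`). -/
def dim : ℤ := ((Δ.faces.sup Finset.card : ℕ) : ℤ) - 1

/-- `v` is a vertex of `Δ`. -/
def IsVertex (v : Fin n) : Prop := {v} ∈ Δ.faces

/-- A facet is a face which is maximal by inclusion. -/
def IsFacet (σ : Finset (Fin n)) : Prop :=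
  σ ∈ Δ.faces ∧ ∀ τ ∈ Δ.faces, σ ⊆ τ → σ = τ

/-- A cone point is a vertex contained in every facet. -/
def IsConePoint (v : Fin n) : Prop :=
  Δ.IsVertex v ∧ ∀ σ, Δ.IsFacet σ → v ∈ σ

/-- A simplicial complex is connected if it has a vertex and any two vertices are joined
by a path of edges. -/
def Connected : Prop :=
  (∃ v, Δ.IsVertex v) ∧ ∀ u v, Δ.IsVertex u → Δ.IsVertex v →
    Relation.ReflTransGen (fun a b => ({a, b} : Finset (Fin n)) ∈ Δ.faces) u v

/-- A simplicial complex is strongly connected if any two facets are joined by a chain of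
facets in which consecutive facets intersect in a face of dimension `dim Δ - 1`. -/
def StronglyConnected : Prop :=
  ∀ σ τ, Δ.IsFacet σ → Δ.IsFacet τ →
    Relation.ReflTransGen
      (fun α β => Δ.IsFacet α ∧ Δ.IsFacet β ∧ ((α ∩ β).card : ℤ) - 1 = Δ.dim - 1) σ τ

/-- A pseudomanifold: strongly connected, and every face of dimension `dim Δ - 1` is
contained in exactly two facets. -/
def IsPseudomanifold : Prop :=
  Δ.StronglyConnected ∧
    ∀ τ ∈ Δ.faces, (τ.card : ℤ) - 1 = Δ.dim - 1 →
      {σ : Finset (Fin n) | Δ.IsFacet σ ∧ τ ⊆ σ}.ncard = 2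

/-- The link of a face `σ` of `Δ`. -/
def link (σ : Finset (Fin n)) (hσ : σ ∈ Δ.faces) : SC n where
  faces := Δ.faces.filter fun τ => τ ∩ σ = ∅ ∧ τ ∪ σ ∈ Δ.faces
  empty_mem := by
    simp only [Finset.mem_filter]
    exact ⟨Δ.empty_mem, by simp, by simpa using hσ⟩
  down_closed := by
    intro σ' τ' h hsub
    simp only [Finset.mem_filter] at h ⊢
    refine ⟨Δ.down_closed h.1 hsub, ?_, ?_⟩
    · have := h.2.1
      rw [Finset.eq_empty_iff_forall_notMem] at this ⊢
      intro x hx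
      exact this x (Finset.mem_inter.mpr
        ⟨hsub (Finset.mem_inter.mp hx).1, (Finset.mem_inter.mp hx).2⟩)
    · exact Δ.down_closed h.2.2 (Finset.union_subset_union hsub (le_refl σ))

/-- A complex is normal if the link of every face of dimension `≤ dim Δ - 2` is connected. -/
def Normal : Prop :=
  ∀ σ (hσ : σ ∈ Δ.faces), (σ.card : ℤ) - 1 ≤ Δ.dim - 2 → (Δ.link σ hσ).Connected

/-! ## Simplicial homology -/

/-- Faces of `Δ` of cardinality `c` containing the face `σ`.  These index a basis of the
`c`-th chain group of the pair `(Δ, cost_Δ σ)` (for `σ = ∅` this is the augmented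
(reduced) chain complex of `Δ`, since the empty face is included in chain degree `0`). -/
def RFace (σ : Finset (Fin n)) (c : ℕ) : Type :=
  {τ : Finset (Fin n) // τ ∈ Δ.faces ∧ σ ⊆ τ ∧ τ.card = c}

instance (σ : Finset (Fin n)) (c : ℕ) : Fintype (Δ.RFace σ c) :=
  inferInstanceAs (Fintype {τ : Finset (Fin n) // τ ∈ Δ.faces ∧ σ ⊆ τ ∧ τ.card = c})

instance (σ : Finset (Fin n)) (c : ℕ) : DecidableEq (Δ.RFace σ c) :=
  inferInstanceAs (DecidableEq {τ : Finset (Fin n) // τ ∈ Δ.faces ∧ σ ⊆ τ ∧ τ.card = c})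

variable (R : Type) [CommRing R]

/-- Chains of the pair `(Δ, cost_Δ σ)` with coefficients in `R`. -/
abbrev relChain (σ : Finset (Fin n)) (c : ℕ) : Type := Δ.RFace σ c → R

/-- The matrix of the simplicial boundary map of the pair `(Δ, cost_Δ σ)`: the coefficient of
`ρ` in `∂ τ` is `(-1)^j` if `ρ` is obtained from `τ` by deleting its `(j+1)`-st vertex (the
deleted vertex not belonging to `σ`), and `0` otherwise. -/
def relBMat (σ : Finset (Fin n)) (i : ℕ) :
    Matrix (Δ.RFace σ i) (Δ.RFace σ (i + 1)) R :=
  fun ρ τ => ∑ v ∈ τ.1, if v ∉ σ ∧ τ.1.erase v = ρ.1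
    then (-1 : R) ^ ((τ.1.filter (fun w => w < v)).card) else 0

/-- The boundary map of the chain complex of the pair `(Δ, cost_Δ σ)`. -/
noncomputable def relBoundary (σ : Finset (Fin n)) (i : ℕ) :
    Δ.relChain R σ (i + 1) →ₗ[R] Δ.relChain R σ i :=
  (Δ.relBMat R σ i).mulVecLin

/-- The relative simplicial homology `H_d(Δ, cost_Δ σ; R)` (`d ≥ 0`). -/
noncomputable def relHomology (σ : Finset (Fin n)) (d : ℕ) : Type :=
  LinearMap.ker (Δ.relBoundary R σ d) ⧸
    Submodule.comap (LinearMap.ker (Δ.relBoundary R σ d)).subtype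
      (LinearMap.range (Δ.relBoundary R σ (d + 1)))

noncomputable instance (σ : Finset (Fin n)) (d : ℕ) : AddCommGroup (Δ.relHomology R σ d) :=
  inferInstanceAs (AddCommGroup (LinearMap.ker (Δ.relBoundary R σ d) ⧸
    Submodule.comap (LinearMap.ker (Δ.relBoundary R σ d)).subtype
      (LinearMap.range (Δ.relBoundary R σ (d + 1)))))

noncomputable instance (σ : Finset (Fin n)) (d : ℕ) : Module R (Δ.relHomology R σ d) :=
  inferInstanceAs (Module R (LinearMap.ker (Δ.relBoundary R σ d) ⧸
    Submodule.comap (LinearMap.ker (Δ.relBoundary R σ d)).subtype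
      (LinearMap.range (Δ.relBoundary R σ (d + 1)))))

/-- Reduced simplicial homology `H̃_d(Δ; R)` for `d ≥ 0`: the homology of the augmented chain
complex, i.e. of the pair `(Δ, cost_Δ ∅)`. -/
noncomputable abbrev reducedHomology (d : ℕ) : Type := Δ.relHomology R ∅ d

/-- Reduced simplicial homology in degree `-1`. -/
noncomputable def reducedHomologyNeg : Type :=
  (⊤ : Submodule R (Δ.relChain R ∅ 0)) ⧸
    Submodule.comap (⊤ : Submodule R (Δ.relChain R ∅ 0)).subtype
      (LinearMap.range (Δ.relBoundary R ∅ 0))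

noncomputable instance : AddCommGroup (Δ.reducedHomologyNeg R) :=
  inferInstanceAs (AddCommGroup ((⊤ : Submodule R (Δ.relChain R ∅ 0)) ⧸
    Submodule.comap (⊤ : Submodule R (Δ.relChain R ∅ 0)).subtype
      (LinearMap.range (Δ.relBoundary R ∅ 0))))

noncomputable instance : Module R (Δ.reducedHomologyNeg R) :=
  inferInstanceAs (Module R ((⊤ : Submodule R (Δ.relChain R ∅ 0)) ⧸
    Submodule.comap (⊤ : Submodule R (Δ.relChain R ∅ 0)).subtype
      (LinearMap.range (Δ.relBoundary R ∅ 0))))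

/-- Cycles of the non-augmented chain complex of `Δ` in dimension `d` (for `d = 0` every
`0`-chain is a cycle). -/
noncomputable def cyclesUnred (d : ℕ) : Submodule R (Δ.relChain R ∅ (d + 1)) :=
  if d = 0 then ⊤ else LinearMap.ker (Δ.relBoundary R ∅ d)

/-- (Unreduced) simplicial homology `H_d(Δ; R)`. -/
noncomputable def homologyUnred (d : ℕ) : Type :=
  Δ.cyclesUnred R d ⧸
    Submodule.comap (Δ.cyclesUnred R d).subtype (LinearMap.range (Δ.relBoundary R ∅ (d + 1)))

noncomputable instance (d : ℕ) : AddCommGroup (Δ.homologyUnred R d) :=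
  inferInstanceAs (AddCommGroup (Δ.cyclesUnred R d ⧸
    Submodule.comap (Δ.cyclesUnred R d).subtype (LinearMap.range (Δ.relBoundary R ∅ (d + 1)))))

noncomputable instance (d : ℕ) : Module R (Δ.homologyUnred R d) :=
  inferInstanceAs (Module R (Δ.cyclesUnred R d ⧸
    Submodule.comap (Δ.cyclesUnred R d).subtype (LinearMap.range (Δ.relBoundary R ∅ (d + 1)))))

/-- `Δ` is `R`-orientable if `H_d(Δ; R) ≠ 0`, where `d = dim Δ`. -/
def Orientable : Prop :=
  ∃ d : ℕ, Δ.dim = (d : ℤ) ∧ Nontrivial (Δ.homologyUnred R d)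

/-- A `k`-homology sphere condition for a single complex `Γ`:
`H̃_i(Γ; k) = k` for `i = dim Γ` and `0` otherwise. -/
def HomologySphereCond (Γ : SC n) : Prop :=
  (∀ i : ℕ, ((i : ℤ) = Γ.dim → Nonempty ((Γ.reducedHomology R i) ≃ₗ[R] R)) ∧
    ((i : ℤ) ≠ Γ.dim → Subsingleton (Γ.reducedHomology R i))) ∧
  ((-1 : ℤ) = Γ.dim → Nonempty ((Γ.reducedHomologyNeg R) ≃ₗ[R] R)) ∧
  ((-1 : ℤ) ≠ Γ.dim → Subsingleton (Γ.reducedHomologyNeg R))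

/-- `Δ` is a `k`-homology manifold: it is connected and the link of every nonempty face has
the reduced homology of a sphere of its dimension. -/
def IsHomologyManifold : Prop :=
  Δ.Connected ∧ ∀ σ (hσ : σ ∈ Δ.faces), σ ≠ ∅ → HomologySphereCond R (Δ.link σ hσ)

/-- `Δ` is isomorphic to the disjoint union of `m` vertices. -/
def IsDisjointVertices (m : ℕ) : Prop :=
  ∃ v : Fin m → Fin n, Function.Injective v ∧
    ∀ σ : Finset (Fin n), σ ∈ Δ.faces ↔ (σ = ∅ ∨ ∃ i, σ = {v i})

/-- `Δ` is isomorphic to a path of length `m` (with `m` edges and `m+1` vertices). -/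
def IsPathComplex (m : ℕ) : Prop :=
  ∃ v : Fin (m + 1) → Fin n, Function.Injective v ∧
    ∀ σ : Finset (Fin n), σ ∈ Δ.faces ↔
      (σ = ∅ ∨ (∃ i, σ = {v i}) ∨ ∃ i : Fin m, σ = {v i.castSucc, v i.succ})

end SC

/-! ## Commutative algebra -/

/-- The `i`-th Ext module `Ext^i_R(M, N)` of two `R`-modules, as an object of `ModuleCat R`. -/
noncomputable def extMod (R : Type) [CommRing R] (M N : Type) [AddCommGroup M] [Module R M]
    [AddCommGroup N] [Module R N] (i : ℕ) : ModuleCat R :=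
  ((Ext R (ModuleCat R) i).obj (Opposite.op (ModuleCat.of R M))).obj (ModuleCat.of R N)

/-- The trace ideal of an `R`-module `M`: the sum of the images of all `R`-linear maps
`M → R`. -/
noncomputable def traceIdeal (R : Type) [CommRing R] (M : Type) [AddCommGroup M] [Module R M] :
    Ideal R :=
  ⨆ f : M →ₗ[R] R, LinearMap.range f

/-- A Noetherian ring `R` with a distinguished maximal ideal `𝔪` (a local ring, or a graded
ring with its graded maximal ideal) is Cohen--Macaulay when `depth = dim`, i.e. (by the
Ext-characterisation of depth) `Ext^i_R(R/𝔪, R) = 0` for all `i < dim R`. -/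
def IsCohenMacaulayAt (R : Type) [CommRing R] (𝔪 : Ideal R) : Prop :=
  IsNoetherianRing R ∧
    ∀ i : ℕ, (i : WithBot (WithTop ℕ)) < ringKrullDim R → Subsingleton (extMod R (R ⧸ 𝔪) R i)

/-- A Noetherian ring `R` with a distinguished maximal ideal `𝔪` (a local ring, or a graded
ring with its graded maximal ideal) is Gorenstein when `Ext^i_R(R/𝔪, R)` vanishes for
`i ≠ dim R` and is isomorphic to `R/𝔪` for `i = dim R`. -/
def IsGorensteinAt (R : Type) [CommRing R] (𝔪 : Ideal R) : Prop :=
  IsNoetherianRing R ∧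
    ∀ i : ℕ, ((i : WithBot (WithTop ℕ)) = ringKrullDim R →
        Nonempty ((extMod R (R ⧸ 𝔪) R i) ≃ₗ[R] (R ⧸ 𝔪))) ∧
      ((i : WithBot (WithTop ℕ)) ≠ ringKrullDim R → Subsingleton (extMod R (R ⧸ 𝔪) R i))

/-- A Noetherian local ring is Gorenstein. -/
def IsGorensteinLocalRing (A : Type) [CommRing A] [IsLocalRing A] : Prop :=
  IsGorensteinAt A (IsLocalRing.maximalIdeal A)

section Graded

variable (k : Type) [Field k] {n : ℕ}

/-- An ideal of a polynomial ring is homogeneous (graded) if it contains all homogeneous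
components of its elements. -/
def IsHomogIdeal (I : Ideal (MvPolynomial (Fin n) k)) : Prop :=
  ∀ p ∈ I, ∀ d : ℕ, MvPolynomial.homogeneousComponent d p ∈ I

/-- The graded (irrelevant) maximal ideal of `k[x_1,…,x_n]/I`, generated by the images of the
variables. -/
noncomputable def quotMax (I : Ideal (MvPolynomial (Fin n) k)) :
    Ideal (MvPolynomial (Fin n) k ⧸ I) :=
  Ideal.span (Set.range fun i : Fin n => Ideal.Quotient.mk I (MvPolynomial.X i))

/-- The degree `j` component of the standard graded ring `k[x_1,…,x_n]/I`, as a
`k`-subspace. -/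
noncomputable def quotGrade (I : Ideal (MvPolynomial (Fin n) k)) (j : ℕ) :
    Submodule k (MvPolynomial (Fin n) k ⧸ I) :=
  (MvPolynomial.homogeneousSubmodule (Fin n) k j).map (Ideal.Quotient.mkₐ k I).toLinearMap

/-- The `ℤ^n`-graded component of `k[x_1,…,x_n]/I` of multidegree `a`: the `k`-line spanned by
the image of the monomial `x^a`. -/
noncomputable def quotMonomialGrade (I : Ideal (MvPolynomial (Fin n) k)) (a : Fin n → ℕ) :
    Submodule k (MvPolynomial (Fin n) k ⧸ I) :=
  Submodule.span k
    {Ideal.Quotient.mk I (MvPolynomial.monomial (Finsupp.equivFunOnFinite.symm a) (1 : k))}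

/-- The standard graded ring `R = k[x_1,…,x_n]/I` is Gorenstein on the punctured spectrum if
`R_𝔭` is Gorenstein for every graded prime `𝔭` other than the graded maximal ideal. -/
def GorensteinPunctured (I : Ideal (MvPolynomial (Fin n) k)) : Prop :=
  ∀ (𝔭 : Ideal (MvPolynomial (Fin n) k ⧸ I)) [𝔭.IsPrime],
    IsHomogIdeal k (𝔭.comap (Ideal.Quotient.mk I)) → 𝔭 ≠ quotMax k I →
      IsGorensteinLocalRing (Localization.AtPrime 𝔭)

/-- `ω` is a canonical module of the standard graded ring `R = k[x_1,…,x_n]/I`, `d = dim R`,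
when `ω ≅ Ext^{n-d}_S(R, S)` for `S = k[x_1,…,x_n]` (by graded local duality this is, up to
shift, the Matlis dual of the top local cohomology module `H^d_𝔪(R)`). -/
def IsCanonicalModuleQ (I : Ideal (MvPolynomial (Fin n) k)) (ω : Type) [AddCommGroup ω]
    [Module (MvPolynomial (Fin n) k ⧸ I) ω] : Prop :=
  Module.Finite (MvPolynomial (Fin n) k ⧸ I) ω ∧
    ∃ d : ℕ, ringKrullDim (MvPolynomial (Fin n) k ⧸ I) = (d : WithBot (WithTop ℕ)) ∧
      letI : Module (MvPolynomial (Fin n) k) ω := Module.compHom ω (Ideal.Quotient.mk I)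
      Nonempty (ω ≃ₗ[MvPolynomial (Fin n) k]
        (extMod (MvPolynomial (Fin n) k) (MvPolynomial (Fin n) k ⧸ I)
          (MvPolynomial (Fin n) k) (n - d)))

/-- A `ℤ`-grading on a module `ω` over `R = k[x_1,…,x_n]/I` compatible with the standard
grading of `R`. -/
def IsCompatibleGrading (I : Ideal (MvPolynomial (Fin n) k)) (ω : Type) [AddCommGroup ω]
    [Module (MvPolynomial (Fin n) k ⧸ I) ω] [Module k ω] (gr : ℤ → Submodule k ω) : Prop :=
  DirectSum.IsInternal gr ∧
    ∀ (i : ℕ) (j : ℤ) (r : MvPolynomial (Fin n) k ⧸ I) (m : ω),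
      r ∈ quotGrade k I i → m ∈ gr j → r • m ∈ gr ((i : ℤ) + j)

/-- The minimal number of generators of a module `M` over `R = k[…]/I` with graded maximal
ideal `𝔪`: the `k`-dimension of `M/𝔪M`. -/
noncomputable def muGen (R : Type) [CommRing R] [Algebra k R] (𝔪 : Ideal R) (M : Type)
    [AddCommGroup M] [Module R M] : ℕ :=
  letI : Module k (M ⧸ (𝔪 • (⊤ : Submodule R M))) :=
    Module.compHom (M ⧸ (𝔪 • (⊤ : Submodule R M))) (algebraMap k R)
  Module.finrank k (M ⧸ (𝔪 • (⊤ : Submodule R M)))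

/-- The Hilbert--Samuel function `j ↦ dim_k M/𝔪^j M` of a module. -/
noncomputable def hilbSam (R : Type) [CommRing R] [Algebra k R] (𝔪 : Ideal R) (M : Type)
    [AddCommGroup M] [Module R M] (j : ℕ) : ℕ :=
  letI : Module k (M ⧸ ((𝔪 ^ j) • (⊤ : Submodule R M))) :=
    Module.compHom (M ⧸ ((𝔪 ^ j) • (⊤ : Submodule R M))) (algebraMap k R)
  Module.finrank k (M ⧸ ((𝔪 ^ j) • (⊤ : Submodule R M)))

/-- `M` is an Ulrich module with respect to `𝔪`: its minimal number of generators `μ(M)`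
equals its multiplicity `e(𝔪; M) = lim_j t!·dim_k(M/𝔪^j M)/j^t`, where `t = dim M`. -/
def IsUlrich (R : Type) [CommRing R] [Algebra k R] (𝔪 : Ideal R) (M : Type) [AddCommGroup M]
    [Module R M] : Prop :=
  ∃ t : ℕ, ringKrullDim (R ⧸ Module.annihilator R M) = (t : WithBot (WithTop ℕ)) ∧
    Filter.Tendsto
      (fun j : ℕ => ((t.factorial : ℝ) * (hilbSam k R 𝔪 M j : ℝ)) / (j : ℝ) ^ t)
      Filter.atTop (nhds ((muGen k R 𝔪 M : ℝ)))

end Graded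

section SR

variable (k : Type) [Field k] {n : ℕ}

/-- The Stanley--Reisner ideal of `Δ`: generated by the squarefree monomials supported on
non-faces of `Δ`. -/
noncomputable def srIdeal (Δ : SC n) : Ideal (MvPolynomial (Fin n) k) :=
  Ideal.span {m | ∃ σ : Finset (Fin n), σ ∉ Δ.faces ∧ m = ∏ i ∈ σ, MvPolynomial.X i}

/-- The Stanley--Reisner ring `k[Δ]`. -/
abbrev SRRing (Δ : SC n) : Type := MvPolynomial (Fin n) k ⧸ srIdeal k Δ

/-- The graded maximal ideal of `k[Δ]`. -/
noncomputable abbrev srMax (Δ : SC n) : Ideal (SRRing k Δ) := quotMax k (srIdeal k Δ)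

/-- The value at `j` of the Hilbert function of the (canonically graded) canonical module of
`k[Δ]`, as computed by Gräbe's theorem:
`dim_k [ω]_j = Σ_{a ∈ ℕ^n, |a| = j} dim_k H_{dim Δ}(Δ, cost_Δ(supp a); k)`. -/
noncomputable def canonicalHilbert (Δ : SC n) (j : ℕ) : ℕ :=
  ∑ a ∈ (Fintype.piFinset fun _ : Fin n => Finset.range (j + 1)).filter
      (fun a => ∑ i, a i = j),
    Module.finrank k
      (Δ.relHomology k (Finset.univ.filter fun i => a i ≠ 0) (Δ.faces.sup Finset.card - 1))

/-- A `ℤ`-grading `gr` on a module `ω` over `k[Δ]` is the canonical grading of the canonical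
module if it is a compatible grading, is supported in nonnegative degrees, and its Hilbert
function is the one given by Gräbe's theorem. -/
def IsCanonicallyGraded (Δ : SC n) (ω : Type) [AddCommGroup ω] [Module (SRRing k Δ) ω]
    [Module k ω] (gr : ℤ → Submodule k ω) : Prop :=
  IsCompatibleGrading k (srIdeal k Δ) ω gr ∧ (∀ j : ℤ, j < 0 → gr j = ⊥) ∧
    ∀ j : ℕ, Module.finrank k (gr (j : ℤ)) = canonicalHilbert k Δ j

/-- A `ℤ^n`-grading `grN` on a module `ω` over `k[Δ]` (supported in `ℕ^n`) is the canonical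
multigrading of the canonical module if it is an internal direct sum, is compatible with the
`ℤ^n`-grading of `k[Δ]`, and its multigraded Hilbert function is the one given by Gräbe's
theorem: `dim_k [ω]_a = dim_k H_{dim Δ}(Δ, cost_Δ(supp a); k)`. -/
def IsCanonicallyMultiGraded (Δ : SC n) (ω : Type) [AddCommGroup ω] [Module (SRRing k Δ) ω]
    [Module k ω] (grN : (Fin n → ℕ) → Submodule k ω) : Prop :=
  DirectSum.IsInternal grN ∧
    (∀ (a b : Fin n → ℕ) (r : SRRing k Δ) (m : ω),
      r ∈ quotMonomialGrade k (srIdeal k Δ) a → m ∈ grN b → r • m ∈ grN (a + b)) ∧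
    ∀ a : Fin n → ℕ, Module.finrank k (grN a) =
      Module.finrank k
        (Δ.relHomology k (Finset.univ.filter fun i => a i ≠ 0) (Δ.faces.sup Finset.card - 1))

end SR

/-- The chain map `C_•(Δ, cost_Δ τ) → C_•(Δ, cost_Δ σ)` (for `τ ⊆ σ`) induced by the
inclusion `cost_Δ τ ⊆ cost_Δ σ`: basis faces not containing `σ` are sent to `0`. -/
def SC.relChainMap {n : ℕ} (Δ : SC n) (R : Type) [CommRing R] (τ σ : Finset (Fin n)) (c : ℕ) :
    Δ.relChain R τ c →ₗ[R] Δ.relChain R σ c :=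
  Matrix.mulVecLin (fun (β : Δ.RFace σ c) (α : Δ.RFace τ c) => if α.1 = β.1 then (1 : R) else 0)

set_option synthInstance.maxHeartbeats 1000000 in
/-- `R = k[x_1,…,x_n]/I` is almost Gorenstein with respect to a canonical module `ω` with
(canonical) grading `gr`: writing `a = a_R` for the `a`-invariant (so `-a` is the least degree
of `ω`), there is an injective degree-zero `R`-linear map `φ : R → ω(-a)` whose cokernel is
zero or an Ulrich module. -/
def IsAlmostGorenstein (k : Type) [Field k] {n : ℕ} (I : Ideal (MvPolynomial (Fin n) k))
    (ω : Type) [AddCommGroup ω] [Module (MvPolynomial (Fin n) k ⧸ I) ω] [Module k ω]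
    (gr : ℤ → Submodule k ω) : Prop :=
  ∃ a : ℤ, (gr (-a) ≠ ⊥ ∧ ∀ j : ℤ, j < -a → gr j = ⊥) ∧
    ∃ φ : (MvPolynomial (Fin n) k ⧸ I) →ₗ[MvPolynomial (Fin n) k ⧸ I] ω,
      Function.Injective φ ∧
      (∀ (i : ℕ) (r : MvPolynomial (Fin n) k ⧸ I),
        r ∈ quotGrade k I i → φ r ∈ gr ((i : ℤ) - a)) ∧
      (Subsingleton (ω ⧸ LinearMap.range φ) ∨
        IsUlrich k (MvPolynomial (Fin n) k ⧸ I) (quotMax k I) (ω ⧸ LinearMap.range φ))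


section Bridge
variable {R : Type} [CommRing R] {X Y : ModuleCat.{0} R}

open CochainComplex HomComplex in
lemma extMk_eq_zero_zero (P : ProjectiveResolution X) (f : P.complex.X 0 ⟶ Y)
    (hf : P.complex.d 1 0 ≫ f = 0) :
    P.extMk f 1 rfl hf = 0 ↔ f = 0 := by
  simp only [← P.extEquivCohomologyClass.apply_eq_iff_eq,
    ProjectiveResolution.extEquivCohomologyClass_extMk,
    ProjectiveResolution.extEquivCohomologyClass_zero,
    CohomologyClass.mk_eq_zero_iff]
  rw [Cocycle.toSingleMk_mem_coboundaries_iff _ _ _ _ _ 1 (by simp)]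
  have hz : P.cochainComplex.d (-((0:ℕ):ℤ)) 1 = 0 := by
    apply Limits.IsZero.eq_of_tgt
    exact CochainComplex.isZero_of_isStrictlyLE _ 0 1 (by simp)
  rw [hz]
  constructor
  · rintro ⟨g, hg⟩
    rw [← cancel_epi (P.cochainComplexXIso (-((0:ℕ):ℤ)) 0 rfl).hom]
    rw [← hg]; simp
  · rintro rfl
    exact ⟨0, by simp⟩

/-- cocycles to Ext -/
noncomputable def cocycToExt (P : ProjectiveResolution X) (i : ℕ) :
    LinearMap.ker (((P.complex.linearYonedaObj R Y).sc' (i - 1) i (i+1)).g).hom →ₗ[R]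
      Abelian.Ext.{0} X Y i where
  toFun f := P.extMk (f.1 : P.complex.X i ⟶ Y) (i+1) rfl (by
    have := f.2
    exact this)
  map_add' f g := by
    exact (P.add_extMk (f.1 : P.complex.X i ⟶ Y) (g.1 : P.complex.X i ⟶ Y) (i+1) rfl f.2 g.2).symm
  map_smul' r f := by
    refine Eq.trans ?_ (Abelian.Ext.smul_eq_comp_mk₀ _ r).symm
    refine Eq.trans ?_ (P.extMk_comp_mk₀ (f.1 : P.complex.X i ⟶ Y) (i+1) rfl f.2 (r • 𝟙 Y)).symm
    have h : ∀ (a b : P.complex.X i ⟶ Y) (ha hb), a = b →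
      P.extMk a (i+1) rfl ha = P.extMk b (i+1) rfl hb := by
      rintro a b ha hb rfl; rfl
    apply h
    have h2 : ∀ a : P.complex.X i ⟶ Y, r • a = a ≫ (r • 𝟙 Y) := fun a => by simp
    exact h2 f.1

theorem extMod_equiv (R : Type) [CommRing R] (M N : Type) [AddCommGroup M] [Module R M]
    [AddCommGroup N] [Module R N] (i : ℕ) :
    Nonempty (extMod R M N i ≃ₗ[R] Abelian.Ext.{0} (ModuleCat.of R M) (ModuleCat.of R N) i) := by
  let X := ModuleCat.of R M
  let Y := ModuleCat.of R N
  let P : ProjectiveResolution X := ProjectiveResolution.of X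
  let K := P.complex.linearYonedaObj R Y
  let S := K.sc' (i-1) i (i+1)
  have hprev : (ComplexShape.up ℕ).prev i = i - 1 := by
    cases i with
    | zero => simp
    | succ j => simp
  have hnext : (ComplexShape.up ℕ).next i = i + 1 := by simp
  have e1 : extMod R M N i ≃ₗ[R] K.homology i := (P.isoExt i Y).toLinearEquiv
  have e2 : K.homology i ≃ₗ[R] S.homology :=
    (ShortComplex.homologyMapIso (K.isoSc' (i-1) i (i+1) hprev hnext)).toLinearEquiv
  have e3 : S.homology ≃ₗ[R] S.moduleCatLeftHomologyData.H := S.moduleCatHomologyIso.toLinearEquiv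
  have hsurj : Function.Surjective (cocycToExt (Y := Y) P i) := by
    intro α
    obtain ⟨f, hf, h⟩ := P.extMk_surjective α (i+1) rfl
    exact ⟨⟨f, hf⟩, h⟩
  have hker : LinearMap.ker (cocycToExt (Y := Y) P i) = LinearMap.range S.moduleCatToCycles := by
    ext f
    rw [LinearMap.mem_ker, LinearMap.mem_range]
    cases i with
    | zero =>
      have : cocycToExt P 0 f = 0 ↔ (f.1 : P.complex.X 0 ⟶ Y) = 0 :=
        extMk_eq_zero_zero P _ f.2
      rw [this]
      have hd : S.f = 0 := K.shape _ _ (by simp)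
      constructor
      · intro h
        exact ⟨0, by rw [map_zero]; exact Subtype.ext h.symm⟩
      · rintro ⟨g, rfl⟩
        change S.f.hom g = 0
        rw [hd]; rfl
    | succ j =>
      have : cocycToExt P (j+1) f = 0 ↔ _ :=
        P.extMk_eq_zero_iff (f.1 : P.complex.X (j+1) ⟶ Y) (j+1+1) rfl f.2 j rfl
      rw [this]
      constructor
      · rintro ⟨g, hg⟩
        exact ⟨g, Subtype.ext hg⟩
      · rintro ⟨g, rfl⟩
        exact ⟨g, rfl⟩
  have e4 : S.moduleCatLeftHomologyData.H ≃ₗ[R] Abelian.Ext.{0} X Y i :=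
    (Submodule.quotEquivOfEq _ _ hker.symm).trans
      ((cocycToExt (Y := Y) P i).quotKerEquivOfSurjective hsurj)
  exact ⟨e1.trans (e2.trans (e3.trans e4))⟩
end Bridge


section Mono
open MvPolynomial
variable (k : Type) [Field k] {n : ℕ}

/-- squarefree exponent -/
noncomputable def ind (μ : Finset (Fin n)) : Fin n →₀ ℕ := Finsupp.indicator μ (fun _ _ => 1)

lemma ind_apply (μ : Finset (Fin n)) (i : Fin n) : ind μ i = if i ∈ μ then 1 else 0 := by
  classical
  simp [ind, Finsupp.indicator_apply]

lemma ind_support (μ : Finset (Fin n)) : (ind μ).support = μ := by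
  ext i; simp [ind_apply]

lemma ind_empty : ind (∅ : Finset (Fin n)) = 0 := by
  ext i; simp [ind_apply]

lemma ind_le_iff (μ : Finset (Fin n)) (t : Fin n →₀ ℕ) : ind μ ≤ t ↔ μ ⊆ t.support := by
  constructor
  · intro h i hi
    have := h i
    rw [ind_apply, if_pos hi] at this
    simp; omega
  · intro h i
    rw [ind_apply]
    split_ifs with hi
    · have := h hi
      simp at this; omega
    · omega

lemma supp_add (s t : Fin n →₀ ℕ) : (s + t).support = s.support ∪ t.support := by
  ext i; simp; omega

lemma prod_X_eq (μ : Finset (Fin n)) : (∏ i ∈ μ, X i : MvPolynomial (Fin n) k) = monomial (ind μ) 1 := by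
  classical
  rw [monomial_eq]
  simp only [map_one, one_mul, Finsupp.prod, ind_support]
  apply Finset.prod_congr rfl
  intro i hi
  simp [ind_apply, hi]

/-- the squarefree monomial ideal of a lower set of finsets -/
noncomputable def mI (Γ : LowerSet (Finset (Fin n))) : Ideal (MvPolynomial (Fin n) k) :=
  Ideal.span {m | ∃ σ : Finset (Fin n), σ ∉ Γ ∧ m = ∏ i ∈ σ, MvPolynomial.X i}

theorem mem_mI (Γ : LowerSet (Finset (Fin n))) (f : MvPolynomial (Fin n) k) :
    f ∈ mI k Γ ↔ ∀ t ∈ f.support, t.support ∉ Γ := by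
  have : {m : MvPolynomial (Fin n) k | ∃ σ : Finset (Fin n), σ ∉ Γ ∧ m = ∏ i ∈ σ, MvPolynomial.X i}
     = (fun s => monomial s (1:k)) '' (ind '' {σ | σ ∉ Γ}) := by
    ext m
    simp only [Set.mem_ofPred_eq, Set.mem_image, exists_exists_and_eq_and, prod_X_eq]
    exact exists_congr fun σ => by rw [eq_comm (a := m)]
  rw [mI, this, mem_ideal_span_monomial_image]
  refine forall₂_congr fun t _ => ?_
  constructor
  · rintro ⟨_, ⟨σ, hσ, rfl⟩, hle⟩ ht
    exact hσ (Γ.lower ((ind_le_iff σ t).1 hle) ht)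
  · intro h
    exact ⟨_, ⟨t.support, h, rfl⟩, (ind_le_iff _ t).2 subset_rfl⟩

/-- quotient ring -/
abbrev mQ (Γ : LowerSet (Finset (Fin n))) : Type := MvPolynomial (Fin n) k ⧸ mI k Γ

variable {k}

open Classical in
/-- coefficient functional (extended by zero) -/
noncomputable def rc (Γ : LowerSet (Finset (Fin n))) (t : Fin n →₀ ℕ) : mQ k Γ →ₗ[k] k :=
  ((mI k Γ).restrictScalars k).liftQ (if t.support ∈ Γ then MvPolynomial.lcoeff k t else 0) (by
    intro f hf
    have hf' := (mem_mI k Γ f).1 hf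
    by_cases h : t.support ∈ Γ
    · simp only [h, if_true, LinearMap.mem_ker, MvPolynomial.lcoeff_apply]
      by_contra h2
      exact hf' t (by simpa using h2) h
    · simp [h])

open Classical in
lemma rc_mk (Γ : LowerSet (Finset (Fin n))) (t : Fin n →₀ ℕ) (f : MvPolynomial (Fin n) k) :
    rc Γ t (Ideal.Quotient.mk (mI k Γ) f) = if t.support ∈ Γ then coeff t f else 0 := by
  change ((if t.support ∈ Γ then MvPolynomial.lcoeff k t else 0) : MvPolynomial (Fin n) k →ₗ[k] k) f = _
  split_ifs <;> simp

lemma rc_of_notMem {Γ : LowerSet (Finset (Fin n))} {t : Fin n →₀ ℕ} (h : t.support ∉ Γ) (r : mQ k Γ) :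
    rc Γ t r = 0 := by
  obtain ⟨f, rfl⟩ := Ideal.Quotient.mk_surjective r
  rw [rc_mk, if_neg h]

lemma rc_ext {Γ : LowerSet (Finset (Fin n))} {r s : mQ k Γ}
    (h : ∀ t : Fin n →₀ ℕ, t.support ∈ Γ → rc Γ t r = rc Γ t s) : r = s := by
  obtain ⟨f, rfl⟩ := Ideal.Quotient.mk_surjective r
  obtain ⟨g, rfl⟩ := Ideal.Quotient.mk_surjective s
  rw [Ideal.Quotient.eq, mem_mI]
  intro t ht hΓ
  have := h t hΓ
  rw [rc_mk, rc_mk, if_pos hΓ, if_pos hΓ] at this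
  simp [this] at ht

lemma rc_finite (Γ : LowerSet (Finset (Fin n))) (r : mQ k Γ) : {t | rc Γ t r ≠ 0}.Finite := by
  obtain ⟨f, rfl⟩ := Ideal.Quotient.mk_surjective r
  apply f.support.finite_toSet.subset
  intro t ht
  simp only [Set.mem_ofPred_eq, rc_mk] at ht
  by_contra h
  simp at h
  simp [h] at ht

/-- element with prescribed coefficients -/
lemma rc_exists (Γ : LowerSet (Finset (Fin n))) (g : (Fin n →₀ ℕ) → k) (hg : {t | g t ≠ 0}.Finite)
    (hs : ∀ t, t.support ∉ Γ → g t = 0) : ∃ r : mQ k Γ, ∀ t, rc Γ t r = g t := by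
  refine ⟨Ideal.Quotient.mk _ (∑ t ∈ hg.toFinset, monomial t (g t)), fun t => ?_⟩
  classical
  rw [rc_mk]
  split_ifs with h
  · simp only [coeff_sum, coeff_monomial, Finset.sum_ite_eq', Set.Finite.mem_toFinset, Set.mem_ofPred_eq]
    split_ifs with h2
    · rfl
    · simp at h2; exact h2.symm
  · exact (hs t h).symm

/-- monomial element -/
noncomputable def mon (Γ : LowerSet (Finset (Fin n))) (s : Fin n →₀ ℕ) : mQ k Γ :=
  Ideal.Quotient.mk _ (monomial s 1)

open Classical in
lemma rc_mon (Γ : LowerSet (Finset (Fin n))) (s t : Fin n →₀ ℕ) :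
    rc Γ t (mon (k := k) Γ s) = if t.support ∈ Γ ∧ s = t then 1 else 0 := by
  rw [mon, rc_mk, coeff_monomial, ite_and]

/-- rc of monomial multiple -/
lemma rc_smul_add {Γ : LowerSet (Finset (Fin n))} (s t : Fin n →₀ ℕ) (r : mQ k Γ)
    (h : (s + t).support ∈ Γ) :
    rc Γ (s + t) ((monomial s (1:k)) • r) = rc Γ t r := by
  obtain ⟨f, rfl⟩ := Ideal.Quotient.mk_surjective r
  have : (monomial s (1:k)) • (Ideal.Quotient.mk (mI k Γ) f) = Ideal.Quotient.mk (mI k Γ) (monomial s 1 * f) := rfl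
  have ht : t.support ∈ Γ := Γ.lower (by rw [supp_add]; exact Finset.subset_union_right) h
  rw [this, rc_mk, rc_mk, if_pos h, if_pos ht, coeff_monomial_mul, one_mul]

lemma rc_smul_of_not_le {Γ : LowerSet (Finset (Fin n))} (s t : Fin n →₀ ℕ) (r : mQ k Γ)
    (h : ¬ s ≤ t) :
    rc Γ t ((monomial s (1:k)) • r) = 0 := by
  obtain ⟨f, rfl⟩ := Ideal.Quotient.mk_surjective r
  have : (monomial s (1:k)) • (Ideal.Quotient.mk (mI k Γ) f) = Ideal.Quotient.mk (mI k Γ) (monomial s 1 * f) := rfl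
  rw [this, rc_mk, coeff_monomial_mul', if_neg h, ite_self]

lemma supp_tsub_union {μ : Finset (Fin n)} {t : Fin n →₀ ℕ} (h : μ ⊆ t.support) :
    (t - ind μ).support ∪ μ = t.support := by
  conv_rhs => rw [← tsub_add_cancel_of_le ((ind_le_iff μ t).2 h), supp_add, ind_support]

/-- multiplication by a squarefree monomial -/
noncomputable def mulMap (μ : Finset (Fin n)) (Γ Γ' : LowerSet (Finset (Fin n)))
    (h : ∀ s, s ∪ μ ∈ Γ' → s ∈ Γ) : mQ k Γ →ₗ[MvPolynomial (Fin n) k] mQ k Γ' :=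
  Submodule.mapQ (mI k Γ) (mI k Γ') (LinearMap.mulLeft _ (monomial (ind μ) 1)) (by
    intro f hf
    rw [Submodule.mem_comap, LinearMap.mulLeft_apply]
    rw [mem_mI] at hf ⊢
    intro t ht hΓ
    rw [mem_support_iff, coeff_monomial_mul'] at ht
    split_ifs at ht with hle
    · rw [one_mul] at ht
      refine hf (t - ind μ) (by simpa using ht) (h _ ?_)
      rwa [supp_tsub_union ((ind_le_iff μ t).1 hle)]
    · exact ht rfl)

lemma mulMap_mk (μ : Finset (Fin n)) (Γ Γ' : LowerSet (Finset (Fin n)))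
    (h : ∀ s, s ∪ μ ∈ Γ' → s ∈ Γ) (f : MvPolynomial (Fin n) k) :
    mulMap μ Γ Γ' h (Ideal.Quotient.mk _ f) = Ideal.Quotient.mk _ (monomial (ind μ) 1 * f) := rfl

lemma rc_mulMap_add (μ : Finset (Fin n)) (Γ Γ' : LowerSet (Finset (Fin n)))
    (h : ∀ s, s ∪ μ ∈ Γ' → s ∈ Γ) (t : Fin n →₀ ℕ) (ht : t.support ∪ μ ∈ Γ') (r : mQ k Γ) :
    rc Γ' (t + ind μ) (mulMap μ Γ Γ' h r) = rc Γ t r := by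
  obtain ⟨f, rfl⟩ := Ideal.Quotient.mk_surjective r
  rw [mulMap_mk, rc_mk, rc_mk, if_pos (by rwa [supp_add, ind_support]), if_pos (h _ ht), add_comm,
    coeff_monomial_mul, one_mul]

lemma rc_mulMap_not (μ : Finset (Fin n)) (Γ Γ' : LowerSet (Finset (Fin n)))
    (h : ∀ s, s ∪ μ ∈ Γ' → s ∈ Γ) (t : Fin n →₀ ℕ) (ht : ¬ μ ⊆ t.support) (r : mQ k Γ) :
    rc Γ' t (mulMap μ Γ Γ' h r) = 0 := by
  obtain ⟨f, rfl⟩ := Ideal.Quotient.mk_surjective r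
  rw [mulMap_mk, rc_mk, coeff_monomial_mul', if_neg (fun hle => ht ((ind_le_iff μ t).1 hle)), ite_self]

/-- restriction map -/
noncomputable def resMap (Γ Γ' : LowerSet (Finset (Fin n))) (h : Γ' ≤ Γ) :
    mQ k Γ →ₗ[MvPolynomial (Fin n) k] mQ k Γ' :=
  mulMap ∅ Γ Γ' (fun s hs => h (by simpa using hs))

lemma resMap_mk (Γ Γ' : LowerSet (Finset (Fin n))) (h : Γ' ≤ Γ) (f : MvPolynomial (Fin n) k) :
    resMap Γ Γ' h (Ideal.Quotient.mk _ f) = Ideal.Quotient.mk _ f := by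
  rw [resMap, mulMap_mk, ind_empty]; simp

lemma rc_resMap (Γ Γ' : LowerSet (Finset (Fin n))) (h : Γ' ≤ Γ) (t : Fin n →₀ ℕ)
    (ht : t.support ∈ Γ') (r : mQ k Γ) : rc Γ' t (resMap Γ Γ' h r) = rc Γ t r := by
  have := rc_mulMap_add ∅ Γ Γ' (fun s hs => h (by simpa using hs)) t (by simpa using ht) r
  rw [ind_empty, add_zero] at this
  exact this

lemma resMap_surj (Γ Γ' : LowerSet (Finset (Fin n))) (h : Γ' ≤ Γ) :
    Function.Surjective (resMap (k := k) Γ Γ' h) := by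
  intro r
  obtain ⟨f, rfl⟩ := Ideal.Quotient.mk_surjective r
  exact ⟨Ideal.Quotient.mk _ f, resMap_mk _ _ _ _⟩

/-- the complex as a lower set -/
def SC.low {n : ℕ} (Δ : SC n) : LowerSet (Finset (Fin n)) :=
  ⟨{σ | σ ∈ Δ.faces}, fun _ _ h hb => Δ.down_closed hb h⟩

lemma srIdeal_eq (Δ : SC n) : srIdeal k Δ = mI k Δ.low := rfl

/-! ### the short exact sequences -/

/-- Data for a short exact sequence `∏ k[F i] → k[Γ] → k[Γ']` -/
structure SesData {n : ℕ} (ι : Type) where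
  F : ι → Finset (Fin n)
  μ : ι → Finset (Fin n)
  Γ : LowerSet (Finset (Fin n))
  Γ' : LowerSet (Finset (Fin n))
  le : Γ' ≤ Γ
  h1 : ∀ i s, s ∪ μ i ∈ Γ → s ∈ LowerSet.Iic (F i)
  h2 : ∀ s, s ∈ Γ → s ∉ Γ' → ∃ i, μ i ⊆ s ∧ s ⊆ F i
  h3 : ∀ i s, s ⊆ F i → s ∪ μ i ∈ Γ ∧ s ∪ μ i ∉ Γ'
  h4 : ∀ i j, μ i ∪ μ j ⊆ F i → μ i ∪ μ j ⊆ F j → i = j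

namespace SesData
variable {ι : Type} [Fintype ι] (D : SesData (n := n) ι)

variable (k) in
noncomputable def inc :
    ((i : ι) → mQ k (LowerSet.Iic (D.F i))) →ₗ[MvPolynomial (Fin n) k] mQ k D.Γ :=
  ∑ i, (mulMap (D.μ i) (LowerSet.Iic (D.F i)) D.Γ (D.h1 i)) ∘ₗ LinearMap.proj i

lemma inc_apply (f : (i : ι) → mQ k (LowerSet.Iic (D.F i))) :
    D.inc k f = ∑ i, mulMap (D.μ i) (LowerSet.Iic (D.F i)) D.Γ (D.h1 i) (f i) := by
  simp [inc]

lemma rc_inc (f : (i : ι) → mQ k (LowerSet.Iic (D.F i))) (i : ι) (t : Fin n →₀ ℕ)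
    (ht : t.support ⊆ D.F i) :
    rc D.Γ (t + ind (D.μ i)) (D.inc k f) = rc _ t (f i) := by
  rw [inc_apply, map_sum, Finset.sum_eq_single i]
  · rw [rc_mulMap_add _ _ _ _ _ (D.h3 i _ ht).1]
  · intro j _ hj
    by_cases h : D.μ j ⊆ (t + ind (D.μ i)).support
    · exfalso
      apply hj
      have h5 : D.μ i ⊆ D.F i := by
        have := D.h1 i (D.μ i) (by simpa using (D.h3 i ∅ (by simp)).1)
        exact this
      have hs : (t + ind (D.μ i)).support ⊆ D.F j := by
        apply D.h1 j
        have := (D.h3 i _ ht).1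
        rw [supp_add, ind_support] at h ⊢
        rwa [Finset.union_eq_left.2 h]
      rw [supp_add, ind_support] at h hs
      refine D.h4 j i (Finset.union_subset (h.trans hs) (Finset.subset_union_right.trans hs)) ?_
      exact Finset.union_subset (h.trans (Finset.union_subset ht h5)) h5
    · exact rc_mulMap_not _ _ _ _ _ h _
  · simp

lemma inc_inj : Function.Injective (D.inc k) := by
  rw [← LinearMap.ker_eq_bot, LinearMap.ker_eq_bot']
  intro f hf
  funext i
  apply rc_ext
  intro t ht
  rw [← D.rc_inc f i t ht, hf]
  simp

lemma exact : Function.Exact (D.inc k) (resMap D.Γ D.Γ' D.le) := by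
  intro r
  constructor
  · intro h
    have key : ∀ i, ∃ g : mQ k (LowerSet.Iic (D.F i)), ∀ t : Fin n →₀ ℕ, t.support ⊆ D.F i →
        rc _ t g = rc D.Γ (t + ind (D.μ i)) r := by
      intro i
      classical
      obtain ⟨g, hg⟩ := rc_exists (LowerSet.Iic (D.F i)) (k := k)
        (fun t => if t.support ⊆ D.F i then rc D.Γ (t + ind (D.μ i)) r else 0) (by
          have := (rc_finite D.Γ r).preimage (f := fun t => t + ind (D.μ i))
            (fun a _ b _ h => by simpa using h)
          apply this.subset
          intro t ht
          simp only [Set.mem_ofPred_eq, ne_eq, ite_eq_right_iff, Classical.not_imp] at ht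
          exact ht.2) (by
          intro t ht
          exact if_neg ht)
      exact ⟨g, fun t ht => by rw [hg, if_pos ht]⟩
    choose g hg using key
    refine ⟨g, rc_ext fun t ht => ?_⟩
    by_cases h' : t.support ∈ D.Γ'
    · have e1 : rc D.Γ t r = 0 := by
        rw [← rc_resMap D.Γ D.Γ' D.le t h' r, h]; simp
      rw [e1, inc_apply, map_sum]
      apply Finset.sum_eq_zero
      intro i _
      apply rc_mulMap_not
      intro hμ
      have h5 := D.h1 i t.support (by rwa [Finset.union_eq_left.2 hμ])
      apply (D.h3 i t.support h5).2
      rwa [Finset.union_eq_left.2 hμ]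
    · obtain ⟨i, hi1, hi2⟩ := D.h2 _ ht h'
      obtain ⟨s, rfl⟩ := exists_add_of_le ((ind_le_iff _ _).2 hi1)
      rw [add_comm] at hi2 ⊢
      have hs : s.support ⊆ D.F i := by
        refine subset_trans ?_ hi2
        rw [supp_add]; exact Finset.subset_union_left
      rw [D.rc_inc _ _ _ hs, hg i s hs]
  · rintro ⟨f, rfl⟩
    apply rc_ext
    intro t ht
    rw [rc_resMap D.Γ D.Γ' D.le t ht, map_zero, inc_apply, map_sum]
    apply Finset.sum_eq_zero
    intro i _
    apply rc_mulMap_not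
    intro hμ
    have ht' := D.le ht
    have h5 := D.h1 i t.support (by rwa [Finset.union_eq_left.2 hμ])
    apply (D.h3 i t.support h5).2
    rwa [Finset.union_eq_left.2 hμ]

end SesData
end Mono


section ExtLayer
open Abelian
variable {R : Type} [CommRing R]

/-- Ext at module level -/
noncomputable abbrev EM (R : Type) [CommRing R] (M N : Type) [AddCommGroup M] [Module R M]
    [AddCommGroup N] [Module R N] (i : ℕ) : Type :=
  Abelian.Ext.{0} (ModuleCat.of R M) (ModuleCat.of R N) i

variable {M M' M'' N : Type} [AddCommGroup M] [Module R M] [AddCommGroup M'] [Module R M']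
  [AddCommGroup M''] [Module R M''] [AddCommGroup N] [Module R N]

/-- pullback -/
noncomputable def pull (N : Type) [AddCommGroup N] [Module R N] (f : M →ₗ[R] M') (i : ℕ) :
    EM R M' N i →ₗ[R] EM R M N i where
  toFun e := (Ext.mk₀ (ModuleCat.ofHom f)).comp e (zero_add i)
  map_add' a b := by simp
  map_smul' r a := by simp [Ext.comp_smul]

lemma pull_apply (f : M →ₗ[R] M') (i : ℕ) (e : EM R M' N i) :
    pull N f i e = (Ext.mk₀ (ModuleCat.ofHom f)).comp e (zero_add i) := rfl

lemma pull_id (i : ℕ) (e : EM R M N i) : pull N (LinearMap.id : M →ₗ[R] M) i e = e := by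
  rw [pull_apply, ModuleCat.ofHom_id, Ext.mk₀_id_comp]

lemma pull_comp (f : M →ₗ[R] M') (g : M' →ₗ[R] M'') (i : ℕ) (e : EM R M'' N i) :
    pull N (g ∘ₗ f) i e = pull N f i (pull N g i e) := by
  rw [pull_apply, pull_apply, pull_apply, ModuleCat.ofHom_comp, Ext.mk₀_comp_mk₀_assoc]

lemma pull_add (f g : M →ₗ[R] M') (i : ℕ) (e : EM R M' N i) :
    pull N (f + g) i e = pull N f i e + pull N g i e := by
  rw [pull_apply, pull_apply, pull_apply, ModuleCat.ofHom_add, Ext.mk₀_add, Ext.add_comp]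

lemma pull_zero (i : ℕ) (e : EM R M' N i) :
    pull N (0 : M →ₗ[R] M') i e = 0 := by
  have := pull_add (0 : M →ₗ[R] M') 0 i e
  simpa using this

lemma pull_sum {ι : Type} (s : Finset ι) (f : ι → (M →ₗ[R] M')) (i : ℕ) (e : EM R M' N i) :
    pull N (∑ j ∈ s, f j) i e = ∑ j ∈ s, pull N (f j) i e := by
  classical
  induction s using Finset.induction_on with
  | empty => simp [pull_zero]
  | insert a s ha ih => rw [Finset.sum_insert ha, Finset.sum_insert ha, pull_add, ih]

lemma pull_smul (r : R) (f : M →ₗ[R] M') (i : ℕ) (e : EM R M' N i) :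
    pull N (r • f) i e = r • pull N f i e := by
  have h : ModuleCat.ofHom (r • f) = r • ModuleCat.ofHom f := rfl
  rw [pull_apply, pull_apply, h, Ext.mk₀_smul, Ext.smul_comp]

lemma pull_smul_id (r : R) (i : ℕ) (e : EM R M N i) :
    pull N (r • (LinearMap.id : M →ₗ[R] M)) i e = r • e := by
  rw [pull_smul, pull_id]

/-- short exact data -/
structure SE (f : M →ₗ[R] M') (g : M' →ₗ[R] M'') : Prop where
  inj : Function.Injective f
  surj : Function.Surjective g
  ex : Function.Exact f g

namespace SE
variable {f : M →ₗ[R] M'} {g : M' →ₗ[R] M''} (h : SE f g)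

/-- the short complex -/
noncomputable abbrev sc : ShortComplex (ModuleCat.{0} R) :=
  ShortComplex.mk (ModuleCat.ofHom f) (ModuleCat.ofHom g) (by
    ext x
    exact h.ex.apply_apply_eq_zero x)

lemma shortExact : h.sc.ShortExact := by
  have h1 : Mono h.sc.f := (ModuleCat.mono_iff_injective _).2 h.inj
  have h2 : Epi h.sc.g := (ModuleCat.epi_iff_surjective _).2 h.surj
  exact { exact := (ShortComplex.ShortExact.moduleCat_exact_iff_function_exact _).2 h.ex }

variable (N) in
/-- connecting map -/
noncomputable def delta (i : ℕ) : EM R M N i →ₗ[R] EM R M'' N (i + 1) where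
  toFun e := h.shortExact.extClass.comp e (add_comm 1 i)
  map_add' a b := by simp
  map_smul' r a := by simp [Ext.comp_smul]

lemma ex1 (i : ℕ) (e : EM R M N i) (he : h.delta N i e = 0) : ∃ e', pull N f i e' = e :=
  Ext.contravariant_sequence_exact₁ h.shortExact _ e (add_comm 1 i) he

include h in
lemma ex2 (i : ℕ) (e : EM R M' N i) (he : pull N f i e = 0) : ∃ e', pull N g i e' = e :=
  Ext.contravariant_sequence_exact₂ h.shortExact _ e he

lemma ex3 (i : ℕ) (e : EM R M'' N (i+1)) (he : pull N g (i+1) e = 0) : ∃ e', h.delta N i e' = e :=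
  Ext.contravariant_sequence_exact₃ h.shortExact _ e he (add_comm 1 i)

lemma delta_pull (i : ℕ) (e : EM R M' N i) : h.delta N i (pull N f i e) = 0 :=
  h.shortExact.extClass_comp_assoc e (h := add_comm 1 i)

include h in
lemma pull_inj_zero : Function.Injective (pull N g 0) := by
  have : Epi (ModuleCat.ofHom g) := (ModuleCat.epi_iff_surjective _).2 h.surj
  exact Ext.precomp_mk₀_injective_of_epi (ModuleCat.of R N) (ModuleCat.ofHom g)

lemma natural {L L' L'' : Type} [AddCommGroup L] [Module R L] [AddCommGroup L'] [Module R L']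
    [AddCommGroup L''] [Module R L''] {f' : L →ₗ[R] L'} {g' : L' →ₗ[R] L''} (h' : SE f' g')
    (a : M →ₗ[R] L) (b : M' →ₗ[R] L') (c : M'' →ₗ[R] L'') (h1 : b ∘ₗ f = f' ∘ₗ a)
    (h2 : c ∘ₗ g = g' ∘ₗ b) (i : ℕ) (e : EM R L N i) :
    h.delta N i (pull N a i e) = pull N c (i+1) (h'.delta N i e) := by
  let φ : h.sc ⟶ h'.sc := 
    { τ₁ := ModuleCat.ofHom a
      τ₂ := ModuleCat.ofHom b
      τ₃ := ModuleCat.ofHom c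
      comm₁₂ := by
        rw [← ModuleCat.ofHom_comp, ← ModuleCat.ofHom_comp, h1]
      comm₂₃ := by
        rw [← ModuleCat.ofHom_comp, ← ModuleCat.ofHom_comp, h2] }
  have := ShortComplex.ShortExact.extClass_naturality h.shortExact h'.shortExact φ
  change h.shortExact.extClass.comp ((Ext.mk₀ φ.τ₁).comp e (zero_add i)) (add_comm 1 i) =
    (Ext.mk₀ φ.τ₃).comp (h'.shortExact.extClass.comp e (add_comm 1 i)) (zero_add _)
  rw [← Ext.comp_assoc_of_second_deg_zero, this, Ext.comp_assoc]
  omega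
end SE

/-- products -/
lemma pull_pi_eq {ι : Type} [Fintype ι] [DecidableEq ι] (X : ι → Type) [∀ j, AddCommGroup (X j)]
    [∀ j, Module R (X j)] (i : ℕ) (e : EM R ((j : ι) → X j) N i) :
    e = ∑ j, pull N (LinearMap.proj j : ((j : ι) → X j) →ₗ[R] X j) i
      (pull N (LinearMap.single R X j) i e) := by
  have : (LinearMap.id : ((j : ι) → X j) →ₗ[R] ((j : ι) → X j)) =
      ∑ j, (LinearMap.single R X j) ∘ₗ (LinearMap.proj j : ((j : ι) → X j) →ₗ[R] X j) := by
    ext j x l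
    simp [Finset.sum_apply]
  conv_lhs => rw [← pull_id i e, this, pull_sum]
  simp only [pull_comp]

lemma EM_pi_subsingleton {ι : Type} [Fintype ι] (X : ι → Type) [∀ j, AddCommGroup (X j)]
    [∀ j, Module R (X j)] (i : ℕ) (h : ∀ j, Subsingleton (EM R (X j) N i)) :
    Subsingleton (EM R ((j : ι) → X j) N i) := by
  classical
  refine subsingleton_of_forall_eq 0 fun e => ?_
  rw [pull_pi_eq X i e]
  apply Finset.sum_eq_zero
  intro j _
  rw [Subsingleton.elim (pull N (LinearMap.single R X j) i e) 0, map_zero]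
end ExtLayer


section E1
open MvPolynomial
variable (k : Type) [Field k] {n : ℕ}

/-- face ring of a simplex -/
abbrev kF (σ : Finset (Fin n)) : Type := mQ k (LowerSet.Iic σ)

lemma SesData.se {ι : Type} [Fintype ι] (D : SesData (n := n) ι) :
    SE (D.inc k) (resMap D.Γ D.Γ' D.le) :=
  ⟨D.inc_inj, resMap_surj _ _ _, D.exact⟩

lemma mulMap_comp_smul (v : Fin n) (Γ : LowerSet (Finset (Fin n))) (h) (r : mQ k Γ) :
    mulMap {v} Γ Γ h r = (X v : MvPolynomial (Fin n) k) • r := by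
  obtain ⟨f, rfl⟩ := Ideal.Quotient.mk_surjective r
  rw [mulMap_mk, ← prod_X_eq]
  rw [Finset.prod_singleton]
  rfl

/-- multiplication by a variable -/
noncomputable def xv (σ : Finset (Fin n)) (v : Fin n) : kF k σ →ₗ[MvPolynomial (Fin n) k] kF k σ :=
  mulMap {v} (LowerSet.Iic σ) (LowerSet.Iic σ)
    (fun _ hs => LowerSet.mem_Iic_iff.2 (Finset.subset_union_left.trans (LowerSet.mem_Iic_iff.1 hs)))

lemma xv_apply (σ : Finset (Fin n)) (v : Fin n) (r : kF k σ) :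
    xv k σ v r = (X v : MvPolynomial (Fin n) k) • r := mulMap_comp_smul k v _ _ r

lemma se_cone (σ : Finset (Fin n)) (v : Fin n) (hv : v ∈ σ) (hle : LowerSet.Iic (σ.erase v) ≤ LowerSet.Iic σ) :
    SE (xv k σ v)
      (resMap (LowerSet.Iic σ) (LowerSet.Iic (σ.erase v)) hle) := by
  let D : SesData (n := n) Unit :=
    { F := fun _ => σ
      μ := fun _ => {v}
      Γ := LowerSet.Iic σ
      Γ' := LowerSet.Iic (σ.erase v)
      le := hle
      h1 := fun _ s hs => (Finset.subset_union_left.trans hs : s ⊆ σ)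
      h2 := by
        intro s hs hs'
        refine ⟨(), ?_, hs⟩
        have hs1 : s ⊆ σ := hs
        have hs2 : ¬ s ⊆ σ.erase v := hs'
        rw [Finset.singleton_subset_iff]
        by_contra h
        exact hs2 (Finset.subset_erase.2 ⟨hs1, h⟩)
      h3 := by
        intro _ s hs
        constructor
        · exact Finset.union_subset hs (by simpa using hv)
        · intro h
          have h' : s ∪ {v} ⊆ σ.erase v := h
          have := h' (by simp : v ∈ s ∪ {v})
          simp at this
      h4 := fun _ _ _ _ => rfl }
  have h := D.se k
  have e : ∀ r, D.inc k (fun _ => r) = xv k σ v r := by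
    intro r
    rw [SesData.inc_apply]
    simp only [Finset.univ_unique, Finset.sum_singleton]
    rfl
  refine ⟨fun a b hab => ?_, h.surj, fun r => ?_⟩
  · have := h.inj ((e a).trans (hab.trans (e b).symm))
    exact congrFun this ()
  · refine (h.ex r).trans ⟨?_, ?_⟩
    · rintro ⟨f, rfl⟩
      exact ⟨f (), (e _).symm⟩
    · rintro ⟨f, rfl⟩
      exact ⟨fun _ => f, e f⟩

/-- Ext of face rings of simplices -/
def E1P (σ : Finset (Fin n)) : Prop :=
  ∀ i : ℕ, (i + σ.card ≠ n → Subsingleton (EM (MvPolynomial (Fin n) k) (kF k σ) (MvPolynomial (Fin n) k) i)) ∧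
    (i + σ.card = n → Nonempty (EM (MvPolynomial (Fin n) k) (kF k σ) (MvPolynomial (Fin n) k) i
      ≃ₗ[MvPolynomial (Fin n) k] kF k σ))

lemma E1_univ : E1P k (Finset.univ : Finset (Fin n)) := by
  have hbot : mI k (LowerSet.Iic (Finset.univ : Finset (Fin n))) = ⊥ := by
    rw [eq_bot_iff]
    intro f hf
    rw [mem_mI] at hf
    rw [Ideal.mem_bot, ← MvPolynomial.support_eq_empty, Finset.eq_empty_iff_forall_notMem]
    intro t ht
    exact hf t ht (Finset.subset_univ t.support)
  let e : kF k (Finset.univ : Finset (Fin n)) ≃ₗ[MvPolynomial (Fin n) k] MvPolynomial (Fin n) k :=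
    Submodule.quotEquivOfEqBot _ hbot
  have : Module.Projective (MvPolynomial (Fin n) k) (kF k (Finset.univ : Finset (Fin n))) :=
    Module.Projective.of_equiv e.symm
  have hp : Projective (ModuleCat.of (MvPolynomial (Fin n) k) (kF k (Finset.univ : Finset (Fin n)))) :=
    inferInstance
  intro i
  cases i with
  | zero =>
    refine ⟨fun h => (h (by simp)).elim, fun _ => ?_⟩
    have e1 := Abelian.Ext.linearEquiv₀ (R := MvPolynomial (Fin n) k)
      (X := ModuleCat.of (MvPolynomial (Fin n) k) (kF k (Finset.univ : Finset (Fin n))))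
      (Y := ModuleCat.of (MvPolynomial (Fin n) k) (MvPolynomial (Fin n) k))
    have e2 := ModuleCat.homLinearEquiv (S := MvPolynomial (Fin n) k)
      (M := ModuleCat.of (MvPolynomial (Fin n) k) (kF k (Finset.univ : Finset (Fin n))))
      (N := ModuleCat.of (MvPolynomial (Fin n) k) (MvPolynomial (Fin n) k))
    exact ⟨e1 ≪≫ₗ e2 ≪≫ₗ (LinearEquiv.congrLeft _ _ e) ≪≫ₗ (LinearMap.ringLmapEquivSelf _ _ _) ≪≫ₗ e.symm⟩
  | succ i =>
    refine ⟨fun _ => Abelian.Ext.subsingleton_of_projective _ _ i, fun h => ?_⟩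
    simp at h

lemma E1_step (σ : Finset (Fin n)) (v : Fin n) (hv : v ∈ σ) (h : E1P k σ) : E1P k (σ.erase v) := by
  have hle : LowerSet.Iic (σ.erase v) ≤ LowerSet.Iic σ := by
    rw [LowerSet.Iic_le]
    exact Finset.erase_subset v σ
  have hse := se_cone k σ v hv hle
  have hpull : ∀ i (e : EM (MvPolynomial (Fin n) k) (kF k σ) (MvPolynomial (Fin n) k) i),
      pull (MvPolynomial (Fin n) k) (xv k σ v) i e = (X v : MvPolynomial (Fin n) k) • e := by
    intro i e
    rw [← pull_smul_id]
    rw [show xv k σ v = (X v : MvPolynomial (Fin n) k) • LinearMap.id from LinearMap.ext fun r => xv_apply k σ v r]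
  have hcard : (σ.erase v).card + 1 = σ.card := Finset.card_erase_add_one hv
  have hcn : σ.card ≤ n := by simpa using Finset.card_le_univ σ
  -- X v acts injectively on all Ext^i(k[σ],S)
  have hinj : ∀ i (e : EM (MvPolynomial (Fin n) k) (kF k σ) (MvPolynomial (Fin n) k) i),
      (X v : MvPolynomial (Fin n) k) • e = 0 → e = 0 := by
    intro i e he
    by_cases hi : i + σ.card = n
    · obtain ⟨u⟩ := (h i).2 hi
      apply u.injective
      rw [map_zero]
      apply hse.inj
      rw [xv_apply, ← map_smul, he, map_zero, map_zero]
    · have := (h i).1 hi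
      exact Subsingleton.elim _ _
  intro i
  cases i with
  | zero =>
    refine ⟨fun _ => ?_, fun h0 => by omega⟩
    refine subsingleton_of_forall_eq 0 fun e => ?_
    apply hse.pull_inj_zero
    rw [map_zero]
    apply hinj
    rw [← hpull, ← pull_comp]
    have : (resMap (LowerSet.Iic σ) (LowerSet.Iic (σ.erase v)) hle) ∘ₗ (xv k σ v) = 0 := by
      refine LinearMap.ext fun r => ?_
      exact hse.ex.apply_apply_eq_zero _
    rw [this, pull_zero]
  | succ i =>
    have hz : ∀ e : EM (MvPolynomial (Fin n) k) (kF k (σ.erase v)) (MvPolynomial (Fin n) k) (i+1),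
        pull (MvPolynomial (Fin n) k) (resMap (LowerSet.Iic σ) (LowerSet.Iic (σ.erase v)) hle) (i+1) e = 0 := by
      intro e
      apply hinj
      rw [← hpull, ← pull_comp]
      have : (resMap (LowerSet.Iic σ) (LowerSet.Iic (σ.erase v)) hle) ∘ₗ (xv k σ v) = 0 := by
        refine LinearMap.ext fun r => ?_
        exact hse.ex.apply_apply_eq_zero _
      rw [this, pull_zero]
    have hsurj : Function.Surjective (hse.delta (MvPolynomial (Fin n) k) i) := fun e => hse.ex3 i e (hz e)
    constructor
    · intro hne
      have := (h i).1 (by omega)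
      exact hsurj.subsingleton
    · intro heq
      obtain ⟨u⟩ := (h i).2 (by omega)
      let D := (hse.delta (MvPolynomial (Fin n) k) i) ∘ₗ u.symm.toLinearMap
      have hD : Function.Surjective D := hsurj.comp u.symm.surjective
      have hk : LinearMap.ker D = LinearMap.ker (resMap (k := k) (LowerSet.Iic σ) (LowerSet.Iic (σ.erase v)) hle) := by
        ext r
        rw [LinearMap.mem_ker, LinearMap.mem_ker, hse.ex r]
        constructor
        · intro hr
          obtain ⟨e', he'⟩ := hse.ex1 i _ hr
          refine ⟨u e', ?_⟩
          rw [xv_apply, ← map_smul, ← hpull, he']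
          simp
        · rintro ⟨r', rfl⟩
          change hse.delta (MvPolynomial (Fin n) k) i (u.symm _) = 0
          rw [xv_apply, map_smul, ← hpull]
          exact hse.delta_pull i _
      exact ⟨(LinearMap.quotKerEquivOfSurjective D hD).symm ≪≫ₗ Submodule.quotEquivOfEq _ _ hk ≪≫ₗ
        LinearMap.quotKerEquivOfSurjective _ hse.surj⟩

theorem E1 (σ : Finset (Fin n)) : E1P k σ := by
  have : ∀ τ : Finset (Fin n), E1P k (Finset.univ \ τ) := by
    intro τ
    induction τ using Finset.induction_on with
    | empty => simpa using E1_univ k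
    | insert a s ha ih =>
      have := E1_step k _ a (by simpa using ha) ih
      rwa [show (Finset.univ \ s).erase a = Finset.univ \ insert a s by ext; simp] at this
  have h2 := this (Finset.univ \ σ)
  simpa using h2
end E1


section Omega
open MvPolynomial
variable (k : Type) [Field k] {n : ℕ}

/-- skeleton: faces of cardinality `< j` -/
def skel (Δ : SC n) (j : ℕ) : LowerSet (Finset (Fin n)) :=
  ⟨{σ | σ ∈ Δ.faces ∧ σ.card < j}, fun _ _ h hb =>
    ⟨Δ.down_closed hb.1 h, (Finset.card_le_card h).trans_lt hb.2⟩⟩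

lemma mem_skel {Δ : SC n} {j : ℕ} {σ : Finset (Fin n)} : σ ∈ skel Δ j ↔ σ ∈ Δ.faces ∧ σ.card < j := Iff.rfl

lemma mem_iic {σ τ : Finset (Fin n)} : σ ∈ LowerSet.Iic τ ↔ σ ⊆ τ := Iff.rfl

/-- faces of cardinality `j` -/
abbrev Fc (Δ : SC n) (j : ℕ) : Type := {σ : Finset (Fin n) // σ ∈ Δ.faces ∧ σ.card = j}

lemma skel_h1 {Δ : SC n} {j : ℕ} {F s : Finset (Fin n)} (hF : F.card = j) (h : s ∪ F ∈ skel Δ (j+1)) :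
    s ⊆ F := by
  have h2 := (mem_skel.1 h).2
  have : F = s ∪ F := Finset.eq_of_subset_of_card_le Finset.subset_union_right (by omega)
  rw [this]; exact Finset.subset_union_left

abbrev skelData (Δ : SC n) (j : ℕ) : SesData (n := n) (Fc Δ j) where
  F F := F.1
  μ F := F.1
  Γ := skel Δ (j+1)
  Γ' := skel Δ j
  le := fun s hs => ⟨hs.1, hs.2.trans (Nat.lt_succ_self j)⟩
  h1 F s hs := skel_h1 F.2.2 hs
  h2 s hs hs' := by
    rw [mem_skel] at hs hs'
    refine ⟨⟨s, hs.1, ?_⟩, subset_rfl, subset_rfl⟩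
    have : ¬ s.card < j := fun h => hs' ⟨hs.1, h⟩
    omega
  h3 F s hs := by
    rw [Finset.union_eq_right.2 hs, mem_skel, mem_skel]
    exact ⟨⟨F.2.1, by have := F.2.2; omega⟩, fun h => by have := F.2.2; omega⟩
  h4 F G h1 h2 := by
    apply Subtype.ext
    exact subset_antisymm (Finset.subset_union_left.trans h2) (Finset.subset_union_right.trans h1)

/-- star -/
def starLow (Δ : SC n) (d : ℕ) (ρ : Finset (Fin n)) : LowerSet (Finset (Fin n)) :=
  ⟨{s | s ∪ ρ ∈ skel Δ d}, fun _ _ h hb => (skel Δ d).lower (Finset.union_subset_union_left h) hb⟩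

lemma mem_starLow {Δ : SC n} {j : ℕ} {ρ σ : Finset (Fin n)} : σ ∈ starLow Δ j ρ ↔ σ ∪ ρ ∈ skel Δ j := Iff.rfl

abbrev starData (Δ : SC n) (d : ℕ) (ρ : Finset (Fin n)) (hρ : ρ ∈ Δ.faces) (hc : ρ.card + 1 = d) :
    SesData (n := n) {F : Fc Δ d // ρ ⊆ F.1} where
  F F := F.1.1
  μ F := F.1.1 \ ρ
  Γ := starLow Δ (d+1) ρ
  Γ' := LowerSet.Iic ρ
  le := fun s hs => by
    have hs : s ⊆ ρ := hs
    rw [SetLike.mem_coe, mem_starLow, Finset.union_eq_right.2 hs, mem_skel]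
    exact ⟨hρ, by omega⟩
  h1 F s hs := by
    rw [mem_starLow, Finset.union_assoc, Finset.sdiff_union_of_subset F.2] at hs
    exact skel_h1 F.1.2.2 hs
  h2 s hs hs' := by
    rw [mem_starLow, mem_skel] at hs
    rw [mem_iic] at hs'
    have : s ∪ ρ ≠ ρ := fun h => hs' (Finset.union_eq_right.1 h)
    have h2 : ρ.card < (s ∪ ρ).card := Finset.card_lt_card
      ⟨Finset.subset_union_right, fun h => this (subset_antisymm h Finset.subset_union_right)⟩
    refine ⟨⟨⟨s ∪ ρ, hs.1, by omega⟩, Finset.subset_union_right⟩, ?_, Finset.subset_union_left⟩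
    intro x hx
    simp at hx; tauto
  h3 F s hs := by
    rw [mem_starLow, Finset.union_assoc, Finset.sdiff_union_of_subset F.2, Finset.union_eq_right.2 hs, mem_skel, mem_iic]
    refine ⟨⟨F.1.2.1, by have := F.1.2.2; omega⟩, fun h => ?_⟩
    have h1 : F.1.1 \ ρ ⊆ ρ := Finset.subset_union_right.trans h
    have h2 : F.1.1 ⊆ ρ := by
      intro x hx
      by_contra hx2
      exact hx2 (h1 (Finset.mem_sdiff.2 ⟨hx, hx2⟩))
    have := Finset.card_le_card h2
    have := F.1.2.2
    omega
  h4 F G h1 h2 := by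
    apply Subtype.ext; apply Subtype.ext
    have : G.1.1 ⊆ F.1.1 := by
      rw [← Finset.sdiff_union_of_subset G.2]
      exact Finset.union_subset (Finset.subset_union_right.trans h1) F.2
    exact (Finset.eq_of_subset_of_card_le this (by rw [F.1.2.2, G.1.2.2])).symm

abbrev coneData (F ρ : Finset (Fin n)) (h : ρ ⊆ F) (hne : F.card = ρ.card + 1) : SesData (n := n) Unit where
  F _ := F
  μ _ := F \ ρ
  Γ := LowerSet.Iic F
  Γ' := LowerSet.Iic ρ
  le := fun s hs => subset_trans (b := ρ) hs h
  h1 _ s hs := by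
    rw [mem_iic] at hs ⊢
    exact Finset.subset_union_left.trans hs
  h2 s hs hs' := by
    rw [mem_iic] at hs hs'
    refine ⟨(), ?_, hs⟩
    rw [Finset.not_subset] at hs'
    obtain ⟨x, hx, hx'⟩ := hs'
    have h1 : (F \ ρ).card = 1 := by rw [Finset.card_sdiff_of_subset h]; omega
    rw [Finset.card_eq_one] at h1
    obtain ⟨w, hw⟩ := h1
    have : x ∈ F \ ρ := Finset.mem_sdiff.2 ⟨hs hx, hx'⟩
    rw [hw] at this ⊢
    rw [Finset.mem_singleton] at this
    rw [Finset.singleton_subset_iff, ← this]; exact hx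
  h3 _ s hs := by
    rw [mem_iic, mem_iic]
    refine ⟨Finset.union_subset hs Finset.sdiff_subset, fun h2 => ?_⟩
    have h1 : (F \ ρ).card = 1 := by rw [Finset.card_sdiff_of_subset h]; omega
    rw [Finset.card_eq_one] at h1
    obtain ⟨w, hw⟩ := h1
    have hw2 : w ∈ F \ ρ := by rw [hw]; simp
    exact (Finset.mem_sdiff.1 hw2).2 (h2 (Finset.mem_union_right _ hw2))
  h4 _ _ _ _ := rfl

/-- Ext vanishing -/
theorem E3 (Δ : SC n) (j i : ℕ) (h : i + j ≤ n) :
    Subsingleton (EM (MvPolynomial (Fin n) k) (mQ k (skel Δ j)) (MvPolynomial (Fin n) k) i) := by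
  induction j with
  | zero =>
    have hs : Subsingleton (mQ k (skel Δ 0)) := by
      refine subsingleton_of_forall_eq 0 fun r => rc_ext fun t ht => ?_
      exact absurd ht.2 (Nat.not_lt_zero _)
    refine subsingleton_of_forall_eq 0 fun e => ?_
    rw [← pull_id i e, show (LinearMap.id : mQ k (skel Δ 0) →ₗ[MvPolynomial (Fin n) k] mQ k (skel Δ 0)) = 0
      from LinearMap.ext fun r => Subsingleton.elim _ _, pull_zero]
  | succ j ih =>
    have ih := ih (by omega)
    have hse := (skelData Δ j).se k
    have hJ : Subsingleton (EM (MvPolynomial (Fin n) k) ((F : Fc Δ j) → kF k F.1) (MvPolynomial (Fin n) k) i) := by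
      apply EM_pi_subsingleton
      intro F
      exact (E1 k F.1 i).1 (by have := F.2.2; omega)
    refine subsingleton_of_forall_eq 0 fun e => ?_
    obtain ⟨e', he'⟩ := hse.ex2 i e (@Subsingleton.elim _ hJ _ _)
    rw [← he', @Subsingleton.elim _ ih e' 0]
    exact map_zero _

/-- multiplication by `x_ρ` -/
noncomputable def cmap (Δ : SC n) (d : ℕ) (ρ : Finset (Fin n)) (hc : ρ.card + 1 = d) :
    kF k ρ →ₗ[MvPolynomial (Fin n) k] mQ k (skel Δ d) :=
  mulMap ρ (LowerSet.Iic ρ) (skel Δ d) (fun s hs => by subst hc; exact skel_h1 rfl hs)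

lemma joint_inj (Δ : SC n) (d i : ℕ) (h : i + d ≤ n + 1)
    (y : EM (MvPolynomial (Fin n) k) (mQ k (skel Δ d)) (MvPolynomial (Fin n) k) i)
    (hy : ∀ ρ ∈ Δ.faces, ∀ (hc : ρ.card + 1 = d), pull _ (cmap k Δ d ρ hc) i y = 0) (hi : 1 ≤ i) : y = 0 := by
  cases d with
  | zero =>
    have hs : Subsingleton (mQ k (skel Δ 0)) := by
      refine subsingleton_of_forall_eq 0 fun r => rc_ext fun t ht => ?_
      exact absurd ht.2 (Nat.not_lt_zero _)
    rw [← pull_id i y, show (LinearMap.id : mQ k (skel Δ 0) →ₗ[MvPolynomial (Fin n) k] mQ k (skel Δ 0)) = 0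
      from LinearMap.ext fun r => Subsingleton.elim _ _, pull_zero]
  | succ e =>
    have hse := (skelData Δ e).se k
    obtain ⟨y', hy'⟩ := hse.ex2 i y (by
      classical
      rw [pull_pi_eq _ i (pull _ ((skelData Δ e).inc k) i y)]
      apply Finset.sum_eq_zero
      intro F _
      have : (skelData Δ e).inc k ∘ₗ LinearMap.single (MvPolynomial (Fin n) k) (fun F => mQ k (LowerSet.Iic ((skelData Δ e).F F))) F
          = cmap k Δ (e+1) F.1 (by rw [F.2.2]) := by
        refine LinearMap.ext fun r => ?_
        rw [LinearMap.comp_apply, SesData.inc_apply, Finset.sum_eq_single F]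
        · rw [LinearMap.single_apply, Pi.single_eq_same]; rfl
        · intro G _ hG
          rw [LinearMap.single_apply, Pi.single_eq_of_ne hG, map_zero]
        · simp
      have h0 := (pull_comp _ _ i y).symm.trans (this ▸ hy F.1 F.2.1 (by rw [F.2.2]) :
        pull _ ((skelData Δ e).inc k ∘ₗ LinearMap.single (MvPolynomial (Fin n) k) (fun F => mQ k (LowerSet.Iic ((skelData Δ e).F F))) F) i y = 0)
      exact (congrArg _ h0).trans (map_zero _))
    rw [← hy', @Subsingleton.elim _ (E3 k Δ e i (by omega)) y' 0]
    exact map_zero _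

end Omega


section Omega2
open MvPolynomial
variable (k : Type) [Field k] {n : ℕ}

lemma nat1 (Δ : SC n) (d c : ℕ) (ρ : Finset (Fin n)) (hρ : ρ ∈ Δ.faces) (hc : ρ.card + 1 = d)
    (F : Fc Δ d) (e : EM (MvPolynomial (Fin n) k) (kF k F.1) (MvPolynomial (Fin n) k) c)
    (p : ((i : {F : Fc Δ d // ρ ⊆ F.1}) → kF k i.1.1) →ₗ[MvPolynomial (Fin n) k] kF k F.1)
    (hp : ∀ f, p f = if h : ρ ⊆ F.1 then f ⟨F, h⟩ else 0) :
    pull (MvPolynomial (Fin n) k) (cmap k Δ d ρ hc) (c+1)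
      (((skelData Δ d).se k).delta (MvPolynomial (Fin n) k) c
        (pull (MvPolynomial (Fin n) k) (LinearMap.proj F : ((i : Fc Δ d) → kF k i.1) →ₗ[MvPolynomial (Fin n) k] kF k F.1) c e)) =
    ((starData Δ d ρ hρ hc).se k).delta (MvPolynomial (Fin n) k) c
        (pull (MvPolynomial (Fin n) k) p c e) := by
  classical
  let a : ((i : {F : Fc Δ d // ρ ⊆ F.1}) → kF k i.1.1) →ₗ[MvPolynomial (Fin n) k] ((i : Fc Δ d) → kF k i.1) :=
    LinearMap.pi (fun F => if h : ρ ⊆ F.1 then LinearMap.proj (⟨F, h⟩ : {F : Fc Δ d // ρ ⊆ F.1}) else 0)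
  have hpa : p = (LinearMap.proj F : ((i : Fc Δ d) → kF k i.1) →ₗ[MvPolynomial (Fin n) k] kF k F.1) ∘ₗ a := by
    refine LinearMap.ext fun f => ?_
    rw [hp, LinearMap.comp_apply, LinearMap.proj_apply, LinearMap.pi_apply]
    split_ifs <;> rfl
  rw [hpa, pull_comp]
  symm
  refine SE.natural ((starData Δ d ρ hρ hc).se k) ((skelData Δ d).se k) a
    (mulMap ρ (starLow Δ (d+1) ρ) (skel Δ (d+1)) (fun s hs => mem_starLow.2 hs)) (cmap k Δ d ρ hc) ?_ ?_ c _
  · refine LinearMap.ext fun f => ?_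
    rw [LinearMap.comp_apply, LinearMap.comp_apply, SesData.inc_apply, SesData.inc_apply, map_sum]
    rw [← Fintype.sum_subtype_add_sum_subtype (fun F : Fc Δ d => ρ ⊆ F.1) (fun i => (mulMap _ _ _ _) (a f i))]
    rw [Finset.sum_eq_zero (s := (Finset.univ : Finset {x : Fc Δ d // ¬ ρ ⊆ x.1})), add_zero]
    · apply Finset.sum_congr rfl
      intro G _
      have : a f G.1 = f G := by
        rw [LinearMap.pi_apply, dif_pos G.2]; rfl
      rw [this]
      obtain ⟨g, hg⟩ := Ideal.Quotient.mk_surjective (f G)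
      rw [← hg, mulMap_mk, mulMap_mk, mulMap_mk, ← mul_assoc, monomial_mul, one_mul]
      have hind : ind ρ + ind ((starData Δ d ρ hρ hc).μ G) = ind ((skelData Δ d).μ G.1) := by
        refine Finsupp.ext fun i => ?_
        rw [Finsupp.add_apply, ind_apply, ind_apply, ind_apply]
        have := @G.2 i
        by_cases h1 : i ∈ ρ <;> simp_all
      rw [hind]
    · intro G _
      have : a f G.1 = 0 := by
        rw [LinearMap.pi_apply, dif_neg G.2]; rfl
      rw [this, map_zero]
  · refine LinearMap.ext fun f => ?_
    obtain ⟨g, rfl⟩ := Ideal.Quotient.mk_surjective f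
    rw [LinearMap.comp_apply, LinearMap.comp_apply, resMap_mk, mulMap_mk, resMap_mk, cmap, mulMap_mk]

lemma nat2 (Δ : SC n) (d c : ℕ) (ρ : Finset (Fin n)) (hρ : ρ ∈ Δ.faces) (hc : ρ.card + 1 = d)
    (F : Fc Δ d) (hF : ρ ⊆ F.1) (e : EM (MvPolynomial (Fin n) k) (kF k F.1) (MvPolynomial (Fin n) k) c)
    (hne : F.1.card = ρ.card + 1) :
    ((starData Δ d ρ hρ hc).se k).delta (MvPolynomial (Fin n) k) c
        (pull (MvPolynomial (Fin n) k)
          (LinearMap.proj (⟨F, hF⟩ : {F : Fc Δ d // ρ ⊆ F.1}) : ((i : {F : Fc Δ d // ρ ⊆ F.1}) → kF k i.1.1) →ₗ[MvPolynomial (Fin n) k] kF k F.1) c e) =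
    ((coneData F.1 ρ hF hne).se k).delta (MvPolynomial (Fin n) k) c
        (pull (MvPolynomial (Fin n) k) (LinearMap.proj () : ((i : Unit) → kF k F.1) →ₗ[MvPolynomial (Fin n) k] kF k F.1) c e) := by
  classical
  let a : ((i : {F : Fc Δ d // ρ ⊆ F.1}) → kF k i.1.1) →ₗ[MvPolynomial (Fin n) k] ((i : Unit) → kF k F.1) :=
    LinearMap.pi (fun _ => LinearMap.proj (⟨F, hF⟩ : {F : Fc Δ d // ρ ⊆ F.1}))
  have hpa : (LinearMap.proj (⟨F, hF⟩ : {F : Fc Δ d // ρ ⊆ F.1}) : ((i : {F : Fc Δ d // ρ ⊆ F.1}) → kF k i.1.1) →ₗ[MvPolynomial (Fin n) k] kF k F.1) = (LinearMap.proj () : ((i : Unit) → kF k F.1) →ₗ[MvPolynomial (Fin n) k] kF k F.1) ∘ₗ a := rfl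
  rw [hpa, pull_comp]
  have hle : LowerSet.Iic F.1 ≤ starLow Δ (d+1) ρ := by
    intro s hs
    have hs : s ⊆ F.1 := hs
    refine ⟨Δ.down_closed F.2.1 (Finset.union_subset hs hF), ?_⟩
    have := Finset.card_le_card (Finset.union_subset hs hF)
    have := F.2.2
    omega
  have := SE.natural (N := MvPolynomial (Fin n) k) ((starData Δ d ρ hρ hc).se k) ((coneData F.1 ρ hF hne).se k) a
    (resMap (starLow Δ (d+1) ρ) (LowerSet.Iic F.1) hle) LinearMap.id ?_ ?_ c
      (pull (MvPolynomial (Fin n) k) (LinearMap.proj () : ((i : Unit) → kF k F.1) →ₗ[MvPolynomial (Fin n) k] kF k F.1) c e)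
  · rw [this, pull_id]
  · refine LinearMap.ext fun f => ?_
    rw [LinearMap.comp_apply, LinearMap.comp_apply, SesData.inc_apply, SesData.inc_apply, map_sum]
    rw [Finset.sum_eq_single (⟨F, hF⟩ : {F : Fc Δ d // ρ ⊆ F.1})]
    · rw [Fintype.sum_unique]
      have : a f () = f ⟨F, hF⟩ := rfl
      rw [show (default : Unit) = () from rfl, this]
      obtain ⟨g, hg⟩ := Ideal.Quotient.mk_surjective (f ⟨F, hF⟩)
      rw [← hg, mulMap_mk, mulMap_mk, resMap_mk]
    · intro G _ hG
      apply rc_ext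
      intro t ht
      rw [rc_resMap _ _ _ _ ht, rc_mulMap_not, map_zero]
      intro h
      apply hG
      apply Subtype.ext; apply Subtype.ext
      have ht : t.support ⊆ F.1 := ht
      have h1 : G.1.1 ⊆ F.1 := by
        rw [← Finset.sdiff_union_of_subset G.2]
        exact Finset.union_subset (h.trans ht) hF
      exact Finset.eq_of_subset_of_card_le h1 (by rw [F.2.2, G.1.2.2])
    · intro h; exact absurd (Finset.mem_univ _) h
  · refine LinearMap.ext fun f => ?_
    obtain ⟨g, rfl⟩ := Ideal.Quotient.mk_surjective f
    rw [LinearMap.comp_apply, LinearMap.comp_apply, resMap_mk, resMap_mk, resMap_mk]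
    rfl

end Omega2


section Omega3
open MvPolynomial
variable (k : Type) [Field k] {n : ℕ}

/-- ridges -/
abbrev Rd (Δ : SC n) (d : ℕ) : Type := {ρ : Finset (Fin n) // ρ ∈ Δ.faces ∧ ρ.card + 1 = d}

noncomputable def uF (Δ : SC n) (d c : ℕ) (hcd : c + d = n) (F : Fc Δ d) :
    EM (MvPolynomial (Fin n) k) (kF k F.1) (MvPolynomial (Fin n) k) c ≃ₗ[MvPolynomial (Fin n) k] kF k F.1 :=
  Classical.choice ((E1 k F.1 c).2 (by rw [F.2.2]; exact hcd))

noncomputable def uR (Δ : SC n) (d c : ℕ) (hcd : c + d = n) (ρ : Rd Δ d) :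
    EM (MvPolynomial (Fin n) k) (kF k ρ.1) (MvPolynomial (Fin n) k) (c+1) ≃ₗ[MvPolynomial (Fin n) k] kF k ρ.1 :=
  Classical.choice ((E1 k ρ.1 (c+1)).2 (by have := ρ.2.2; omega))

abbrev PF (Δ : SC n) (d : ℕ) : Type := (F : Fc Δ d) → kF k F.1

noncomputable def prF (Δ : SC n) (d : ℕ) (F : Fc Δ d) : PF k Δ d →ₗ[MvPolynomial (Fin n) k] kF k F.1 :=
  LinearMap.proj F

open Classical in
noncomputable def siF (Δ : SC n) (d : ℕ) (F : Fc Δ d) : kF k F.1 →ₗ[MvPolynomial (Fin n) k] PF k Δ d :=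
  LinearMap.single (MvPolynomial (Fin n) k) (fun F : Fc Δ d => kF k F.1) F

noncomputable def incF (Δ : SC n) (d : ℕ) : PF k Δ d →ₗ[MvPolynomial (Fin n) k] mQ k (skel Δ (d+1)) :=
  (skelData Δ d).inc k

noncomputable def resF (Δ : SC n) (d : ℕ) : mQ k (skel Δ (d+1)) →ₗ[MvPolynomial (Fin n) k] mQ k (skel Δ d) :=
  resMap _ _ (skelData Δ d).le

lemma seF (Δ : SC n) (d : ℕ) : SE (incF k Δ d) (resF k Δ d) := (skelData Δ d).se k

noncomputable def deltaF (Δ : SC n) (d c : ℕ) : EM (MvPolynomial (Fin n) k) (PF k Δ d) (MvPolynomial (Fin n) k) c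
    →ₗ[MvPolynomial (Fin n) k] EM (MvPolynomial (Fin n) k) (mQ k (skel Δ d)) (MvPolynomial (Fin n) k) (c+1) :=
  (seF k Δ d).delta (MvPolynomial (Fin n) k) c

noncomputable def psi (Δ : SC n) (d c : ℕ) (hcd : c + d = n) :
    EM (MvPolynomial (Fin n) k) (mQ k (skel Δ (d+1))) (MvPolynomial (Fin n) k) c →ₗ[MvPolynomial (Fin n) k] PF k Δ d :=
  LinearMap.pi fun F => (uF k Δ d c hcd F).toLinearMap ∘ₗ pull _ (siF k Δ d F) c ∘ₗ pull _ (incF k Δ d) c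

lemma psi_apply (Δ : SC n) (d c : ℕ) (hcd : c + d = n) (e) (F : Fc Δ d) : psi k Δ d c hcd e F =
  uF k Δ d c hcd F (pull _ (siF k Δ d F) c (pull _ (incF k Δ d) c e)) := rfl

noncomputable def TT (Δ : SC n) (d c : ℕ) (hcd : c + d = n) (F : Fc Δ d) (ρ : Rd Δ d) :
    kF k F.1 →ₗ[MvPolynomial (Fin n) k] kF k ρ.1 :=
  (uR k Δ d c hcd ρ).toLinearMap ∘ₗ pull _ (cmap k Δ d ρ.1 ρ.2.2) (c+1) ∘ₗ deltaF k Δ d c ∘ₗ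
    pull _ (prF k Δ d F) c ∘ₗ (uF k Δ d c hcd F).symm.toLinearMap

lemma TT_apply (Δ : SC n) (d c : ℕ) (hcd : c + d = n) (F : Fc Δ d) (ρ : Rd Δ d) (x) :
    TT k Δ d c hcd F ρ x = uR k Δ d c hcd ρ (pull _ (cmap k Δ d ρ.1 ρ.2.2) (c+1) (deltaF k Δ d c
    (pull _ (prF k Δ d F) c ((uF k Δ d c hcd F).symm x)))) := rfl

noncomputable def EE (Δ : SC n) (d c : ℕ) (hcd : c + d = n) (f : PF k Δ d) :
    EM (MvPolynomial (Fin n) k) (PF k Δ d) (MvPolynomial (Fin n) k) c :=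
  ∑ F, pull _ (prF k Δ d F) c ((uF k Δ d c hcd F).symm (f F))

lemma EE1 (Δ : SC n) (d c : ℕ) (hcd : c + d = n) (f : PF k Δ d) (ρ : Rd Δ d) :
    ∑ F, TT k Δ d c hcd F ρ (f F) = uR k Δ d c hcd ρ (pull _ (cmap k Δ d ρ.1 ρ.2.2) (c+1)
      (deltaF k Δ d c (EE k Δ d c hcd f))) := by
  simp only [TT_apply, EE]
  rw [map_sum (deltaF k Δ d c), map_sum (pull _ (cmap k Δ d ρ.1 ρ.2.2) (c+1)), map_sum (uR k Δ d c hcd ρ)]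

lemma EE2 (Δ : SC n) (d c : ℕ) (hcd : c + d = n) (e) :
    EE k Δ d c hcd (psi k Δ d c hcd e) = pull _ (incF k Δ d) c e := by
  classical
  simp only [EE, psi_apply, LinearEquiv.symm_apply_apply]
  refine Eq.trans ?_ (pull_pi_eq (fun F : Fc Δ d => kF k F.1) c _).symm
  apply Finset.sum_congr rfl
  intro F _
  rw [siF, prF]

lemma EE3 (Δ : SC n) (d c : ℕ) (hcd : c + d = n) (f : PF k Δ d) (F : Fc Δ d) :
    uF k Δ d c hcd F (pull _ (siF k Δ d F) c (EE k Δ d c hcd f)) = f F := by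
  classical
  rw [EE]
  rw [map_sum, map_sum, Finset.sum_eq_single F]
  · have : prF k Δ d F ∘ₗ siF k Δ d F = LinearMap.id := LinearMap.proj_comp_single_same _ _ _
    rw [← pull_comp, this, pull_id, LinearEquiv.apply_symm_apply]
  · intro G _ hG
    have : prF k Δ d G ∘ₗ siF k Δ d F = 0 := LinearMap.proj_comp_single_ne _ _ _ _ hG
    rw [← pull_comp, this, pull_zero, map_zero]
  · simp

lemma psi_inj (Δ : SC n) (d c : ℕ) (hcd : c + d = n) : Function.Injective (psi k Δ d c hcd) := by
  rw [← LinearMap.ker_eq_bot, LinearMap.ker_eq_bot']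
  intro e he
  have h1 : pull _ (incF k Δ d) c e = 0 := by
    rw [← EE2 k Δ d c hcd, he]
    simp [EE]
  obtain ⟨e', he'⟩ := (seF k Δ d).ex2 c e h1
  rw [← he', @Subsingleton.elim _ (E3 k Δ d c hcd.le) e' 0]
  exact map_zero _

lemma TT_zero (Δ : SC n) (d c : ℕ) (hcd : c + d = n) (F : Fc Δ d) (ρ : Rd Δ d) (h : ¬ ρ.1 ⊆ F.1) :
    TT k Δ d c hcd F ρ = 0 := by
  refine LinearMap.ext fun x => ?_
  have := nat1 k Δ d c ρ.1 ρ.2.1 ρ.2.2 F ((uF k Δ d c hcd F).symm x) 0 (fun f => by rw [dif_neg h]; rfl)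
  rw [pull_zero, map_zero] at this
  rw [TT_apply]
  exact (congrArg _ this).trans (map_zero _)

lemma TT_surj (Δ : SC n) (d c : ℕ) (hcd : c + d = n) (F : Fc Δ d) (ρ : Rd Δ d) (h : ρ.1 ⊆ F.1) :
    Function.Surjective (TT k Δ d c hcd F ρ) := by
  intro y
  have hne : F.1.card = ρ.1.card + 1 := by rw [F.2.2, ρ.2.2]
  have hc0 := (coneData F.1 ρ.1 h hne).se k
  obtain ⟨e', he'⟩ := hc0.ex3 (N := MvPolynomial (Fin n) k) c ((uR k Δ d c hcd ρ).symm y)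
    (@Subsingleton.elim _ ((E1 k F.1 (c+1)).1 (by rw [F.2.2]; omega)) _ _)
  have h3 := pull_pi_eq (N := MvPolynomial (Fin n) k) (fun _ : Unit => kF k F.1) c e'
  rw [Fintype.sum_unique] at h3
  let e1 := pull (MvPolynomial (Fin n) k) (LinearMap.single (MvPolynomial (Fin n) k) (fun _ : Unit => kF k F.1) ()) c e'
  have h1 := nat1 k Δ d c ρ.1 ρ.2.1 ρ.2.2 F e1 (LinearMap.proj (⟨F, h⟩ : {F : Fc Δ d // ρ.1 ⊆ F.1})) (fun f => by rw [dif_pos h]; rfl)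
  have h2 := nat2 k Δ d c ρ.1 ρ.2.1 ρ.2.2 F h e1 hne
  refine ⟨uF k Δ d c hcd F e1, ?_⟩
  rw [TT_apply, LinearEquiv.symm_apply_apply, ← LinearEquiv.eq_symm_apply]
  refine (h1.trans h2).trans (Eq.trans ?_ he')
  exact congrArg _ h3.symm

lemma psi_range (Δ : SC n) (d c : ℕ) (hcd : c + d = n) (f) :
    f ∈ LinearMap.range (psi k Δ d c hcd) ↔ ∀ ρ, ∑ F, TT k Δ d c hcd F ρ (f F) = 0 := by
  constructor
  · rintro ⟨e, rfl⟩ ρ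
    rw [EE1, EE2, deltaF, SE.delta_pull, map_zero, map_zero]
  · intro h
    have h1 : deltaF k Δ d c (EE k Δ d c hcd f) = 0 := by
      apply joint_inj k Δ d (c+1) (by omega) _ _ (by omega)
      intro ρ hρ hc
      have := h ⟨ρ, hρ, hc⟩
      rw [EE1, LinearEquiv.map_eq_zero_iff] at this
      exact this
    obtain ⟨e, he⟩ := (seF k Δ d).ex1 c _ h1
    refine ⟨e, ?_⟩
    funext F
    rw [psi_apply, ← EE3 k Δ d c hcd f F, ← he]

end Omega3


section Omega4
open MvPolynomial
variable (k : Type) [Field k] {n : ℕ}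

/-- kill the variables outside `ρ` -/
noncomputable def piH (ρ : Finset (Fin n)) : MvPolynomial (Fin n) k →ₐ[k] MvPolynomial (Fin n) k :=
  aeval (fun i => if i ∈ ρ then X i else 0)

lemma piH_X (ρ : Finset (Fin n)) (i : Fin n) : piH k ρ (X i) = if i ∈ ρ then X i else 0 := by
  simp [piH]

lemma piH_mI (ρ : Finset (Fin n)) (f) (hf : f ∈ mI k (LowerSet.Iic ρ)) : piH k ρ f = 0 := by
  have : mI k (LowerSet.Iic ρ) ≤ RingHom.ker (piH k ρ) := by
    rw [mI, Ideal.span_le]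
    rintro m ⟨σ, hσ, rfl⟩
    rw [mem_iic, Finset.not_subset] at hσ
    obtain ⟨x, hx, hx'⟩ := hσ
    rw [SetLike.mem_coe, RingHom.mem_ker, map_prod]
    apply Finset.prod_eq_zero hx
    rw [piH_X, if_neg hx']
  exact this hf

lemma X_mem_mI (ρ : Finset (Fin n)) (i : Fin n) (h : i ∉ ρ) : (X i : MvPolynomial (Fin n) k) ∈ mI k (LowerSet.Iic ρ) := by
  apply Ideal.subset_span
  exact ⟨{i}, by simpa [mem_iic] using h, by simp⟩

lemma mk_piH (ρ : Finset (Fin n)) (f) : Ideal.Quotient.mk (mI k (LowerSet.Iic ρ)) (piH k ρ f) = Ideal.Quotient.mk _ f := by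
  have : (Ideal.Quotient.mkₐ k (mI k (LowerSet.Iic ρ))).comp (piH k ρ) = Ideal.Quotient.mkₐ k (mI k (LowerSet.Iic ρ)) := by
    apply MvPolynomial.algHom_ext
    intro i
    rw [AlgHom.comp_apply, piH_X]
    split_ifs with h
    · rfl
    · rw [map_zero]
      exact (Ideal.Quotient.eq_zero_iff_mem.2 (X_mem_mI k ρ i h)).symm
  exact DFunLike.congr_fun this f

lemma smul_mQ {Γ : LowerSet (Finset (Fin n))} (f : MvPolynomial (Fin n) k) (r : mQ k Γ) :
    f • r = Ideal.Quotient.mk (mI k Γ) f * r := by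
  obtain ⟨g, rfl⟩ := Ideal.Quotient.mk_surjective r
  rfl

lemma eps_exists (F ρ : Finset (Fin n)) (φ : kF k F →ₗ[MvPolynomial (Fin n) k] kF k ρ) (h : ρ ⊆ F)
    (hs : Function.Surjective φ) : ∃ ε : k, ε ≠ 0 ∧ ∀ x t, t.support ⊆ ρ → rc _ t (φ x) = ε * rc _ t x := by
  have hφ : ∀ f, φ (Ideal.Quotient.mk _ f) = Ideal.Quotient.mk _ f * φ (Ideal.Quotient.mk _ 1) := by
    intro f
    have : Ideal.Quotient.mk (mI k (LowerSet.Iic F)) f = f • Ideal.Quotient.mk (mI k (LowerSet.Iic F)) 1 := by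
      rw [smul_mQ, map_one, mul_one]
    rw [this, map_smul, smul_mQ]
  obtain ⟨y, hy⟩ := hs 1
  obtain ⟨g, rfl⟩ := Ideal.Quotient.mk_surjective y
  obtain ⟨p, hp⟩ := Ideal.Quotient.mk_surjective (φ (Ideal.Quotient.mk _ 1))
  rw [hφ, ← hp, ← map_mul, ← map_one (Ideal.Quotient.mk _), Ideal.Quotient.eq] at hy
  have h1 := piH_mI k ρ _ hy
  rw [map_sub, map_one, map_mul, sub_eq_zero] at h1
  have hu : IsUnit (piH k ρ p) := IsUnit.of_mul_eq_one_right _ h1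
  rw [MvPolynomial.isUnit_iff_eq_C_of_isReduced] at hu
  obtain ⟨ε, hε, hε2⟩ := hu
  refine ⟨ε, hε.ne_zero, fun x t ht => ?_⟩
  obtain ⟨f, rfl⟩ := Ideal.Quotient.mk_surjective x
  rw [hφ, ← hp, ← mk_piH k ρ p, hε2, ← map_mul, rc_mk, rc_mk, if_pos (mem_iic.2 ht), if_pos (mem_iic.2 (ht.trans h)), mul_comm f, coeff_C_mul]

/-- full combinatorial description of Ext -/
theorem omegaDesc (Δ : SC n) (d c : ℕ) (hcd : c + d = n) :
    ∃ (Ψ : EM (MvPolynomial (Fin n) k) (mQ k (skel Δ (d+1))) (MvPolynomial (Fin n) k) c →ₗ[MvPolynomial (Fin n) k]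
        PF k Δ d)
      (ε : Fc Δ d → Rd Δ d → k),
      Function.Injective Ψ ∧ (∀ F ρ, ε F ρ ≠ 0 ↔ ρ.1 ⊆ F.1) ∧
      ∀ f, f ∈ LinearMap.range Ψ ↔ ∀ (ρ : Rd Δ d) (t : Fin n →₀ ℕ), t.support ⊆ ρ.1 → ∑ F, ε F ρ * rc _ t (f F) = 0 := by
  classical
  have : ∀ F ρ, ∃ ε : k, (ε ≠ 0 ↔ ρ.1 ⊆ F.1) ∧ ∀ x t, t.support ⊆ ρ.1 → rc _ t (TT k Δ d c hcd F ρ x) = ε * rc _ t x := by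
    intro F ρ
    by_cases h : ρ.1 ⊆ F.1
    · obtain ⟨ε, h1, h2⟩ := eps_exists k F.1 ρ.1 (TT k Δ d c hcd F ρ) h (TT_surj k Δ d c hcd F ρ h)
      exact ⟨ε, by simp [h1, h], h2⟩
    · refine ⟨0, by simp [h], fun x t _ => ?_⟩
      rw [TT_zero k Δ d c hcd F ρ h, LinearMap.zero_apply, map_zero, zero_mul]
  choose ε h1 h2 using this
  refine ⟨psi k Δ d c hcd, ε, psi_inj k Δ d c hcd, h1, fun f => ?_⟩
  rw [psi_range]
  refine forall_congr' fun ρ => ?_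
  constructor
  · intro h t ht
    have := congrArg (rc _ t) h
    rw [map_sum, map_zero] at this
    rw [← this]
    exact Finset.sum_congr rfl fun F _ => (h2 F ρ _ t ht).symm
  · intro h
    apply rc_ext
    intro t ht
    rw [map_sum, map_zero, ← h t ht]
    exact Finset.sum_congr rfl fun F _ => (h2 F ρ _ t ht)

end Omega4


section Omega5
open MvPolynomial
variable (k : Type) [Field k] {n : ℕ}

/-- Combinatorial data describing the canonical module. -/
structure OD (Δ : SC n) (d : ℕ) (ω : Type) [AddCommGroup ω] [Module (mQ k Δ.low) ω] where
  eps : Fc Δ d → Rd Δ d → k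
  heps : ∀ F ρ, eps F ρ ≠ 0 ↔ ρ.1 ⊆ F.1
  l : Fc Δ d → (Fin n →₀ ℕ) → ω →+ k
  ext : ∀ η η', (∀ F s, s.support ⊆ F.1 → l F s η = l F s η') → η = η'
  supp : ∀ F s η, ¬ s.support ⊆ F.1 → l F s η = 0
  smul_add : ∀ F s t η, (s + t).support ⊆ F.1 → l F (s + t) ((mon Δ.low s : mQ k Δ.low) • η) = l F t η
  smul_not_le : ∀ F s t η, ¬ s ≤ t → l F t ((mon Δ.low s : mQ k Δ.low) • η) = 0
  smul_C : ∀ F t (a : k) η, l F t ((Ideal.Quotient.mk _ (C a) : mQ k Δ.low) • η) = a * l F t η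
  fin : ∀ F η, {s | l F s η ≠ 0}.Finite
  cond : ∀ (ρ : Rd Δ d) t η, t.support ⊆ ρ.1 → ∑ F, eps F ρ * l F t η = 0
  exi : ∀ g : Fc Δ d → (Fin n →₀ ℕ) → k, (∀ F, {s | g F s ≠ 0}.Finite) →
    (∀ F s, ¬ s.support ⊆ F.1 → g F s = 0) →
    (∀ (ρ : Rd Δ d) t, t.support ⊆ ρ.1 → ∑ F, eps F ρ * g F t = 0) → ∃ η, ∀ F s, l F s η = g F s

variable {k}

lemma low_eq_skel {Δ : SC n} {d : ℕ} (hd : Δ.faces.sup Finset.card = d) : Δ.low = skel Δ (d+1) := by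
  apply SetLike.coe_injective
  ext σ
  change σ ∈ Δ.faces ↔ σ ∈ Δ.faces ∧ σ.card < d + 1
  have := fun h => Finset.le_sup (f := Finset.card) (s := Δ.faces) (b := σ) h
  rw [hd] at this
  constructor
  · intro h
    exact ⟨h, Nat.lt_succ_of_le (this h)⟩
  · exact fun h => h.1

theorem OD_exists (Δ : SC n) (d : ℕ) (hd : Δ.faces.sup Finset.card = d) (hdn : d ≤ n)
    (ω : Type) [AddCommGroup ω] [Module (mQ k Δ.low) ω]
    (e : letI : Module (MvPolynomial (Fin n) k) ω := Module.compHom ω (Ideal.Quotient.mk (mI k Δ.low))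
      Nonempty (ω ≃ₗ[MvPolynomial (Fin n) k] (extMod (MvPolynomial (Fin n) k) (mQ k Δ.low)
          (MvPolynomial (Fin n) k) (n - d)))) : Nonempty (OD k Δ d ω) := by
  have key : ∃ (Ψ : EM (MvPolynomial (Fin n) k) (mQ k Δ.low) (MvPolynomial (Fin n) k) (n-d) →ₗ[MvPolynomial (Fin n) k]
        PF k Δ d)
      (ε : Fc Δ d → Rd Δ d → k),
      Function.Injective Ψ ∧ (∀ F ρ, ε F ρ ≠ 0 ↔ ρ.1 ⊆ F.1) ∧
      ∀ f, f ∈ LinearMap.range Ψ ↔ ∀ (ρ : Rd Δ d) (t : Fin n →₀ ℕ), t.support ⊆ ρ.1 → ∑ F, ε F ρ * rc _ t (f F) = 0 := by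
    rw [low_eq_skel hd]
    exact omegaDesc k Δ d (n-d) (by omega)
  obtain ⟨Ψ, ε, h1, h2, h3⟩ := key
  letI : Module (MvPolynomial (Fin n) k) ω := Module.compHom ω (Ideal.Quotient.mk (mI k Δ.low))
  obtain ⟨e⟩ := e
  obtain ⟨e2⟩ := extMod_equiv (MvPolynomial (Fin n) k) (mQ k Δ.low) (MvPolynomial (Fin n) k) (n-d)
  let Φ : ω →ₗ[MvPolynomial (Fin n) k] PF k Δ d := Ψ ∘ₗ e2.toLinearMap ∘ₗ e.toLinearMap
  have hΦi : Function.Injective Φ := h1.comp (e2.injective.comp e.injective)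
  have hΦr : ∀ f, f ∈ LinearMap.range Ψ → ∃ η, Φ η = f := by
    rintro f ⟨x, rfl⟩
    refine ⟨e.symm (e2.symm x), ?_⟩
    simp [Φ]
  have hΦr' : ∀ η, Φ η ∈ LinearMap.range Ψ := fun η => ⟨_, rfl⟩
  have hsm : ∀ (f : MvPolynomial (Fin n) k) η, Φ ((Ideal.Quotient.mk (mI k Δ.low) f : mQ k Δ.low) • η) = f • Φ η :=
    fun f η => Φ.map_smul f η
  refine ⟨{ eps := ε, heps := h2, l := fun F s => (rc _ s).toAddMonoidHom.comp ((LinearMap.proj F : PF k Δ d →ₗ[MvPolynomial (Fin n) k] kF k F.1).toAddMonoidHom.comp Φ.toAddMonoidHom), ext := ?_, supp := ?_, smul_add := ?_, smul_not_le := ?_, smul_C := ?_, fin := ?_, cond := ?_, exi := ?_}⟩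
  · intro η η' h
    apply hΦi
    funext F
    apply rc_ext
    intro t ht
    exact h F t ht
  · intro F s η h
    exact rc_of_notMem (Γ := LowerSet.Iic F.1) h _
  · intro F s t η h
    refine Eq.trans ?_ (rc_smul_add (Γ := LowerSet.Iic F.1) s t (Φ η F) h)
    exact congrArg (fun z : PF k Δ d => rc _ _ (z F)) (hsm _ _)
  · intro F s t η h
    refine Eq.trans ?_ (rc_smul_of_not_le (Γ := LowerSet.Iic F.1) s t (Φ η F) h)
    exact congrArg (fun z : PF k Δ d => rc _ _ (z F)) (hsm _ _)
  · intro F t a η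
    refine Eq.trans (b := rc _ t ((C a : MvPolynomial (Fin n) k) • (Φ η F))) ?_ ?_
    · exact congrArg (fun z : PF k Δ d => rc _ _ (z F)) (hsm _ _)
    · change _ = a * rc _ t (Φ η F)
      obtain ⟨g, hg⟩ := Ideal.Quotient.mk_surjective (Φ η F)
      rw [← hg, smul_mQ, ← map_mul, rc_mk, rc_mk, coeff_C_mul]
      split_ifs <;> simp
  · intro F η
    exact rc_finite _ (Φ η F)
  · intro ρ t η ht
    exact (h3 _).1 (hΦr' η) ρ t ht
  · intro g hg1 hg2 hg3
    have : ∀ F, ∃ r : kF k F.1, ∀ t, rc _ t r = g F t := fun F => rc_exists _ (g F) (hg1 F) (hg2 F)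
    choose r hr using this
    obtain ⟨η, hη⟩ := hΦr r ((h3 r).2 (fun ρ t ht => by
      rw [← hg3 ρ t ht]
      exact Finset.sum_congr rfl fun F _ => by rw [hr]))
    refine ⟨η, fun F s => ?_⟩
    change rc _ s (Φ η F) = _
    rw [hη, hr]

end Omega5


section Krull
open MvPolynomial
variable (k : Type) [Field k] {n : ℕ}

lemma dim_poly (F : Finset (Fin n)) : ringKrullDim (MvPolynomial F k) = (F.card : WithBot (WithTop ℕ)) := by
  rw [MvPolynomial.ringKrullDim_of_isNoetherianRing, ringKrullDim_eq_zero_of_field, zero_add]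
  simp
  rfl

lemma dim_kF_le (F : Finset (Fin n)) : ringKrullDim (kF k F) ≤ (F.card : WithBot (WithTop ℕ)) := by
  rw [← dim_poly k F]
  refine ringKrullDim_le_of_surjective (((Ideal.Quotient.mk (mI k (LowerSet.Iic F))).comp (rename (R := k) (Subtype.val : F → Fin n)).toRingHom)) ?_
  intro r
  obtain ⟨f, rfl⟩ := Ideal.Quotient.mk_surjective r
  rw [← mk_piH]
  have : ∀ f, ∃ g : MvPolynomial F k, rename (R := k) (Subtype.val : F → Fin n) g = piH k F f := by
    intro f
    refine ⟨aeval (fun i => if h : i ∈ F then X ⟨i, h⟩ else 0) f, ?_⟩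
    rw [← AlgHom.comp_apply]
    congr 1
    apply MvPolynomial.algHom_ext
    intro i
    rw [AlgHom.comp_apply, aeval_X, piH_X]
    split_ifs <;> simp
  obtain ⟨g, hg⟩ := this f
  exact ⟨g, congrArg _ hg⟩

lemma dim_low_ge (Δ : SC n) (F : Finset (Fin n)) (hF : F ∈ Δ.faces) :
    (F.card : WithBot (WithTop ℕ)) ≤ ringKrullDim (mQ k Δ.low) := by
  rw [← dim_poly k F]
  let φ : MvPolynomial (Fin n) k →ₐ[k] MvPolynomial F k := aeval (fun i => if h : i ∈ F then X ⟨i, h⟩ else 0)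
  have hφ : ∀ f ∈ mI k Δ.low, φ f = 0 := by
    have : mI k Δ.low ≤ RingHom.ker φ := by
      rw [mI, Ideal.span_le]
      rintro m ⟨σ, hσ, rfl⟩
      have : ¬ σ ⊆ F := fun h => hσ (Δ.low.lower h hF)
      rw [Finset.not_subset] at this
      obtain ⟨x, hx, hx'⟩ := this
      rw [SetLike.mem_coe, RingHom.mem_ker, map_prod]
      apply Finset.prod_eq_zero hx
      simp [φ, hx']
    exact this
  refine ringKrullDim_le_of_surjective (Ideal.Quotient.lift (mI k Δ.low) φ.toRingHom hφ) ?_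
  apply Ideal.Quotient.lift_surjective_of_surjective
  intro g
  refine ⟨rename Subtype.val g, ?_⟩
  change (φ.comp (rename Subtype.val)) g = AlgHom.id k _ g
  congr 1
  apply MvPolynomial.algHom_ext
  intro i
  simp [φ]

theorem dim_low (Δ : SC n) : ringKrullDim (mQ k Δ.low) = ((Δ.faces.sup Finset.card : ℕ) : WithBot (WithTop ℕ)) := by
  classical
  apply le_antisymm
  · rw [ringKrullDim_quotient, Order.krullDim]
    refine iSup_le fun l => ?_
    let p := (l 0).1
    let F : Finset (Fin n) := Finset.univ.filter (fun i => (X i : MvPolynomial (Fin n) k) ∉ p.asIdeal)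
    have hI : mI k Δ.low ≤ p.asIdeal := (l 0).2
    have hF : F ∈ Δ.faces := by
      by_contra h
      have : (∏ i ∈ F, X i : MvPolynomial (Fin n) k) ∈ p.asIdeal := hI (Ideal.subset_span ⟨F, h, rfl⟩)
      rw [Ideal.IsPrime.prod_mem_iff] at this
      obtain ⟨i, hi, hi2⟩ := this
      exact (Finset.mem_filter.1 hi).2 hi2
    have hP : mI k (LowerSet.Iic F) ≤ p.asIdeal := by
      conv_lhs => rw [mI]
      rw [Ideal.span_le]
      rintro m ⟨σ, hσ, rfl⟩
      rw [mem_iic, Finset.not_subset] at hσ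
      obtain ⟨x, hx, hx'⟩ := hσ
      rw [SetLike.mem_coe]
      refine Ideal.mem_of_dvd _ (Finset.dvd_prod_of_mem _ hx) ?_
      by_contra h
      exact hx' (by simp [F, h])
    have h2 := dim_kF_le k F
    rw [ringKrullDim_quotient] at h2
    let l' : LTSeries (PrimeSpectrum.zeroLocus (mI k (LowerSet.Iic F) : Set (MvPolynomial (Fin n) k))) :=
      { length := l.length
        toFun := fun i => ⟨(l i).1, fun x hx => by
          have : (l 0).1 ≤ (l i).1 := l.monotone (Fin.zero_le i)
          exact this (hP hx)⟩
        step := fun i => l.step i }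
    have h3 := Order.LTSeries.length_le_krullDim l'
    refine (h3.trans h2).trans ?_
    have := Finset.le_sup (f := Finset.card) hF
    change ((F.card : ℕ) : WithBot ℕ∞) ≤ ((Δ.faces.sup Finset.card : ℕ) : WithBot ℕ∞)
    exact_mod_cast this
  · obtain ⟨F, hF, hF2⟩ := Finset.exists_mem_eq_sup Δ.faces ⟨∅, Δ.empty_mem⟩ Finset.card
    rw [hF2]
    exact dim_low_ge k Δ F hF

end Krull


namespace Kz
variable {n : ℕ}

/-- Koszul sign -/
def sg (v : Fin n) (τ : Finset (Fin n)) : ℤ := (-1) ^ (τ.filter (· < v)).card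

lemma sg_sq (v : Fin n) (τ : Finset (Fin n)) : sg v τ * sg v τ = 1 := by
  unfold sg; rw [← mul_pow]; simp

lemma sg_erase_self (v : Fin n) (τ : Finset (Fin n)) : sg v (τ.erase v) = sg v τ := by
  unfold sg
  congr 2
  ext x; simp only [Finset.mem_filter, Finset.mem_erase]
  constructor
  · rintro ⟨⟨_, h⟩, h2⟩; exact ⟨h, h2⟩
  · rintro ⟨h, h2⟩; exact ⟨⟨h2.ne, h⟩, h2⟩

lemma sg_insert (v w : Fin n) (τ : Finset (Fin n)) (h : v ∉ τ) :
    sg w (insert v τ) = (if v < w then -1 else 1) * sg w τ := by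
  unfold sg
  rw [Finset.filter_insert]
  split_ifs with h1
  · rw [Finset.card_insert_of_notMem (by simp [h]), pow_succ]; ring
  · simp

lemma sg_insert_self (v : Fin n) (τ : Finset (Fin n)) : sg v (insert v τ) = sg v τ := by
  by_cases h : v ∈ τ
  · rw [Finset.insert_eq_self.2 h]
  · rw [sg_insert _ _ _ h]; simp

lemma sg_erase (v w : Fin n) (τ : Finset (Fin n)) (h : v ∈ τ) :
    sg w (τ.erase v) = (if v < w then -1 else 1) * sg w τ := by
  have := sg_insert v w (τ.erase v) (by simp)
  rw [Finset.insert_erase h] at this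
  rw [this]; split_ifs <;> ring

variable {R : Type} [CommRing R] {M : Type} [AddCommGroup M] [Module R M]

/-- cochains -/
abbrev Ch (n : ℕ) (M : Type) := Finset (Fin n) → M

/-- exterior mult -/
def E (v : Fin n) (α : Ch n M) : Ch n M := fun τ => if v ∈ τ then sg v τ • α (τ.erase v) else 0

/-- contraction -/
def C (v : Fin n) (α : Ch n M) : Ch n M := fun τ => if v ∈ τ then 0 else sg v τ • α (insert v τ)

lemma EE_self (v : Fin n) (α : Ch n M) : E v (E v α) = 0 := by
  funext τ; simp [E]

lemma EE_ne (v w : Fin n) (h : v ≠ w) (α : Ch n M) : E v (E w α) + E w (E v α) = 0 := by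
  funext τ
  simp only [E, Pi.add_apply, Pi.zero_apply, Finset.mem_erase]
  by_cases hv : v ∈ τ <;> by_cases hw : w ∈ τ <;> simp only [hv, hw, if_true, if_false, and_true, and_false, smul_zero, add_zero, h, h.symm, ne_eq, not_false_eq_true]
  rw [smul_smul, smul_smul, Finset.erase_right_comm, ← add_smul, sg_erase _ _ _ hv, sg_erase _ _ _ hw]
  have : sg v τ * ((if v < w then -1 else 1) * sg w τ) + sg w τ * ((if w < v then -1 else 1) * sg v τ) = 0 := by
    rcases lt_or_gt_of_ne h with h1 | h1
    · rw [if_pos h1, if_neg h1.not_gt]; ring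
    · rw [if_pos h1, if_neg h1.not_gt]; ring
  rw [this, zero_smul]

lemma CE_self (v : Fin n) (α : Ch n M) : C v (E v α) + E v (C v α) = α := by
  funext τ
  by_cases hv : v ∈ τ
  · simp [E, C, hv, smul_smul, sg_erase_self, sg_sq]
  · simp [E, C, hv, smul_smul, sg_insert_self, sg_sq]

lemma CE_ne (v w : Fin n) (h : v ≠ w) (α : Ch n M) : C v (E w α) + E w (C v α) = 0 := by
  funext τ
  by_cases hv : v ∈ τ <;> by_cases hw : w ∈ τ <;> simp [E, C, hv, hw, h.symm, h]
  rw [smul_smul, smul_smul, Finset.erase_insert_of_ne h, ← add_smul, sg_erase _ _ _ hw, sg_insert _ _ _ hv]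
  have : sg v τ * ((if v < w then -1 else 1) * sg w τ) + sg w τ * ((if w < v then -1 else 1) * sg v τ) = 0 := by
    rcases lt_or_gt_of_ne h with h1 | h1
    · rw [if_pos h1, if_neg h1.not_gt]; ring
    · rw [if_pos h1, if_neg h1.not_gt]; ring
  rw [this, zero_smul]

lemma E_add (v : Fin n) (α β : Ch n M) : E v (α + β) = E v α + E v β := by
  funext τ; simp only [E, Pi.add_apply]; split_ifs <;> simp
lemma E_smul (v : Fin n) (r : R) (α : Ch n M) : E v (r • α) = r • E v α := by
  funext τ; simp only [E, Pi.smul_apply]; split_ifs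
  · exact smul_comm _ _ _
  · simp
lemma C_add (v : Fin n) (α β : Ch n M) : C v (α + β) = C v α + C v β := by
  funext τ; simp only [C, Pi.add_apply]; split_ifs <;> simp
lemma C_smul (v : Fin n) (r : R) (α : Ch n M) : C v (r • α) = r • C v α := by
  funext τ; simp only [C, Pi.smul_apply]; split_ifs
  · simp
  · exact smul_comm _ _ _

/-- E as linear map -/
def El (R : Type) [CommRing R] [Module R M] (v : Fin n) : Ch n M →ₗ[R] Ch n M where
  toFun := E v
  map_add' := E_add v
  map_smul' := E_smul v

/-- C as linear map -/
def Cl (R : Type) [CommRing R] [Module R M] (v : Fin n) : Ch n M →ₗ[R] Ch n M where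
  toFun := C v
  map_add' := C_add v
  map_smul' := C_smul v

/-- Koszul differential -/
def dK (y : Fin n → R) : Ch n M →ₗ[R] Ch n M := ∑ v, y v • El R v
/-- homotopy -/
def hK (c : Fin n → R) : Ch n M →ₗ[R] Ch n M := ∑ v, c v • Cl R v

lemma dK_apply (y : Fin n → R) (α : Ch n M) : dK y α = ∑ v, y v • E v α := by
  simp [dK, El]
lemma hK_apply (y : Fin n → R) (α : Ch n M) : hK y α = ∑ v, y v • C v α := by
  simp [hK, Cl]

lemma dK_add_y (y z : Fin n → R) (α : Ch n M) : dK (y + z) α = dK y α + dK z α := by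
  simp [dK_apply, add_smul, Finset.sum_add_distrib]

lemma dK_dK (y : Fin n → R) (α : Ch n M) : dK y (dK y α) = 0 := by
  rw [dK_apply]
  have : ∀ v, y v • E v (dK y α) = ∑ w, (y v * y w) • E v (E w α) := by
    intro v
    change y v • El R v (dK y α) = _
    rw [dK_apply, map_sum, Finset.smul_sum]
    refine Finset.sum_congr rfl fun w _ => ?_
    rw [map_smul, smul_smul]; rfl
  simp_rw [this]
  rw [← Finset.sum_product']
  refine Finset.sum_involution (fun p _ => (p.2, p.1)) ?_ ?_ ?_ ?_
  · rintro ⟨v, w⟩ _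
    by_cases h : v = w
    · subst h; simp [EE_self]
    · simp only
      rw [mul_comm (y w), ← smul_add, EE_ne _ _ h, smul_zero]
  · rintro ⟨v, w⟩ _ h1 h2
    simp only [Prod.mk.injEq] at h2
    apply h1
    simp only
    rw [h2.1, EE_self, smul_zero]
  · simp
  · simp

lemma dK_hK (y c : Fin n → R) (α : Ch n M) : hK c (dK y α) + dK y (hK c α) = (∑ v, c v * y v) • α := by
  rw [dK_apply, hK_apply c α, map_sum, map_sum]
  simp_rw [map_smul]
  simp_rw [hK_apply, dK_apply, Finset.smul_sum, smul_smul]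
  rw [Finset.sum_comm (f := fun x i => (c x * y i) • E i (C x α))]
  rw [← Finset.sum_add_distrib]
  simp_rw [← Finset.sum_add_distrib]
  rw [Finset.sum_smul]
  refine Finset.sum_congr rfl fun v _ => ?_
  rw [Finset.sum_eq_single v]
  · rw [mul_comm (y v), ← smul_add, CE_self]
  · intro w _ hw
    rw [mul_comm (y v), ← smul_add, CE_ne _ _ hw, smul_zero]
  · simp

/-- supported in degree j -/
def Sup (j : ℕ) (α : Ch n M) : Prop := ∀ τ, τ.card ≠ j → α τ = 0

lemma Sup_hK (c : Fin n → R) (j : ℕ) (α : Ch n M) (h : Sup (j+1) α) : Sup j (hK c α) := by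
  intro τ hτ
  rw [hK_apply, Finset.sum_apply]
  refine Finset.sum_eq_zero fun v _ => ?_
  simp only [Pi.smul_apply, C]
  split_ifs with h1
  · simp
  · rw [h _ (by rw [Finset.card_insert_of_notMem h1]; omega)]; simp

lemma hK_zero (c : Fin n → R) (α : Ch n M) (h : Sup 0 α) : hK c α = 0 := by
  funext τ
  rw [hK_apply, Finset.sum_apply]
  refine Finset.sum_eq_zero fun v _ => ?_
  simp only [Pi.smul_apply, C]
  split_ifs with h1
  · simp
  · rw [h _ (by simp)]; simp

lemma dK_map {N : Type} [AddCommGroup N] [Module R N] (y : Fin n → R) (f : M →ₗ[R] N) (α : Ch n M) :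
    dK y (fun τ => f (α τ)) = fun τ => f (dK y α τ) := by
  funext τ
  rw [dK_apply, dK_apply, Finset.sum_apply, Finset.sum_apply, map_sum]
  refine Finset.sum_congr rfl fun v _ => ?_
  simp only [Pi.smul_apply, E]
  split_ifs <;> simp

/-- main Koszul lemma -/
theorem koszul_vanish [IsNoetherianRing R] (𝔪 : Ideal R) (h𝔪 : 𝔪.IsMaximal) (y : Fin n → R)
    (hy : 𝔪 ≤ (Ideal.span (Set.range y)).radical) (t : ℕ) :
    ∀ (M : Type) [AddCommGroup M] [Module R M] [Module.Finite R M],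
    (∀ j < t, Subsingleton (EM R (R ⧸ 𝔪) M j)) →
    ∀ j < t, ∀ α : Ch n M, Sup j α → dK y α = 0 → ∃ γ, α = dK y γ := by
  induction t with
  | zero => intro M _ _ _ _ j hj; omega
  | succ t ih =>
    intro M _ _ _ hE j hj α hα hd
    obtain ⟨c, hc⟩ : ∃ c : Fin n → R, ∀ m : M, (∑ v, c v * y v) • m = 0 → m = 0 := by
      have hnot : ¬ (Ideal.span (Set.range y) : Set R) ⊆ ⋃ p ∈ associatedPrimes R M, (p : Set R) := by
        intro hsub
        obtain ⟨p, hp, hle⟩ := (Ideal.subset_union_prime_finite (associatedPrimes.finite R M) (f := id) 0 0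
          (fun p hp _ _ => hp.isPrime)).1 hsub
        have hpp : p.IsPrime := hp.isPrime
        have h1 : 𝔪 ≤ p := hy.trans (hpp.radical_le_iff.2 hle)
        have h2 : 𝔪 = p := h𝔪.eq_of_le hpp.ne_top h1
        subst h2
        obtain ⟨_, g, hg⟩ := (isAssociatedPrime_iff_exists_injective_linearMap _ _).1 hp
        have h0 := hE 0 (by omega)
        have h3 : Abelian.Ext.mk₀ (ModuleCat.ofHom g) = (0 : EM R (R ⧸ 𝔪) M 0) := Subsingleton.elim _ _
        rw [Abelian.Ext.mk₀_eq_zero_iff] at h3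
        have h4 : g = 0 := by
          have := congrArg ModuleCat.Hom.hom h3
          exact this
        have h5 : (1 : R ⧸ 𝔪) = 0 := hg (by rw [h4]; simp)
        rw [← map_one (Ideal.Quotient.mk 𝔪), Ideal.Quotient.eq_zero_iff_mem] at h5
        exact h𝔪.ne_top ((Ideal.eq_top_iff_one _).2 h5)
      rw [Set.not_subset] at hnot
      obtain ⟨f, hfy, hf⟩ := hnot
      rw [biUnion_associatedPrimes_eq_zero_divisors] at hf
      obtain ⟨c, hc⟩ := (Ideal.mem_span_range_iff_exists_fun).1 hfy
      refine ⟨c, fun m hm => ?_⟩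
      by_contra hne
      exact hf ⟨m, hne, by rw [← hc]; exact hm⟩
    set f := ∑ v, c v * y v with hf
    have hfd : f • α = dK y (hK c α) := by
      have := dK_hK y c α
      rw [hd, map_zero, zero_add] at this
      exact this.symm
    have hinj : ∀ β β' : Ch n M, f • β = f • β' → β = β' := by
      intro β β' h
      funext τ
      have := congrFun h τ
      simp only [Pi.smul_apply] at this
      rw [← sub_eq_zero, ← smul_sub] at this
      exact sub_eq_zero.1 (hc _ this)
    rcases j with _ | j
    · rw [hK_zero c α hα, map_zero] at hfd
      refine ⟨0, ?_⟩
      rw [map_zero]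
      exact hinj _ _ (by rw [hfd, smul_zero])
    · let fM : M →ₗ[R] M := LinearMap.lsmul R M f
      let P := M ⧸ LinearMap.range fM
      have hSE : SE fM (LinearMap.range fM).mkQ := 
        { inj := by
            rw [← LinearMap.ker_eq_bot, LinearMap.ker_eq_bot']
            intro m hm; exact hc m hm
          surj := Submodule.mkQ_surjective _
          ex := LinearMap.exact_map_mkQ_range fM }
      have hP : ∀ j < t, Subsingleton (EM R (R ⧸ 𝔪) P j) := by
        intro j hj
        have := hE (j+1) (by omega)
        have h0 := hE j (by omega)
        refine subsingleton_of_forall_eq 0 fun e => ?_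
        obtain ⟨e', he'⟩ := Abelian.Ext.covariant_sequence_exact₃ (ModuleCat.of R (R ⧸ 𝔪)) hSE.shortExact e
          (n₁ := j+1) rfl (Subsingleton.elim (α := EM R (R ⧸ 𝔪) M (j+1)) _ _)
        rw [← he', Subsingleton.elim (α := EM R (R ⧸ 𝔪) M j) e' 0]
        rw [Abelian.Ext.zero_comp]
      obtain ⟨γ, hγ⟩ := ih P hP j (by omega) (fun τ => (LinearMap.range fM).mkQ (hK c α τ))
        (by
          intro τ hτ
          change (LinearMap.range fM).mkQ (hK c α τ) = 0
          rw [Sup_hK c j α hα τ hτ, map_zero])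
        (by
          rw [dK_map, ← hfd]
          funext τ
          exact (hSE.ex.apply_apply_eq_zero (α τ)))
      choose γ' hγ' using fun τ => (LinearMap.range fM).mkQ_surjective (γ τ)
      have : ∀ τ, ∃ δ, fM δ = hK c α τ - dK y γ' τ := by
        intro τ
        refine (hSE.ex _).1 ?_
        rw [map_sub, sub_eq_zero]
        have h1 := congrFun hγ τ
        have h2 : γ = fun τ => (LinearMap.range fM).mkQ (γ' τ) := by funext τ; exact (hγ' τ).symm
        rw [h2, dK_map] at h1
        exact h1
      choose δ hδ using this
      refine ⟨δ, hinj _ _ ?_⟩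
      have h3 : hK c α = dK y γ' + f • δ := by
        funext τ
        have := hδ τ
        simp only [Pi.add_apply, Pi.smul_apply]
        rw [show f • δ τ = fM (δ τ) from rfl, this]; abel
      rw [hfd, h3, map_add, dK_dK, map_smul, zero_add]

end Kz


section CMcons
open MvPolynomial
variable {k : Type} [Field k] {n : ℕ}

lemma mem_low {Δ : SC n} {σ : Finset (Fin n)} : σ ∈ Δ.low ↔ σ ∈ Δ.faces := Iff.rfl

lemma zero_supp_mem (Δ : SC n) : (0 : Fin n →₀ ℕ).support ∈ Δ.low := by
  rw [Finsupp.support_zero]; exact Δ.empty_mem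

lemma mon_mul_mon (Γ : LowerSet (Finset (Fin n))) (s t : Fin n →₀ ℕ) :
    mon (k := k) Γ s * mon Γ t = mon Γ (s + t) := by
  unfold mon; rw [← map_mul, monomial_mul, one_mul]

lemma rc_mon_mul_add {Γ : LowerSet (Finset (Fin n))} (s t : Fin n →₀ ℕ) (r : mQ k Γ)
    (h : (s + t).support ∈ Γ) : rc Γ (s + t) (mon Γ s * r) = rc Γ t r := by
  rw [← rc_smul_add s t r h, smul_mQ]; rfl

lemma rc_mon_mul_not {Γ : LowerSet (Finset (Fin n))} (s t : Fin n →₀ ℕ) (r : mQ k Γ)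
    (h : ¬ s ≤ t) : rc Γ t (mon Γ s * r) = 0 := by
  rw [← rc_smul_of_not_le s t r h, smul_mQ]; rfl

lemma mon_eq_zero {Γ : LowerSet (Finset (Fin n))} {s : Fin n →₀ ℕ} (h : s.support ∉ Γ) :
    mon (k := k) Γ s = 0 := by
  classical
  apply rc_ext
  intro t ht
  rw [rc_mon, map_zero, if_neg]
  rintro ⟨h1, rfl⟩; exact h h1

lemma mon_zero (Γ : LowerSet (Finset (Fin n))) : mon (k := k) Γ 0 = 1 := by
  unfold mon; exact map_one _

lemma mon_pow (Γ : LowerSet (Finset (Fin n))) (s : Fin n →₀ ℕ) (m : ℕ) :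
    mon (k := k) Γ s ^ m = mon Γ (m • s) := by
  induction m with
  | zero => simp [mon_zero]
  | succ m ih => rw [pow_succ, ih, mon_mul_mon, succ_nsmul]

lemma quotMax_eq (Δ : SC n) : quotMax k (mI k Δ.low) =
    Ideal.span (Set.range fun i : Fin n => mon (k := k) Δ.low (Finsupp.single i 1)) := rfl

lemma mem_srMax (Δ : SC n) (r : mQ k Δ.low) : r ∈ quotMax k (mI k Δ.low) ↔ rc Δ.low 0 r = 0 := by
  classical
  have h0 : (0 : Fin n →₀ ℕ).support ∈ Δ.low := zero_supp_mem Δ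
  constructor
  · intro h
    rw [quotMax_eq, Ideal.mem_span_range_iff_exists_fun] at h
    obtain ⟨c, rfl⟩ := h
    rw [map_sum]
    refine Finset.sum_eq_zero fun i _ => ?_
    rw [mul_comm, rc_mon_mul_not]
    intro h
    have := h i
    simp at this
  · intro h
    obtain ⟨f, rfl⟩ := Ideal.Quotient.mk_surjective r
    rw [rc_mk, if_pos h0] at h
    have h1 : f ∈ Ideal.span (X '' (Set.univ : Set (Fin n)) : Set (MvPolynomial (Fin n) k)) := by
      rw [mem_ideal_span_X_image]
      intro m hm
      by_contra h2
      push Not at h2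
      have : m = 0 := by ext i; exact h2 i (Set.mem_univ i)
      rw [this, mem_support_iff] at hm
      exact hm h
    have h2 := Ideal.mem_map_of_mem (Ideal.Quotient.mk (mI k Δ.low)) h1
    rw [Ideal.map_span] at h2
    refine Ideal.span_mono ?_ h2
    rintro _ ⟨_, ⟨i, _, rfl⟩, rfl⟩
    exact ⟨i, rfl⟩

lemma srMax_ne_top (Δ : SC n) : quotMax k (mI k Δ.low) ≠ ⊤ := by
  classical
  intro h
  have : (1 : mQ k Δ.low) ∈ quotMax k (mI k Δ.low) := by rw [h]; trivial
  rw [mem_srMax, ← mon_zero, rc_mon, if_pos ⟨zero_supp_mem Δ, rfl⟩] at this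
  exact one_ne_zero this

lemma srMax_isMaximal (Δ : SC n) : (quotMax k (mI k Δ.low)).IsMaximal := by
  classical
  rw [Ideal.isMaximal_iff]
  refine ⟨fun h => srMax_ne_top Δ ((Ideal.eq_top_iff_one _).2 h), ?_⟩
  intro J x hJ hx hxJ
  rw [mem_srMax] at hx
  set a := rc Δ.low 0 x
  have h0 : (0 : Fin n →₀ ℕ).support ∈ Δ.low := zero_supp_mem Δ
  have h1 : x - Ideal.Quotient.mk _ (C a) ∈ quotMax k (mI k Δ.low) := by
    rw [mem_srMax, map_sub, rc_mk, if_pos h0]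
    simp [a]
  have h2 : Ideal.Quotient.mk (mI k Δ.low) (C a) ∈ J := by
    have := J.sub_mem hxJ (hJ h1)
    simpa using this
  have h3 := J.mul_mem_left (Ideal.Quotient.mk _ (C a⁻¹)) h2
  rw [← map_mul, ← C_mul, inv_mul_cancel₀ hx, C_1, map_one] at h3
  exact h3

/-- the sop -/
noncomputable def yv (k : Type) [Field k] (Δ : SC n) (σ : Finset (Fin n)) (v : Fin n) : mQ k Δ.low :=
  mon Δ.low (Finsupp.single v (if v ∈ σ then 2 else 1))

lemma yv_rad (Δ : SC n) (σ : Finset (Fin n)) :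
    quotMax k (mI k Δ.low) ≤ (Ideal.span (Set.range (yv k Δ σ))).radical := by
  rw [quotMax_eq, Ideal.span_le]
  rintro _ ⟨i, rfl⟩
  refine ⟨2, ?_⟩
  have h : yv k Δ σ i ∈ Ideal.span (Set.range (yv k Δ σ)) := Ideal.subset_span ⟨i, rfl⟩
  simp only
  rw [mon_pow, Finsupp.smul_single]
  unfold yv at h
  split_ifs at h with h1
  · exact h
  · rw [show (2 • 1 : ℕ) = 1 + 1 from rfl, Finsupp.single_add, ← mon_mul_mon]
    exact Ideal.mul_mem_left _ _ h

lemma CM_koszul (Δ : SC n) (hCM : IsCohenMacaulayAt (mQ k Δ.low) (quotMax k (mI k Δ.low)))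
    (σ : Finset (Fin n)) (j : ℕ) (hj : j < Δ.faces.sup Finset.card) (α : Kz.Ch n (mQ k Δ.low))
    (hα : Kz.Sup j α) (hd : Kz.dK (yv k Δ σ) α = 0) : ∃ γ, α = Kz.dK (yv k Δ σ) γ := by
  have := hCM.1
  refine Kz.koszul_vanish (quotMax k (mI k Δ.low)) (srMax_isMaximal Δ) _ (yv_rad Δ σ) _ (mQ k Δ.low) ?_ j hj α hα hd
  intro i hi
  have h2 := hCM.2 i (by
    rw [dim_low]
    change ((i : ℕ∞) : WithBot ℕ∞) < ((Δ.faces.sup Finset.card : ℕ) : ℕ∞)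
    exact_mod_cast hi)
  obtain ⟨e⟩ := extMod_equiv (mQ k Δ.low) (mQ k Δ.low ⧸ quotMax k (mI k Δ.low)) (mQ k Δ.low) i
  exact e.symm.toEquiv.subsingleton

lemma rc_zsmul (Γ : LowerSet (Finset (Fin n))) (t : Fin n →₀ ℕ) (z : ℤ) (r : mQ k Γ) :
    rc Γ t (z • r) = z • rc Γ t r := map_zsmul _ _ _

lemma not_le_two (σ τ : Finset (Fin n)) (v : Fin n) (hv : v ∈ σ) :
    ¬ Finsupp.single v (if v ∈ σ then 2 else 1) ≤ ind τ := by
  intro h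
  have := h v
  rw [ind_apply, if_pos hv, Finsupp.single_eq_same] at this
  split_ifs at this <;> omega

lemma rc_dK (Δ : SC n) (σ : Finset (Fin n)) (γ : Kz.Ch n (mQ k Δ.low)) (τ : Finset (Fin n)) (t) :
    rc Δ.low t (Kz.dK (yv k Δ σ) γ τ) = ∑ v, rc Δ.low t (yv k Δ σ v * Kz.E v γ τ) := by
  rw [Kz.dK_apply, Finset.sum_apply, map_sum]; rfl

lemma rc_dK_self (Δ : SC n) (σ : Finset (Fin n)) (γ : Kz.Ch n (mQ k Δ.low)) :
    rc Δ.low (ind σ) (Kz.dK (yv k Δ σ) γ σ) = 0 := by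
  rw [rc_dK]
  refine Finset.sum_eq_zero fun v _ => ?_
  by_cases hv : v ∈ σ
  · exact rc_mon_mul_not _ _ _ (not_le_two σ σ v hv)
  · rw [Kz.E, if_neg hv, mul_zero, map_zero]

lemma ind_insert (σ : Finset (Fin n)) (u : Fin n) (hu : u ∉ σ) :
    ind (insert u σ) = Finsupp.single u 1 + ind σ := by
  ext i
  rw [Finsupp.add_apply, ind_apply, ind_apply, Finsupp.single_apply]
  by_cases h : u = i
  · subst h; simp [hu]
  · simp [h, Ne.symm h]

lemma rc_dK_insert (Δ : SC n) (σ : Finset (Fin n)) (γ : Kz.Ch n (mQ k Δ.low)) (u : Fin n) (hu : u ∉ σ)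
    (hf : insert u σ ∈ Δ.faces) :
    rc Δ.low (ind (insert u σ)) (Kz.dK (yv k Δ σ) γ (insert u σ)) =
      Kz.sg u (insert u σ) • rc Δ.low (ind σ) (γ σ) := by
  rw [rc_dK, Finset.sum_eq_single u]
  · rw [yv, if_neg hu, ind_insert σ u hu, rc_mon_mul_add _ _ _ (by rw [← ind_insert σ u hu, ind_support]; exact hf),
      Kz.E, if_pos (Finset.mem_insert_self _ _), Finset.erase_insert hu, rc_zsmul]
  · intro v _ hvu
    by_cases hv : v ∈ σ
    · exact rc_mon_mul_not _ _ _ (not_le_two σ _ v hv)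
    · rw [Kz.E, if_neg (by simp [hv, hvu]), mul_zero, map_zero]
  · simp

/-- the basic cochain -/
noncomputable def xi (k : Type) [Field k] (Δ : SC n) (σ : Finset (Fin n)) : Kz.Ch n (mQ k Δ.low) :=
  fun τ => if τ = σ then mon Δ.low (ind σ) else 0

lemma smul_E_xi (Δ : SC n) (σ : Finset (Fin n)) (v : Fin n) (c : mQ k Δ.low) 
    (h : v ∉ σ → c * mon Δ.low (ind σ) = 0) : c • Kz.E v (xi k Δ σ) = 0 := by
  funext τ
  simp only [Pi.smul_apply, Kz.E, xi, Pi.zero_apply]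
  split_ifs with h1 h2
  · have hv : v ∉ σ := by rw [← h2]; simp
    rw [smul_comm, smul_eq_mul, h hv, smul_zero]
  · simp
  · simp

theorem CM_pure (Δ : SC n) (hCM : IsCohenMacaulayAt (mQ k Δ.low) (quotMax k (mI k Δ.low)))
    (σ : Finset (Fin n)) (hσ : σ ∈ Δ.faces) (hlt : σ.card < Δ.faces.sup Finset.card) :
    ∃ v, v ∉ σ ∧ insert v σ ∈ Δ.faces := by
  classical
  by_contra hcon
  push Not at hcon
  obtain ⟨γ, hγ⟩ := CM_koszul Δ hCM σ σ.card hlt (xi k Δ σ) (by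
    intro τ hτ
    rw [xi, if_neg]
    rintro rfl; exact hτ rfl) (by
    rw [Kz.dK_apply]
    refine Finset.sum_eq_zero fun v _ => ?_
    refine smul_E_xi Δ σ v _ fun hv => ?_
    rw [yv, if_neg hv, mon_mul_mon, ← ind_insert σ v hv]
    exact mon_eq_zero (by rw [ind_support]; exact hcon v hv))
  have h1 := rc_dK_self Δ σ γ
  rw [← hγ, xi, if_pos rfl, rc_mon, if_pos ⟨by rw [ind_support]; exact hσ, rfl⟩] at h1
  exact one_ne_zero h1

theorem CM_link (Δ : SC n) (hCM : IsCohenMacaulayAt (mQ k Δ.low) (quotMax k (mI k Δ.low)))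
    (σ : Finset (Fin n)) (hlt : σ.card + 2 ≤ Δ.faces.sup Finset.card)
    (U : Fin n → Prop) (hU : ∀ u, U u → u ∉ σ ∧ insert u σ ∈ Δ.faces)
    (hcl : ∀ u w, U u → w ∉ σ → w ≠ u → insert w (insert u σ) ∈ Δ.faces → U w)
    (u0 : Fin n) (hu0 : U u0) (w : Fin n) (hw : w ∉ σ) (hwf : insert w σ ∈ Δ.faces) : U w := by
  classical
  by_contra hnw
  let y' : Fin n → mQ k Δ.low := fun v => if U v then yv k Δ σ v else 0
  let y'' : Fin n → mQ k Δ.low := fun v => if U v then 0 else yv k Δ σ v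
  have hy : yv k Δ σ = y' + y'' := by
    funext v; simp only [y', y'', Pi.add_apply]; split_ifs <;> simp
  have hval : ∀ τ, Kz.dK y' (xi k Δ σ) τ = ∑ v, y' v * Kz.E v (xi k Δ σ) τ := by
    intro τ; rw [Kz.dK_apply, Finset.sum_apply]; rfl
  have hE : ∀ v τ, Kz.E v (xi k Δ σ) τ ≠ 0 → v ∉ σ ∧ τ = insert v σ := by
    intro v τ h
    simp only [Kz.E, xi] at h
    split_ifs at h with h1 h2
    · constructor
      · rw [← h2]; simp
      · rw [← h2, Finset.insert_erase h1]
    · simp at h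
    · simp at h
  obtain ⟨γ, hγ⟩ := CM_koszul Δ hCM σ (σ.card + 1) (by omega) (Kz.dK y' (xi k Δ σ)) (by
    intro τ hτ
    rw [hval]
    refine Finset.sum_eq_zero fun v _ => ?_
    by_contra h
    obtain ⟨h1, rfl⟩ := hE v τ (right_ne_zero_of_mul h)
    exact hτ (by rw [Finset.card_insert_of_notMem h1])) (by
    rw [hy, Kz.dK_add_y, Kz.dK_dK, zero_add, Kz.dK_apply y'', Kz.dK_apply y']
    refine Finset.sum_eq_zero fun v _ => ?_
    change y'' v • Kz.El (mQ k Δ.low) v _ = 0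
    rw [map_sum, Finset.smul_sum]
    refine Finset.sum_eq_zero fun u _ => ?_
    rw [map_smul, smul_smul]
    by_cases hv : U v
    · simp [y'', hv]
    by_cases hu : U u
    swap
    · simp [y', hu]
    funext τ
    have hval2 : ((y'' v * y' u) • Kz.El (mQ k Δ.low) v (Kz.E u (xi k Δ σ))) τ =
      (y'' v * y' u) * Kz.E v (Kz.E u (xi k Δ σ)) τ := rfl
    rw [hval2]
    by_cases hvτ : v ∈ τ
    swap
    · rw [Kz.E, if_neg hvτ, mul_zero]; rfl
    by_cases h0 : Kz.E u (xi k Δ σ) (τ.erase v) = 0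
    · rw [Kz.E, if_pos hvτ, h0, smul_zero, mul_zero]; rfl
    obtain ⟨h1, h2⟩ := hE u _ h0
    have hvu : v ≠ u := by rintro rfl; exact hv hu
    have hvσ : v ∉ σ := by
      intro h
      have : v ∈ τ.erase v := by rw [h2]; simp [h]
      simp at this
    rw [Kz.E, if_pos hvτ, h2, Kz.E, if_pos (Finset.mem_insert_self _ _), Finset.erase_insert h1, xi, if_pos rfl]
    rw [mul_smul_comm, mul_smul_comm]
    have : y'' v * y' u * mon Δ.low (ind σ) = 0 := by
      simp only [y'', y', hv, hu, if_true, if_false]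
      rw [yv, yv, if_neg hvσ, if_neg h1, mul_assoc, mon_mul_mon, ← ind_insert σ u h1, mon_mul_mon, ← ind_insert]
      · apply mon_eq_zero
        rw [ind_support]
        intro h
        exact hv (hcl u v hu hvσ hvu h)
      · simp [hvu, hvσ]
    rw [this, smul_zero, smul_zero]; rfl)
  have key : ∀ u, u ∉ σ → insert u σ ∈ Δ.faces → rc Δ.low (ind (insert u σ)) (Kz.dK y' (xi k Δ σ) (insert u σ)) = 
      if U u then Kz.sg u (insert u σ) • 1 else 0 := by
    intro u hu huf
    rw [hval, Finset.sum_eq_single u]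
    · by_cases hUu : U u
      · simp only [y', if_pos hUu]
        rw [yv, if_neg hu, ind_insert σ u hu, rc_mon_mul_add _ _ _ (by rw [← ind_insert σ u hu, ind_support]; exact huf),
          Kz.E, if_pos (Finset.mem_insert_self _ _), Finset.erase_insert hu, rc_zsmul, xi, if_pos rfl, rc_mon, if_pos]
        refine ⟨?_, rfl⟩
        rw [ind_support]
        exact Δ.down_closed huf (Finset.subset_insert _ _)
      · simp [y', hUu]
    · intro v _ hvu
      by_contra h
      obtain ⟨h1, h2⟩ := hE v _ (right_ne_zero_of_mul h)
      have : v ∈ insert u σ := by rw [h2]; simp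
      simp [hvu, h1] at this
    · simp
  have hsg : ∀ (u : Fin n) (τ : Finset (Fin n)), ((Kz.sg u τ : ℤ) : k) ≠ 0 := by
    intro u τ h
    have := congrArg (Int.cast : ℤ → k) (Kz.sg_sq u τ)
    rw [Int.cast_mul, h] at this
    simp at this
  have k1 := key u0 (hU u0 hu0).1 (hU u0 hu0).2
  have k2 := key w hw hwf
  rw [hγ, rc_dK_insert _ _ _ _ (hU u0 hu0).1 (hU u0 hu0).2, if_pos hu0, zsmul_eq_mul, zsmul_eq_mul] at k1
  rw [hγ, rc_dK_insert _ _ _ _ hw hwf, if_neg hnw, zsmul_eq_mul] at k2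
  have k3 := (mul_eq_zero.1 k2).resolve_left (hsg _ _)
  rw [k3, mul_zero, mul_one] at k1
  exact hsg _ _ k1.symm

/-- combinatorial consequences of CM -/
structure CMc (Δ : SC n) (d : ℕ) : Prop where
  card_le : ∀ σ ∈ Δ.faces, σ.card ≤ d
  pure : ∀ σ ∈ Δ.faces, ∃ F : Fc Δ d, σ ⊆ F.1
  conn : ∀ σ ∈ Δ.faces, ∀ P : Fc Δ d → Prop,
    (∀ F G : Fc Δ d, ∀ ρ : Rd Δ d, σ ⊆ ρ.1 → ρ.1 ⊆ F.1 → ρ.1 ⊆ G.1 → P F → P G) →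
    ∀ F G : Fc Δ d, σ ⊆ F.1 → σ ⊆ G.1 → P F → P G

theorem CM_CMc (Δ : SC n) (hCM : IsCohenMacaulayAt (mQ k Δ.low) (quotMax k (mI k Δ.low))) :
    CMc Δ (Δ.faces.sup Finset.card) := by
  set d := Δ.faces.sup Finset.card with hd
  have hle : ∀ σ ∈ Δ.faces, σ.card ≤ d := fun σ h => Finset.le_sup (f := Finset.card) h
  have hpure : ∀ m, ∀ σ ∈ Δ.faces, d - σ.card = m → ∃ F : Fc Δ d, σ ⊆ F.1 := by
    intro m
    induction m with
    | zero => 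
      intro σ hσ h
      exact ⟨⟨σ, hσ, by have := hle σ hσ; omega⟩, subset_rfl⟩
    | succ m ih =>
      intro σ hσ h
      obtain ⟨v, hv, hvf⟩ := CM_pure Δ hCM σ hσ (by omega)
      obtain ⟨F, hF⟩ := ih (insert v σ) hvf (by rw [Finset.card_insert_of_notMem hv]; omega)
      exact ⟨F, (Finset.subset_insert _ _).trans hF⟩
  have hpure' : ∀ σ ∈ Δ.faces, ∃ F : Fc Δ d, σ ⊆ F.1 := fun σ h => hpure _ σ h rfl
  refine ⟨hle, hpure', ?_⟩
  have hcon : ∀ m, ∀ σ ∈ Δ.faces, d - σ.card = m → ∀ P : Fc Δ d → Prop,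
    (∀ F G : Fc Δ d, ∀ ρ : Rd Δ d, σ ⊆ ρ.1 → ρ.1 ⊆ F.1 → ρ.1 ⊆ G.1 → P F → P G) →
    ∀ F G : Fc Δ d, σ ⊆ F.1 → σ ⊆ G.1 → P F → P G := by
    intro m
    induction m with
    | zero =>
      intro σ hσ h P _ F G hF hG hP
      have h1 : σ = F.1 := Finset.eq_of_subset_of_card_le hF (by rw [F.2.2]; omega)
      have h2 : σ = G.1 := Finset.eq_of_subset_of_card_le hG (by rw [G.2.2]; omega)
      have : F = G := Subtype.ext (h1.symm.trans h2)
      exact this ▸ hP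
    | succ m ih =>
      intro σ hσ h P hP F G hF hG hPF
      by_cases h1 : m = 0
      · exact hP F G ⟨σ, hσ, by omega⟩ subset_rfl hF hG hPF
      have ih' : ∀ u, u ∉ σ → insert u σ ∈ Δ.faces → ∀ F G : Fc Δ d, insert u σ ⊆ F.1 → insert u σ ⊆ G.1 → P F → P G := by
        intro u hu huf
        refine ih (insert u σ) huf (by rw [Finset.card_insert_of_notMem hu]; omega) P ?_
        intro F G ρ h1 h2 h3
        exact hP F G ρ ((Finset.subset_insert _ _).trans h1) h2 h3
      have hex : ∀ H : Fc Δ d, σ ⊆ H.1 → ∃ u ∈ H.1, u ∉ σ ∧ insert u σ ∈ Δ.faces ∧ insert u σ ⊆ H.1 := by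
        intro H hH
        obtain ⟨u, hu, hu'⟩ := Finset.exists_mem_notMem_of_card_lt_card (s := σ) (t := H.1) (by rw [H.2.2]; omega)
        exact ⟨u, hu, hu', Δ.down_closed H.2.1 (Finset.insert_subset hu hH), Finset.insert_subset hu hH⟩
      obtain ⟨u0, _, hu0, hu0f, hu0F⟩ := hex F hF
      obtain ⟨w, _, hw, hwf, hwG⟩ := hex G hG
      have := CM_link Δ hCM σ (by omega) (fun u => u ∉ σ ∧ insert u σ ∈ Δ.faces ∧ ∀ H : Fc Δ d, insert u σ ⊆ H.1 → P H)
        (fun u hu => ⟨hu.1, hu.2.1⟩) (by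
          rintro u w ⟨h1, h2, h3⟩ hw hwu hwf
          have hwf' : insert w σ ∈ Δ.faces := Δ.down_closed hwf (Finset.insert_subset_insert _ (Finset.subset_insert _ _))
          refine ⟨hw, hwf', ?_⟩
          obtain ⟨H, hH⟩ := hpure' _ hwf
          intro H' hH'
          refine ih' w hw hwf' H H' ?_ hH' (h3 H ((Finset.subset_insert _ _).trans hH))
          exact (Finset.insert_subset_insert _ (Finset.subset_insert _ _)).trans hH) u0
        ⟨hu0, hu0f, fun H hH => ih' u0 hu0 hu0f F H hu0F hH hPF⟩ w hw hwf
      exact this.2.2 G hwG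
  exact fun σ hσ => hcon _ σ hσ rfl

end CMcons


section Iface
open MvPolynomial
variable {k : Type} [Field k] {n : ℕ} {Δ : SC n} {d : ℕ}

/-- cycles of the star of σ -/
def Zp (eps : Fc Δ d → Rd Δ d → k) (σ : Finset (Fin n)) (c : Fc Δ d → k) : Prop :=
  (∀ F, c F ≠ 0 → σ ⊆ F.1) ∧ ∀ ρ : Rd Δ d, σ ⊆ ρ.1 → ∑ F, eps F ρ * c F = 0

/-- shift data: a homogeneous hom from ω to R of degree p - a -/
structure Sh (eps : Fc Δ d → Rd Δ d → k) (p a : Fin n →₀ ℕ) (q : Fc Δ d → k) : Prop where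
  S : ∀ F, q F ≠ 0 → ∀ i, i ∉ F.1 → p i = a i
  H0 : ∀ a' c', Zp eps a'.support c' → ¬ a ≤ p + a' → ∀ F, q F * c' F = 0
  H1 : ∀ (a' : Fin n →₀ ℕ) c' (t : Fin n →₀ ℕ), Zp eps a'.support c' → t + a = p + a' → ∀ F G : Fc Δ d,
    t.support ⊆ F.1 → t.support ⊆ G.1 → q F * c' F = q G * c' G

/-- witness that the monomial t0 is in the trace -/
def Wt (eps : Fc Δ d → Rd Δ d → k) (t0 : Fin n →₀ ℕ) : Prop :=
  ∃ a c q, Zp eps a.support c ∧ Sh eps t0 a q ∧ ∀ F : Fc Δ d, t0.support ⊆ F.1 → q F * c F = 1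

lemma rc_C_mul (Γ : LowerSet (Finset (Fin n))) (t : Fin n →₀ ℕ) (x : k) (r : mQ k Γ) :
    rc Γ t (Ideal.Quotient.mk (mI k Γ) (C x) * r) = x * rc Γ t r := by
  classical
  obtain ⟨f, rfl⟩ := Ideal.Quotient.mk_surjective r
  rw [← map_mul, rc_mk, rc_mk, coeff_C_mul]
  split_ifs <;> simp

lemma Zp_smul {eps : Fc Δ d → Rd Δ d → k} {σ : Finset (Fin n)} {c : Fc Δ d → k} (h : Zp eps σ c) (x : k) :
    Zp eps σ (fun F => x * c F) := by
  refine ⟨fun F hF => h.1 F (right_ne_zero_of_mul hF), fun ρ hρ => ?_⟩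
  have := h.2 ρ hρ
  simp_rw [mul_left_comm _ x, ← Finset.mul_sum]
  rw [this, mul_zero]

namespace OD
variable {ω : Type} [AddCommGroup ω] [Module (mQ k Δ.low) ω] (O : OD k Δ d ω)
include O

lemma Z_of (η : ω) (a : Fin n →₀ ℕ) : Zp O.eps a.support (fun F => O.l F a η) := by
  refine ⟨fun F hF => ?_, fun ρ hρ => O.cond ρ a η hρ⟩
  by_contra h
  exact hF (O.supp F a η h)

lemma hm_exists (a : Fin n →₀ ℕ) (c : Fc Δ d → k) (h : Zp O.eps a.support c) :
    ∃ η, ∀ F s, O.l F s η = if s = a then c F else 0 := by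
  classical
  refine O.exi (fun F s => if s = a then c F else 0) ?_ ?_ ?_
  · intro F
    refine (Set.finite_singleton a).subset fun s hs => ?_
    by_contra h2
    exact hs (if_neg h2)
  · intro F s hs
    by_cases h2 : s = a
    · rw [if_pos h2]
      by_contra h3
      exact hs (h2 ▸ h.1 F h3)
    · rw [if_neg h2]
  · intro ρ t ht
    by_cases h2 : t = a
    · simp only [if_pos h2]
      exact h.2 ρ (h2 ▸ ht)
    · simp [h2]

open Classical in
/-- homogeneous element -/
noncomputable def hm (a : Fin n →₀ ℕ) (c : Fc Δ d → k) : ω :=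
  if h : Zp O.eps a.support c then (O.hm_exists a c h).choose else 0

lemma l_hm {a : Fin n →₀ ℕ} {c : Fc Δ d → k} (h : Zp O.eps a.support c) (F s) :
    O.l F s (O.hm a c) = if s = a then c F else 0 := by
  rw [hm, dif_pos h]
  exact (O.hm_exists a c h).choose_spec F s

open Classical in
lemma Zsingle (F : Fc Δ d) : Zp O.eps (ind F.1).support (Pi.single F (1:k)) := by
  rw [ind_support]
  constructor
  · intro G hG
    by_cases h : G = F
    · rw [h]
    · exact absurd (Pi.single_eq_of_ne h _) hG
  · intro ρ hρ
    have := Finset.card_le_card hρ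
    have h1 := F.2.2
    have h2 := ρ.2.2
    omega

open Classical in
/-- generator -/
noncomputable def ge (F : Fc Δ d) : ω := O.hm (ind F.1) (Pi.single F (1:k))

omit O in
lemma Fc_eq {F G : Fc Δ d} (h : F.1 ⊆ G.1) : F = G :=
  Subtype.ext (Finset.eq_of_subset_of_card_le h (by rw [F.2.2, G.2.2]))

lemma K1 {a : Fin n →₀ ℕ} {c : Fc Δ d → k} (h : Zp O.eps a.support c) (F : Fc Δ d) :
    (mon Δ.low (ind F.1) : mQ k Δ.low) • O.hm a c =
      (Ideal.Quotient.mk _ (C (c F)) : mQ k Δ.low) • (mon Δ.low a : mQ k Δ.low) • O.ge F := by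
  classical
  apply O.ext
  intro G s hs
  rw [O.smul_C]
  by_cases h1 : s = ind F.1 + a
  · subst h1
    have hFG : F.1 ⊆ G.1 := by
      rw [supp_add, ind_support] at hs
      exact Finset.subset_union_left.trans hs
    have := Fc_eq hFG
    subst this
    rw [O.smul_add _ _ _ _ hs, add_comm (ind F.1) a, O.smul_add _ _ _ _ (by rwa [add_comm]), O.l_hm h, ge, O.l_hm (O.Zsingle F)]
    simp
  · have hL : O.l G s ((mon Δ.low (ind F.1) : mQ k Δ.low) • O.hm a c) = 0 := by
      by_cases h2 : ind F.1 ≤ s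
      · obtain ⟨s', rfl⟩ := le_iff_exists_add.1 h2
        rw [O.smul_add _ _ _ _ hs, O.l_hm h, if_neg]
        rintro rfl; exact h1 rfl
      · exact O.smul_not_le _ _ _ _ h2
    have hR : O.l G s ((mon Δ.low a : mQ k Δ.low) • O.ge F) = 0 := by
      by_cases h2 : a ≤ s
      · obtain ⟨s', rfl⟩ := le_iff_exists_add.1 h2
        rw [O.smul_add _ _ _ _ hs, ge, O.l_hm (O.Zsingle F), if_neg]
        rintro rfl; exact h1 (add_comm _ _)
      · exact O.smul_not_le _ _ _ _ h2
    rw [hL, hR, mul_zero]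

lemma K2 (F : Fc Δ d) (i : Fin n) (hi : i ∉ F.1) :
    (mon Δ.low (Finsupp.single i 1) : mQ k Δ.low) • O.ge F = 0 := by
  classical
  apply O.ext
  intro G s hs
  rw [map_zero]
  by_cases h2 : Finsupp.single i 1 ≤ s
  · obtain ⟨s', rfl⟩ := le_iff_exists_add.1 h2
    rw [O.smul_add _ _ _ _ hs, ge, O.l_hm (O.Zsingle F)]
    split_ifs with h3
    · subst h3
      by_cases h4 : G = F
      · subst h4
        exact absurd (hs (by simp)) hi
      · exact Pi.single_eq_of_ne h4 _
    · rfl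
  · exact O.smul_not_le _ _ _ _ h2

lemma decomp (η : ω) : ∃ A : Finset (Fin n →₀ ℕ), η = ∑ a ∈ A, O.hm a (fun F => O.l F a η) := by
  classical
  have hfin : (⋃ F : Fc Δ d, {s | O.l F s η ≠ 0}).Finite := Set.finite_iUnion fun F => O.fin F η
  refine ⟨hfin.toFinset, O.ext _ _ fun F s _ => ?_⟩
  rw [map_sum]
  simp_rw [O.l_hm (O.Z_of η _)]
  rw [Finset.sum_ite_eq]
  split_ifs with h
  · rfl
  · by_contra h2
    apply h
    rw [Set.Finite.mem_toFinset, Set.mem_iUnion]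
    exact ⟨F, h2⟩

theorem extract1 (φ : ω →ₗ[mQ k Δ.low] mQ k Δ.low) (t0 a : Fin n →₀ ℕ) (c : Fc Δ d → k)
    (hc : Zp O.eps a.support c) (hne : rc Δ.low t0 (φ (O.hm a c)) ≠ 0) : Wt O.eps t0 := by
  classical
  let q : Fc Δ d → k := fun F => if a ≤ ind F.1 + t0 then rc Δ.low (ind F.1 + t0 - a) (φ (O.ge F)) else 0
  have hq1 : ∀ F u, u + a = ind F.1 + t0 → q F = rc Δ.low u (φ (O.ge F)) := by
    intro F u h
    have h1 : a ≤ ind F.1 + t0 := h ▸ le_add_self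
    simp only [q, if_pos h1]
    rw [← h, add_tsub_cancel_right]
  have hq0 : ∀ F, ¬ a ≤ ind F.1 + t0 → q F = 0 := fun F h => if_neg h
  have hq2 : ∀ F, q F ≠ 0 → ∃ u, u + a = ind F.1 + t0 := by
    intro F h
    have : a ≤ ind F.1 + t0 := by
      by_contra h2; exact h (hq0 F h2)
    exact ⟨_, tsub_add_cancel_of_le this⟩
  have hK : ∀ a' c', Zp O.eps a'.support c' → ∀ F t, rc Δ.low t (mon Δ.low (ind F.1) * φ (O.hm a' c')) =
      c' F * rc Δ.low t (mon Δ.low a' * φ (O.ge F)) := by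
    intro a' c' h F t
    have := congrArg φ (O.K1 h F)
    rw [map_smul, map_smul, map_smul, smul_eq_mul, smul_eq_mul, smul_eq_mul] at this
    rw [this, rc_C_mul]
  have hS : ∀ F, q F ≠ 0 → ∀ i, i ∉ F.1 → t0 i = a i := by
    intro F hF i hi
    obtain ⟨u, hu⟩ := hq2 F hF
    rw [hq1 F u hu] at hF
    have h1 := congrArg (· i) hu
    simp only [Finsupp.add_apply, ind_apply, if_neg hi, zero_add] at h1
    by_contra h2
    have h3 : u i ≠ 0 := by omega
    have hus : u.support ∈ Δ.low := by
      by_contra h4; exact hF (rc_of_notMem h4 _)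
    have h5 : (Finsupp.single i 1 + u).support = u.support := by
      rw [supp_add, Finset.union_eq_right]
      intro j hj
      have : j = i := by simpa using hj
      rw [this]; simpa using h3
    have h6 := rc_mon_mul_add (Finsupp.single i 1) u (φ (O.ge F)) (by rw [h5]; exact hus)
    have h7 := congrArg φ (O.K2 F i hi)
    rw [map_smul, smul_eq_mul, map_zero] at h7
    rw [h7, map_zero] at h6
    exact hF h6.symm
  have hfac : ∀ (F : Fc Δ d) (s : Fin n →₀ ℕ), s.support ⊆ F.1 → s.support ∈ Δ.low := fun F s h => Δ.down_closed F.2.1 h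
  have hcl : ∀ a' c' t, Zp O.eps a'.support c' → t + a = t0 + a' → ∀ F : Fc Δ d, t.support ⊆ F.1 →
      rc Δ.low t (φ (O.hm a' c')) = q F * c' F := by
    intro a' c' t h ht F hF
    rw [← rc_mon_mul_add (ind F.1) t _ (hfac F _ (by rw [supp_add, ind_support]; exact Finset.union_subset subset_rfl hF)),
      hK a' c' h, mul_comm (q F)]
    by_cases h1 : c' F = 0
    · rw [h1, zero_mul, zero_mul]
    congr 1
    by_cases h2 : a ≤ ind F.1 + t0
    · obtain ⟨u, hu⟩ : ∃ u, u + a = ind F.1 + t0 := ⟨_, tsub_add_cancel_of_le h2⟩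
      have h3 : ind F.1 + t = a' + u := by
        apply add_right_cancel (b := a)
        rw [add_assoc, ht, add_assoc, hu]; abel
      rw [hq1 F u hu, h3, rc_mon_mul_add]
      refine hfac F _ ?_
      rw [← h3, supp_add, ind_support]; exact Finset.union_subset subset_rfl hF
    · rw [hq0 F h2, rc_mon_mul_not]
      intro h3
      obtain ⟨s, hs⟩ := le_iff_exists_add.1 h3
      apply h2
      refine le_iff_exists_add.2 ⟨s, ?_⟩
      apply add_right_cancel (b := a')
      rw [add_assoc, ← ht, ← add_assoc, hs]; abel
  set κ := rc Δ.low t0 (φ (O.hm a c)) with hκ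
  refine ⟨a, fun F => κ⁻¹ * c F, q, Zp_smul hc _, ⟨hS, ?_, ?_⟩, ?_⟩
  · intro a' c' hc' hnle F
    by_contra hcon
    have hqF := left_ne_zero_of_mul hcon
    have hcF := right_ne_zero_of_mul hcon
    obtain ⟨u, hu⟩ := hq2 F hqF
    have huF : u.support ⊆ F.1 := by
      intro i hi
      by_contra h2
      have h1 := congrArg (· i) hu
      simp only [Finsupp.add_apply, ind_apply, if_neg h2, zero_add] at h1
      have := hS F hqF i h2
      simp at hi
      omega
    have h3 := hK a' c' hc' F (a' + u)
    rw [rc_mon_mul_add _ _ _ (hfac F _ (by rw [supp_add]; exact Finset.union_subset (hc'.1 F hcF) huF)),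
      ← hq1 F u hu, rc_mon_mul_not] at h3
    · exact hcon (by rw [mul_comm]; exact h3.symm)
    · intro h4
      obtain ⟨s, hs⟩ := le_iff_exists_add.1 h4
      apply hnle
      refine le_iff_exists_add.2 ⟨s, ?_⟩
      apply add_left_cancel (a := ind F.1)
      rw [← add_assoc, ← hu, add_left_comm, ← hs]; abel
  · intro a' c' t hc' ht F G hF hG
    rw [← hcl a' c' t hc' ht F hF, ← hcl a' c' t hc' ht G hG]
  · intro F hF
    rw [mul_left_comm, ← hcl a c t0 hc rfl F hF, inv_mul_cancel₀ hne]

theorem extract (r : mQ k Δ.low) (hr : r ∈ traceIdeal (mQ k Δ.low) ω) (t0 : Fin n →₀ ℕ) 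
    (hne : rc Δ.low t0 r ≠ 0) : Wt O.eps t0 := by
  by_contra hcon
  apply hne
  refine Submodule.iSup_induction (fun f : ω →ₗ[mQ k Δ.low] mQ k Δ.low => LinearMap.range f) 
    (motive := fun r => rc Δ.low t0 r = 0) hr ?_ (map_zero _) ?_
  · rintro φ _ ⟨η, rfl⟩
    obtain ⟨A, hA⟩ := O.decomp η
    rw [hA, map_sum, map_sum]
    refine Finset.sum_eq_zero fun a _ => ?_
    by_contra h
    exact hcon (O.extract1 φ t0 a _ (O.Z_of η a) h)
  · intro x y hx hy
    rw [map_add, hx, hy, add_zero]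

end OD
end Iface


section Iface2
open MvPolynomial
variable {k : Type} [Field k] {n : ℕ} {Δ : SC n} {d : ℕ}
variable {ω : Type} [AddCommGroup ω] [Module (mQ k Δ.low) ω]

theorem hom_exists (μ : (Fin n →₀ ℕ) → ω →+ k) (hfin : ∀ η, {t | μ t η ≠ 0}.Finite)
    (hsupp : ∀ t η, t.support ∉ Δ.low → μ t η = 0)
    (hadd : ∀ s t η, (s + t).support ∈ Δ.low → μ (s + t) ((mon Δ.low s : mQ k Δ.low) • η) = μ t η)
    (hnot : ∀ s t η, t.support ∈ Δ.low → ¬ s ≤ t → μ t ((mon Δ.low s : mQ k Δ.low) • η) = 0)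
    (hC : ∀ t (a : k) η, μ t ((Ideal.Quotient.mk _ (C a) : mQ k Δ.low) • η) = a * μ t η) :
    ∃ φ : ω →ₗ[mQ k Δ.low] mQ k Δ.low, ∀ t η, rc Δ.low t (φ η) = μ t η := by
  have hex : ∀ η, ∃ r : mQ k Δ.low, ∀ t, rc Δ.low t r = μ t η := by
    intro η
    exact rc_exists Δ.low (fun t => μ t η) (hfin η) (fun t ht => hsupp t η ht)
  choose f hf using hex
  have hfadd : ∀ x y, f (x + y) = f x + f y := by
    intro x y
    apply rc_ext
    intro t _
    rw [map_add, hf, hf, hf, map_add]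
  have hmon : ∀ s η, f ((mon Δ.low s : mQ k Δ.low) • η) = mon Δ.low s * f η := by
    intro s η
    apply rc_ext
    intro t ht
    rw [hf]
    by_cases h : s ≤ t
    · obtain ⟨t', rfl⟩ := le_iff_exists_add.1 h
      rw [hadd _ _ _ ht, rc_mon_mul_add _ _ _ ht, hf]
    · rw [hnot _ _ _ ht h, rc_mon_mul_not _ _ _ h]
  have hCC : ∀ (a : k) η, f ((Ideal.Quotient.mk _ (C a) : mQ k Δ.low) • η) = Ideal.Quotient.mk _ (C a) * f η := by
    intro a η
    apply rc_ext
    intro t ht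
    rw [hf, hC, rc_C_mul, hf]
  refine ⟨{ toFun := f, map_add' := hfadd, map_smul' := ?_ }, fun t η => hf η t⟩
  intro r η
  obtain ⟨g, rfl⟩ := Ideal.Quotient.mk_surjective r
  rw [RingHom.id_apply, smul_eq_mul]
  induction g using MvPolynomial.induction_on' with
  | monomial s a =>
    have : Ideal.Quotient.mk (mI k Δ.low) (monomial s a) = Ideal.Quotient.mk _ (C a) * mon Δ.low s := by
      rw [mon, ← map_mul, C_mul_monomial, mul_one]
    rw [this, mul_smul, hCC, hmon, mul_assoc]
  | add p q hp hq =>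
    rw [map_add, add_smul, hfadd, hp, hq, add_mul]

theorem OD.hom_of_Sh (O : OD k Δ d ω) (hpure : ∀ σ ∈ Δ.faces, ∃ F : Fc Δ d, σ ⊆ F.1)
    (p a : Fin n →₀ ℕ) (q : Fc Δ d → k) (h : Sh O.eps p a q) :
    ∃ φ : ω →ₗ[mQ k Δ.low] mQ k Δ.low, ∀ t η, 
      (∀ a' (F : Fc Δ d), t + a = p + a' → t.support ⊆ F.1 → rc Δ.low t (φ η) = q F * O.l F a' η) ∧
      (¬ p ≤ t + a → rc Δ.low t (φ η) = 0) := by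
  classical
  have : Nonempty (Fc Δ d) := ⟨(hpure ∅ Δ.empty_mem).choose⟩
  choose! Fa hFa using hpure
  have hFa' : ∀ t : Fin n →₀ ℕ, t.support ∈ Δ.low → t.support ⊆ (Fa t.support).1 := fun t ht => hFa _ ht
  let μ : (Fin n →₀ ℕ) → ω →+ k := fun t => 
    if p ≤ t + a ∧ t.support ∈ Δ.low then (AddMonoidHom.mulLeft (q (Fa t.support))).comp (O.l (Fa t.support) (t + a - p)) else 0
  have hμ1 : ∀ t a' η, t + a = p + a' → t.support ∈ Δ.low → μ t η = q (Fa t.support) * O.l (Fa t.support) a' η := by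
    intro t a' η ht hs
    simp only [μ]
    rw [if_pos ⟨ht ▸ le_self_add, hs⟩, ht, add_tsub_cancel_left]
    rfl
  have hμ2 : ∀ t η, ¬ p ≤ t + a → μ t η = 0 := by
    intro t η ht
    simp only [μ]
    rw [if_neg (fun h => ht h.1)]; rfl
  have hμ3 : ∀ t η, t.support ∉ Δ.low → μ t η = 0 := by
    intro t η ht
    simp only [μ]
    rw [if_neg (fun h => ht h.2)]; rfl
  have hμ4 : ∀ t a' η (F : Fc Δ d), t + a = p + a' → t.support ⊆ F.1 → μ t η = q F * O.l F a' η := by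
    intro t a' η F ht hF
    have hs : t.support ∈ Δ.low := Δ.down_closed F.2.1 hF
    rw [hμ1 t a' η ht hs]
    exact h.H1 a' _ t (O.Z_of η a') ht _ _ (hFa' t hs) hF
  suffices key : ∃ φ : ω →ₗ[mQ k Δ.low] mQ k Δ.low, ∀ t η, rc Δ.low t (φ η) = μ t η by
    obtain ⟨φ, hφ⟩ := key
    refine ⟨φ, fun t η => ⟨fun a' F h1 h2 => ?_, fun h1 => ?_⟩⟩
    · rw [hφ, hμ4 t a' η F h1 h2]
    · rw [hφ, hμ2 t η h1]
  refine hom_exists (Δ := Δ) μ ?_ hμ3 ?_ ?_ ?_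
  · intro η
    have hfin : (⋃ F : Fc Δ d, {s | O.l F s η ≠ 0}).Finite := Set.finite_iUnion fun F => O.fin F η
    refine ((hfin.image (fun s => p + s)).preimage (f := fun t => t + a) (fun x _ y _ h => add_right_cancel h)).subset ?_
    intro t ht
    have h1 : p ≤ t + a := by
      by_contra h2; exact ht (hμ2 t η h2)
    have h2 : t.support ∈ Δ.low := by
      by_contra h2; exact ht (hμ3 t η h2)
    obtain ⟨a', ha'⟩ := le_iff_exists_add.1 h1
    have h3 : μ t η ≠ 0 := ht
    rw [hμ1 t a' η ha' h2] at h3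
    exact ⟨a', Set.mem_iUnion.2 ⟨_, right_ne_zero_of_mul h3⟩, ha'.symm⟩
  · intro s t η hst
    set F := Fa (s + t).support
    have hF : (s+t).support ⊆ F.1 := hFa' _ hst
    have htF : t.support ⊆ F.1 := by
      rw [supp_add] at hF; exact Finset.subset_union_right.trans hF
    by_cases h1 : p ≤ t + a
    · obtain ⟨a', ha'⟩ := le_iff_exists_add.1 h1
      rw [hμ4 (s+t) (s + a') _ F (by rw [add_assoc, ha']; abel) hF, hμ4 t a' _ F ha' htF]
      by_cases hq : q F = 0
      · rw [hq, zero_mul, zero_mul]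
      rw [O.smul_add]
      rw [supp_add] at hF ⊢
      refine Finset.union_subset (Finset.subset_union_left.trans hF) fun i hi => ?_
      by_contra hiF
      have h2 := h.S F hq i hiF
      have h3 := congrArg (· i) ha'
      simp only [Finsupp.add_apply] at h3
      have h4 : t i = 0 := by
        by_contra h5
        exact hiF (htF (by simpa using h5))
      simp at hi
      omega
    · rw [hμ2 t η h1]
      by_cases h2 : p ≤ s + t + a
      · obtain ⟨a', ha'⟩ := le_iff_exists_add.1 h2
        rw [hμ4 (s+t) a' _ F ha' hF, O.smul_not_le, mul_zero]
        intro h3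
        obtain ⟨u, rfl⟩ := le_iff_exists_add.1 h3
        apply h1
        refine le_iff_exists_add.2 ⟨u, ?_⟩
        apply add_left_cancel (a := s)
        rw [← add_assoc, ha']; abel
      · rw [hμ2 _ _ h2]
  · intro s t η hts hnle
    by_cases h1 : p ≤ t + a
    swap
    · rw [hμ2 _ _ h1]
    obtain ⟨a', ha'⟩ := le_iff_exists_add.1 h1
    rw [hμ1 t a' _ ha' hts]
    by_cases h2 : s ≤ a'
    swap
    · rw [O.smul_not_le _ _ _ _ h2, mul_zero]
    obtain ⟨u, rfl⟩ := le_iff_exists_add.1 h2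
    by_cases h3 : (s + u).support ⊆ (Fa t.support).1
    swap
    · rw [O.supp _ _ _ h3, mul_zero]
    rw [O.smul_add _ _ _ _ h3]
    refine h.H0 u _ (O.Z_of η u) ?_ _
    intro h4
    obtain ⟨x, hx⟩ := le_iff_exists_add.1 h4
    apply hnle
    refine le_iff_exists_add.2 ⟨x, ?_⟩
    apply add_right_cancel (b := a)
    rw [ha', add_left_comm, hx]; abel
  · intro t x η
    by_cases h1 : p ≤ t + a
    swap
    · rw [hμ2 _ _ h1, hμ2 _ _ h1, mul_zero]
    by_cases hs : t.support ∈ Δ.low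
    swap
    · rw [hμ3 _ _ hs, hμ3 _ _ hs, mul_zero]
    obtain ⟨a', ha'⟩ := le_iff_exists_add.1 h1
    rw [hμ1 t a' _ ha' hs, hμ1 t a' _ ha' hs, O.smul_C, mul_left_comm]

theorem OD.mem_trace (O : OD k Δ d ω) (hpure : ∀ σ ∈ Δ.faces, ∃ F : Fc Δ d, σ ⊆ F.1)
    (t0 : Fin n →₀ ℕ) (h : Wt O.eps t0) : mon Δ.low t0 ∈ traceIdeal (mQ k Δ.low) ω := by
  classical
  obtain ⟨a, c, q, hc, hSh, hqc⟩ := h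
  obtain ⟨φ, hφ⟩ := O.hom_of_Sh hpure t0 a q hSh
  have : φ (O.hm a c) = mon Δ.low t0 := by
    apply rc_ext
    intro t ht
    obtain ⟨F, hF⟩ := hpure _ ht
    rw [rc_mon]
    by_cases h1 : t0 ≤ t + a
    · obtain ⟨a', ha'⟩ := le_iff_exists_add.1 h1
      rw [(hφ t _).1 a' F ha' hF, O.l_hm hc]
      by_cases h2 : t0 = t
      · subst h2
        have := add_left_cancel ha'
        rw [if_pos this.symm, if_pos ⟨ht, rfl⟩, hqc F hF]
      · rw [if_neg, mul_zero, if_neg (fun h => h2 h.2)]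
        rintro rfl
        exact h2 (add_right_cancel ha').symm
    · rw [(hφ t _).2 h1, if_neg]
      rintro ⟨_, rfl⟩
      exact h1 le_self_add
  rw [← this]
  exact Submodule.mem_iSup_of_mem φ ⟨_, rfl⟩

theorem OD.trace_iff (O : OD k Δ d ω) (hpure : ∀ σ ∈ Δ.faces, ∃ F : Fc Δ d, σ ⊆ F.1) :
    traceIdeal (mQ k Δ.low) ω = quotMax k (mI k Δ.low) ↔
      (∀ v : Fin n, {v} ∈ Δ.faces → Wt O.eps (Finsupp.single v 1)) ∧ ¬ Wt O.eps 0 := by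
  classical
  have hs : ∀ v : Fin n, (Finsupp.single v 1 : Fin n →₀ ℕ).support = {v} := fun v => Finsupp.support_single v one_ne_zero
  constructor
  · intro h
    refine ⟨fun v hv => ?_, fun h0 => ?_⟩
    · refine O.extract (mon Δ.low (Finsupp.single v 1)) ?_ _ ?_
      · rw [h, quotMax_eq]; exact Ideal.subset_span ⟨v, rfl⟩
      · rw [rc_mon, if_pos ⟨by rw [hs]; exact hv, rfl⟩]; exact one_ne_zero
    · have := O.mem_trace hpure 0 h0
      rw [h, mem_srMax, rc_mon, if_pos ⟨zero_supp_mem Δ, rfl⟩] at this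
      exact one_ne_zero this
  · rintro ⟨h1, h2⟩
    apply le_antisymm
    · intro r hr
      rw [mem_srMax]
      by_contra h3
      exact h2 (O.extract r hr 0 h3)
    · rw [quotMax_eq, Ideal.span_le]
      rintro _ ⟨v, rfl⟩
      by_cases hv : {v} ∈ Δ.faces
      · exact O.mem_trace hpure _ (h1 v hv)
      · have : mon (k := k) Δ.low (Finsupp.single v 1) = 0 := mon_eq_zero (by rw [hs]; exact hv)
        simp only [this]
        exact Ideal.zero_mem _

end Iface2


section Comb
variable {k : Type} [Field k] {n : ℕ} {Δ : SC n} {d : ℕ}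

lemma single_supp (v : Fin n) : (Finsupp.single v 1 : Fin n →₀ ℕ).support = {v} :=
  Finsupp.support_single v one_ne_zero

lemma Rd_eq {ρ τ : Rd Δ d} (h : ρ.1 ⊆ τ.1) : ρ = τ :=
  Subtype.ext (Finset.eq_of_subset_of_card_le h (by have := ρ.2.2; have := τ.2.2; omega))

lemma inter_eq {ρ : Rd Δ d} {F G : Fc Δ d} (hne : F ≠ G) (hF : ρ.1 ⊆ F.1) (hG : ρ.1 ⊆ G.1) :
    F.1 ∩ G.1 = ρ.1 := by
  symm
  apply Finset.eq_of_subset_of_card_le (Finset.subset_inter hF hG)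
  by_contra h
  apply hne
  have h1 : F.1 ∩ G.1 = F.1 := Finset.eq_of_subset_of_card_le Finset.inter_subset_left
    (by have := ρ.2.2; have := F.2.2; omega)
  exact OD.Fc_eq (h1 ▸ Finset.inter_subset_right)

/-- the ridge of F opposite to w -/
def rdg (F : Fc Δ d) {w : Fin n} (hw : w ∈ F.1) : Rd Δ d :=
  ⟨F.1.erase w, Δ.down_closed F.2.1 (Finset.erase_subset _ _), by
    rw [Finset.card_erase_add_one hw, F.2.2]⟩

lemma sum2 {eps : Fc Δ d → Rd Δ d → k} (heps : ∀ F ρ, eps F ρ ≠ 0 ↔ ρ.1 ⊆ F.1) {ρ : Rd Δ d}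
    {F G : Fc Δ d} (hne : F ≠ G) (h : ∀ H : Fc Δ d, ρ.1 ⊆ H.1 → H = F ∨ H = G) (c : Fc Δ d → k) :
    ∑ H, eps H ρ * c H = eps F ρ * c F + eps G ρ * c G := by
  classical
  apply Finset.sum_eq_add F G hne
  · intro H _ hH
    by_contra h0
    rcases h H ((heps H ρ).1 (left_ne_zero_of_mul h0)) with h1 | h1
    · exact hH.1 h1
    · exact hH.2 h1
  · intro h; exact absurd (Finset.mem_univ _) h
  · intro h; exact absurd (Finset.mem_univ _) h

lemma sum1 {eps : Fc Δ d → Rd Δ d → k} (heps : ∀ F ρ, eps F ρ ≠ 0 ↔ ρ.1 ⊆ F.1) {ρ : Rd Δ d}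
    {F : Fc Δ d} (h : ∀ H : Fc Δ d, ρ.1 ⊆ H.1 → H = F) (c : Fc Δ d → k) :
    ∑ H, eps H ρ * c H = eps F ρ * c F := by
  classical
  apply Finset.sum_eq_single F
  · intro H _ hH
    by_contra h0
    exact hH (h H ((heps H ρ).1 (left_ne_zero_of_mul h0)))
  · intro h; exact absurd (Finset.mem_univ _) h

/-- a cycle vanishes at a facet with a boundary ridge -/
lemma bdry_zero {eps : Fc Δ d → Rd Δ d → k} (heps : ∀ F ρ, eps F ρ ≠ 0 ↔ ρ.1 ⊆ F.1) {ρ : Rd Δ d}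
    {F : Fc Δ d} (hF : ρ.1 ⊆ F.1) (h : ∀ H : Fc Δ d, ρ.1 ⊆ H.1 → H = F) {σ : Finset (Fin n)}
    {c : Fc Δ d → k} (hc : Zp eps σ c) (hσ : σ ⊆ ρ.1) : c F = 0 := by
  have := hc.2 ρ hσ
  rw [sum1 heps h] at this
  exact (mul_eq_zero.1 this).resolve_left ((heps F ρ).2 hF)

open Classical in
noncomputable def pairC (eps : Fc Δ d → Rd Δ d → k) (ρ : Rd Δ d) (F G : Fc Δ d) : Fc Δ d → k :=
  fun H => if H = F then eps G ρ else if H = G then - eps F ρ else 0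

lemma Zpair (eps : Fc Δ d → Rd Δ d → k) {ρ : Rd Δ d}
    {F G : Fc Δ d} (hne : F ≠ G) (hF : ρ.1 ⊆ F.1) (hG : ρ.1 ⊆ G.1) :
    Zp eps ρ.1 (pairC eps ρ F G) := by
  classical
  constructor
  · intro H hH
    simp only [pairC] at hH
    split_ifs at hH with h1 h2
    · exact h1 ▸ hF
    · exact h2 ▸ hG
    · exact absurd rfl hH
  · intro τ hτ
    rw [← Rd_eq hτ]
    rw [Finset.sum_eq_add F G hne]
    · simp [pairC, hne.symm]; ring
    · intro H _ hH
      simp [pairC, hH.1, hH.2]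
    · intro h; exact absurd (Finset.mem_univ _) h
    · intro h; exact absurd (Finset.mem_univ _) h

theorem Gor {eps : Fc Δ d → Rd Δ d → k} (heps : ∀ F ρ, eps F ρ ≠ 0 ↔ ρ.1 ⊆ F.1) (hC : CMc Δ d)
    (h2 : ∀ (ρ : Rd Δ d) (F G : Fc Δ d), F ≠ G → ρ.1 ⊆ F.1 → ρ.1 ⊆ G.1 →
      ∀ H : Fc Δ d, ρ.1 ⊆ H.1 → H = F ∨ H = G)
    {z : Fc Δ d → k} (hz : Zp eps ∅ z) (hz0 : ∀ F, z F ≠ 0) : Wt eps 0 := by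
  refine ⟨0, z, fun F => (z F)⁻¹, by rwa [Finsupp.support_zero], ⟨fun _ _ _ _ => rfl, ?_, ?_⟩, ?_⟩
  · intro a' c' _ h
    exact absurd (zero_le) h
  · intro a' c' t hc ht F G hF hG
    have ht' : t = a' := by simpa using ht
    subst ht'
    refine (hC.conn t.support (Δ.down_closed F.2.1 hF) (fun H => (z F)⁻¹ * c' F = (z H)⁻¹ * c' H) ?_ F G hF hG rfl)
    intro F' G' ρ hρ hF' hG' hP
    refine hP.trans ?_
    by_cases hne : F' = G'
    · rw [hne]
    have e1 := hc.2 ρ hρ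
    have e2 := hz.2 ρ (Finset.empty_subset _)
    rw [sum2 heps hne (h2 ρ F' G' hne hF' hG')] at e1 e2
    have hε := (heps F' ρ).2 hF'
    have : c' F' * z G' = c' G' * z F' := by
      apply mul_left_cancel₀ hε
      linear_combination z G' * e1 - c' G' * e2
    have := hz0 F'
    have := hz0 G'
    field_simp
    linear_combination ‹c' F' * z G' = c' G' * z F'›
  · intro F _
    exact inv_mul_cancel₀ (hz0 F)

theorem Cone {eps : Fc Δ d → Rd Δ d → k} (heps : ∀ F ρ, eps F ρ ≠ 0 ↔ ρ.1 ⊆ F.1) (hC : CMc Δ d)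
    {w : Fin n} (hw : ∀ F : Fc Δ d, w ∈ F.1) (hb : ∀ F H : Fc Δ d, F.1.erase w ⊆ H.1 → H = F)
    (h : Wt eps (Finsupp.single w 1)) : Wt eps 0 := by
  classical
  obtain ⟨a, c, q, hc, hS, h1⟩ := h
  rw [single_supp] at h1
  have h1' : ∀ F, q F * c F = 1 := fun F => h1 F (Finset.singleton_subset_iff.2 (hw F))
  have hcn : ∀ F, c F ≠ 0 := fun F h0 => by have := h1' F; rw [h0, mul_zero] at this; exact zero_ne_one this
  have hsa : ∀ F : Fc Δ d, a.support ⊆ F.1 := fun F => hc.1 F (hcn F)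
  have hz : ∀ (F : Fc Δ d) (s : Finset (Fin n)) (c' : Fc Δ d → k), Zp eps s c' → w ∉ s → c' F = 0 := by
    intro F s c' hc' hws
    by_contra h0
    apply h0
    refine bdry_zero heps (ρ := rdg F (hw F)) (Finset.erase_subset _ _) (fun H hH => hb F H hH) hc' ?_
    intro x hx
    exact Finset.mem_erase.2 ⟨fun e => hws (e ▸ hx), hc'.1 F h0 hx⟩
  obtain ⟨F0, -⟩ := hC.pure ∅ Δ.empty_mem
  have haw : a w ≠ 0 := by
    intro h0
    exact hcn F0 (hz F0 a.support c hc (by simp [h0]))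
  by_cases h2 : 2 ≤ a w
  · have hle : Finsupp.single w 1 ≤ a := by
      rw [Finsupp.single_le_iff]; omega
    obtain ⟨b, rfl⟩ := le_iff_exists_add.1 hle
    have hsb : (Finsupp.single w 1 + b).support = b.support := by
      ext i
      by_cases hi : i = w
      · subst hi; simp at h2 ⊢; omega
      · simp [Finsupp.single_apply, Ne.symm hi]
    rw [hsb] at hc hsa
    refine ⟨b, c, q, hc, ⟨?_, ?_, ?_⟩, fun F _ => h1' F⟩
    · intro F _ i hi
      have := Finset.notMem_mono (hsa F) hi
      rw [Finsupp.notMem_support_iff] at this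
      rw [this]; rfl
    · intro a' c' hc' hn F
      refine hS.H0 a' c' hc' (fun hh => hn ?_) F
      rw [zero_add]
      exact le_of_add_le_add_left hh
    · intro a' c' t hc' ht F G hF hG
      refine hS.H1 a' c' t hc' ?_ F G hF hG
      rw [add_left_comm, ht, zero_add]
  · have haw1 : a w = 1 := by omega
    refine ⟨a, c, q, hc, ⟨?_, ?_, ?_⟩, fun F _ => h1' F⟩
    · intro F _ i hi
      have := Finset.notMem_mono (hsa F) hi
      rw [Finsupp.notMem_support_iff] at this
      rw [this]; rfl
    · intro a' c' hc' hn F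
      by_cases h3 : a ≤ Finsupp.single w 1 + a'
      · rw [hz F a'.support c' hc' ?_, mul_zero]
        intro hwa
        apply hn
        rw [zero_add]
        intro i
        by_cases hi : i = w
        · subst hi
          rw [Finsupp.mem_support_iff] at hwa; omega
        · have := h3 i
          simpa [Finsupp.single_apply, Ne.symm hi] using this
      · exact hS.H0 a' c' hc' h3 F
    · intro a' c' t hc' ht F G hF hG
      have hsub : ∀ F : Fc Δ d, t.support ⊆ F.1 → (t + Finsupp.single w 1).support ⊆ F.1 := by
        intro F hF
        refine Finsupp.support_add.trans (Finset.union_subset hF ?_)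
        rw [single_supp]; exact Finset.singleton_subset_iff.2 (hw F)
      refine hS.H1 a' c' (t + Finsupp.single w 1) hc' ?_ F G (hsub F hF) (hsub G hG)
      rw [add_right_comm, ht, zero_add, add_comm]

lemma Wt_supp {eps : Fc Δ d → Rd Δ d → k} {v : Fin n} {a : Fin n →₀ ℕ} {c q : Fc Δ d → k}
    (hc : Zp eps a.support c)
    (h1 : ∀ F : Fc Δ d, (Finsupp.single v 1 : Fin n →₀ ℕ).support ⊆ F.1 → q F * c F = 1) (F : Fc Δ d)
    (hF : v ∈ F.1) : q F ≠ 0 ∧ c F ≠ 0 ∧ a.support ⊆ F.1 := by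
  have h := h1 F (by rw [single_supp]; exact Finset.singleton_subset_iff.2 hF)
  have hcn : c F ≠ 0 := fun h0 => by rw [h0, mul_zero] at h; exact zero_ne_one h
  refine ⟨fun h0 => by rw [h0, zero_mul] at h; exact zero_ne_one h, hcn, hc.1 F hcn⟩

theorem LemR {eps : Fc Δ d → Rd Δ d → k} (heps : ∀ F ρ, eps F ρ ≠ 0 ↔ ρ.1 ⊆ F.1) {v : Fin n}
    (h : Wt eps (Finsupp.single v 1)) {ρ : Rd Δ d} {F G : Fc Δ d} (hv : v ∈ ρ.1) (hne : F ≠ G)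
    (hF : ρ.1 ⊆ F.1) (hG : ρ.1 ⊆ G.1) (H : Fc Δ d) (hH : ρ.1 ⊆ H.1) : H = F ∨ H = G := by
  classical
  obtain ⟨a, c, q, hc, hS, h1⟩ := h
  have hsa : a.support ⊆ ρ.1 := by
    rw [← inter_eq hne hF hG]
    exact Finset.subset_inter (Wt_supp hc h1 F (hF hv)).2.2 (Wt_supp hc h1 G (hG hv)).2.2
  by_contra hcon
  push Not at hcon
  have e1 : (ind ρ.1 + a).support = ρ.1 := by
    rw [supp_add, ind_support]; exact Finset.union_eq_left.2 hsa
  have e2 : (Finsupp.single v 1 + ind ρ.1).support = ρ.1 := by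
    rw [supp_add, ind_support, single_supp]
    exact Finset.union_eq_right.2 (Finset.singleton_subset_iff.2 hv)
  have := hS.H1 (ind ρ.1 + a) (pairC eps ρ F G) (Finsupp.single v 1 + ind ρ.1)
    (by rw [e1]; exact Zpair eps hne hF hG) (add_assoc _ _ _) F H (by rw [e2]; exact hF) (by rw [e2]; exact hH)
  simp only [pairC, if_pos, if_neg hcon.1, if_neg hcon.2, mul_zero] at this
  rcases mul_eq_zero.1 this with h2 | h2
  · exact (Wt_supp hc h1 F (hF hv)).1 h2
  · exact (heps G ρ).2 hG h2

theorem LemB {eps : Fc Δ d → Rd Δ d → k} (heps : ∀ F ρ, eps F ρ ≠ 0 ↔ ρ.1 ⊆ F.1) {v : Fin n}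
    (h : Wt eps (Finsupp.single v 1)) {ρ : Rd Δ d} {F : Fc Δ d} (hv : v ∈ ρ.1)
    (hF : ρ.1 ⊆ F.1) (hu : ∀ H : Fc Δ d, ρ.1 ⊆ H.1 → H = F) {w : Fin n} (hw : w ∈ F.1) (hwρ : w ∉ ρ.1)
    (G : Fc Δ d) (hG : v ∈ G.1) : w ∈ G.1 := by
  classical
  obtain ⟨a, c, q, hc, hS, h1⟩ := h
  apply (Wt_supp hc h1 G hG).2.2
  by_contra hwa
  apply (Wt_supp hc h1 F (hF hv)).2.1
  refine bdry_zero heps hF hu hc ?_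
  have hρ : ρ = rdg F hw := Rd_eq (fun x hx => Finset.mem_erase.2 ⟨fun e => hwρ (e ▸ hx), hF hx⟩)
  rw [hρ]
  intro x hx
  exact Finset.mem_erase.2 ⟨fun e => hwa (e ▸ hx), (Wt_supp hc h1 F (hF hv)).2.2 hx⟩

end Comb


section Fwd
variable {k : Type} [Field k] {n : ℕ} {Δ : SC n} {d : ℕ}

theorem fwd_zero {eps : Fc Δ 0 → Rd Δ 0 → k} (heps : ∀ F ρ, eps F ρ ≠ 0 ↔ ρ.1 ⊆ F.1) (hC : CMc Δ 0)
    (h0 : ¬ Wt eps 0) : False := by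
  apply h0
  refine Gor heps hC ?_ (z := fun _ => 1) ⟨fun _ _ => Finset.empty_subset _, ?_⟩ (fun _ => one_ne_zero)
  · intro ρ; have := ρ.2.2; omega
  · intro ρ; have := ρ.2.2; omega

theorem fwd_one {eps : Fc Δ 1 → Rd Δ 1 → k} (heps : ∀ F ρ, eps F ρ ≠ 0 ↔ ρ.1 ⊆ F.1) (hC : CMc Δ 1)
    (hW : ∀ v, {v} ∈ Δ.faces → Wt eps (Finsupp.single v 1))
    (h0 : ¬ Wt eps 0) : ∃ m, 3 ≤ m ∧ Δ.IsDisjointVertices m := by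
  classical
  let S : Finset (Fin n) := Finset.univ.filter (fun v => {v} ∈ Δ.faces)
  have hS : ∀ v, v ∈ S ↔ {v} ∈ Δ.faces := fun v => by simp [S]
  refine ⟨S.card, ?_, ?_⟩
  · by_contra hlt
    apply h0
    obtain ⟨F0, -⟩ := hC.pure ∅ Δ.empty_mem
    obtain ⟨w, hw⟩ := Finset.card_eq_one.1 F0.2.2
    let ρ : Rd Δ 1 := ⟨∅, Δ.empty_mem, rfl⟩
    by_cases hu : ∀ F, F = F0
    · refine Cone heps hC (w := w) (fun F => by rw [hu F, hw]; exact Finset.mem_singleton_self w)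
        (fun F H _ => (hu H).trans (hu F).symm) (hW w (hw ▸ F0.2.1))
    · push Not at hu
      obtain ⟨F1, hne⟩ := hu
      have hall : ∀ H, H = F0 ∨ H = F1 := by
        intro H
        by_contra hc
        push Not at hc
        obtain ⟨w1, hw1⟩ := Finset.card_eq_one.1 F1.2.2
        obtain ⟨w2, hw2⟩ := Finset.card_eq_one.1 H.2.2
        have m0 := (hS w).2 (hw ▸ F0.2.1)
        have m1 := (hS w1).2 (hw1 ▸ F1.2.1)
        have m2 := (hS w2).2 (hw2 ▸ H.2.1)
        have n1 : w ≠ w1 := fun e => hne (Subtype.ext (by rw [hw1, hw, e]))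
        have n2 : w ≠ w2 := fun e => hc.1 (Subtype.ext (by rw [hw2, hw, e]))
        have n3 : w1 ≠ w2 := fun e => hc.2 (Subtype.ext (by rw [hw2, hw1, e]))
        apply hlt
        rw [← Finset.card_eq_three.2 ⟨w, w1, w2, n1, n2, n3, rfl⟩]
        apply Finset.card_le_card
        intro x hx
        simp only [Finset.mem_insert, Finset.mem_singleton] at hx
        rcases hx with rfl | rfl | rfl <;> assumption
      refine Gor heps hC ?_ (z := pairC eps ρ F0 F1) (Zpair eps hne.symm (Finset.empty_subset _) (Finset.empty_subset _)) ?_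
      · intro τ F G hFG _ _ H _
        rcases hall F with rfl | rfl <;> rcases hall G with rfl | rfl
        · exact absurd rfl hFG
        · exact hall H
        · exact (hall H).symm
        · exact absurd rfl hFG
      · intro F
        rcases hall F with rfl | rfl
        · simp only [pairC, if_pos]
          exact (heps _ _).2 (Finset.empty_subset _)
        · simp only [pairC, if_neg hne, if_pos]
          exact neg_ne_zero.2 ((heps _ _).2 (Finset.empty_subset _))
  · refine ⟨fun i => S.orderEmbOfFin rfl i, (S.orderEmbOfFin rfl).injective, fun σ => ⟨fun h => ?_, ?_⟩⟩
    · have := hC.card_le σ h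
      rcases Nat.lt_or_ge σ.card 1 with h1 | h1
      · left; exact Finset.card_eq_zero.1 (by omega)
      · right
        obtain ⟨w, rfl⟩ := Finset.card_eq_one.1 (le_antisymm this h1)
        have : w ∈ Set.range (S.orderEmbOfFin rfl) := by
          rw [Finset.range_orderEmbOfFin]; exact (hS w).2 h
        obtain ⟨i, hi⟩ := this
        exact ⟨i, by subst hi; rfl⟩
    · rintro (rfl | ⟨i, rfl⟩)
      · exact Δ.empty_mem
      · exact (hS _).1 (Finset.orderEmbOfFin_mem S rfl i)

/-- codimension one structure for d ≥ 2 -/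
theorem fwd_two_le {eps : Fc Δ d → Rd Δ d → k} (heps : ∀ F ρ, eps F ρ ≠ 0 ↔ ρ.1 ⊆ F.1)
    (hd : 2 ≤ d)
    (hW : ∀ v, {v} ∈ Δ.faces → Wt eps (Finsupp.single v 1))
    (ρ : Rd Δ d) (F G : Fc Δ d) (hne : F ≠ G) (hF : ρ.1 ⊆ F.1) (hG : ρ.1 ⊆ G.1)
    (H : Fc Δ d) (hH : ρ.1 ⊆ H.1) : H = F ∨ H = G := by
  have : ρ.1.Nonempty := by rw [← Finset.card_pos]; have := ρ.2.2; omega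
  obtain ⟨v, hv⟩ := this
  exact LemR heps (hW v (Δ.down_closed ρ.2.1 (Finset.singleton_subset_iff.2 hv))) hv hne hF hG H hH

theorem fwd_three {eps : Fc Δ d → Rd Δ d → k} (heps : ∀ F ρ, eps F ρ ≠ 0 ↔ ρ.1 ⊆ F.1) (hC : CMc Δ d)
    (hd : 3 ≤ d)
    (hW : ∀ v, {v} ∈ Δ.faces → Wt eps (Finsupp.single v 1))
    (h0 : ¬ Wt eps 0) (ρ : Rd Δ d) (F : Fc Δ d) (hF : ρ.1 ⊆ F.1)
    (hu : ∀ H : Fc Δ d, ρ.1 ⊆ H.1 → H = F) : False := by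
  classical
  obtain ⟨w, hwF, hwρ⟩ : ∃ w ∈ F.1, w ∉ ρ.1 := by
    by_contra hcon
    push Not at hcon
    have := Finset.card_le_card (show F.1 ⊆ ρ.1 from hcon)
    have := ρ.2.2; have := F.2.2; omega
  have hρ : ρ = rdg F hwF := Rd_eq (fun x hx => Finset.mem_erase.2 ⟨fun e => hwρ (e ▸ hx), hF hx⟩)
  have hA : ∀ G : Fc Δ d, w ∈ G.1 ∧ ∀ H : Fc Δ d, G.1.erase w ⊆ H.1 → H = G := by
    intro G
    refine hC.conn ∅ Δ.empty_mem (fun G => w ∈ G.1 ∧ ∀ H : Fc Δ d, G.1.erase w ⊆ H.1 → H = G) ?_ F G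
      (Finset.empty_subset _) (Finset.empty_subset _) ⟨hwF, fun H hH => hu H (by rw [hρ]; exact hH)⟩
    rintro G G' τ - hG hG' ⟨hwG, huG⟩
    by_cases hGG : G' = G
    · rw [hGG]; exact ⟨hwG, huG⟩
    have hwτ : w ∈ τ.1 := by
      by_contra hwτ
      have : τ = rdg G hwG := Rd_eq (fun x hx => Finset.mem_erase.2 ⟨fun e => hwτ (e ▸ hx), hG hx⟩)
      apply hGG
      apply huG
      have h2 : τ.1 = G.1.erase w := by rw [this]; rfl
      rw [← h2]; exact hG'
    refine ⟨hG' hwτ, fun H hH => ?_⟩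
    have hne : (τ.1.erase w).Nonempty := by
      rw [← Finset.card_pos, Finset.card_erase_of_mem hwτ]; have := τ.2.2; omega
    obtain ⟨v, hv⟩ := hne
    rw [Finset.mem_erase] at hv
    have hwH : w ∈ H.1 := by
      refine LemB heps (hW v (Δ.down_closed τ.2.1 (Finset.singleton_subset_iff.2 hv.2))) (ρ := rdg G hwG) (F := G) ?_ (Finset.erase_subset _ _)
        huG hwG (Finset.notMem_erase _ _) H (hH (Finset.mem_erase.2 ⟨hv.1, hG' hv.2⟩))
      exact Finset.mem_erase.2 ⟨hv.1, hG hv.2⟩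
    symm
    apply OD.Fc_eq
    intro x hx
    by_cases hxw : x = w
    · rw [hxw]; exact hwH
    · exact hH (Finset.mem_erase.2 ⟨hxw, hx⟩)
  exact h0 (Cone heps hC (fun F => (hA F).1) (fun F => (hA F).2)
    (hW w (Δ.down_closed F.2.1 (Finset.singleton_subset_iff.2 hwF))))

theorem fwd_nb {eps : Fc Δ d → Rd Δ d → k} (heps : ∀ F ρ, eps F ρ ≠ 0 ↔ ρ.1 ⊆ F.1) (hC : CMc Δ d)
    (hd : 2 ≤ d)
    (hW : ∀ v, {v} ∈ Δ.faces → Wt eps (Finsupp.single v 1))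
    (h0 : ¬ Wt eps 0) (nb : ∀ (ρ : Rd Δ d) (F : Fc Δ d), ρ.1 ⊆ F.1 → ∃ G : Fc Δ d, ρ.1 ⊆ G.1 ∧ G ≠ F) : False := by
  classical
  have h2 := fwd_two_le heps hd hW
  have hZ : ∀ z, Zp eps ∅ z → ∀ F, z F = 0 := by
    intro z hz F
    by_contra hzF
    apply h0
    refine Gor heps hC h2 hz fun G => ?_
    refine hC.conn ∅ Δ.empty_mem (fun G => z G ≠ 0) ?_ F G (Finset.empty_subset _) (Finset.empty_subset _) hzF
    intro F G ρ _ hF hG hne hG0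
    by_cases hFG : F = G
    · exact hne (hFG ▸ hG0)
    have := hz.2 ρ (Finset.empty_subset _)
    rw [sum2 heps hFG (h2 ρ F G hFG hF hG), hG0, mul_zero, add_zero] at this
    exact (mul_ne_zero ((heps F ρ).2 hF) hne) this
  obtain ⟨F0, -⟩ := hC.pure ∅ Δ.empty_mem
  have hsv : ∀ v {a : Fin n →₀ ℕ} {c q : Fc Δ d → k}, (Zp eps a.support c) →
     (∀ F : Fc Δ d, (Finsupp.single v 1 : Fin n →₀ ℕ).support ⊆ F.1 → q F * c F = 1) →
      v ∈ F0.1 → a.support ⊆ {v} := by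
    intro v a c q hc h1 hv u hu
    by_contra huv
    rw [Finset.mem_singleton] at huv
    have huF := (Wt_supp hc h1 F0 hv).2.2 hu
    obtain ⟨G, hG, hGF⟩ := nb (rdg F0 huF) F0 (Finset.erase_subset _ _)
    have hvG : v ∈ G.1 := hG (Finset.mem_erase.2 ⟨Ne.symm huv, hv⟩)
    have huG := (Wt_supp hc h1 G hvG).2.2 hu
    apply hGF
    symm
    apply OD.Fc_eq
    intro x hx
    by_cases hxu : x = u
    · rw [hxu]; exact huG
    · exact hG (Finset.mem_erase.2 ⟨hxu, hx⟩)
  have hcard : 1 < F0.1.card := by rw [F0.2.2]; omega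
  obtain ⟨v, hv, u, hu, hvu⟩ := Finset.one_lt_card.1 hcard
  have hWF : ∀ x ∈ F0.1, Wt eps (Finsupp.single x 1) := fun x hx =>
    hW x (Δ.down_closed F0.2.1 (Finset.singleton_subset_iff.2 hx))
  obtain ⟨a, c, q, hc, hS, h1⟩ := hWF v hv
  obtain ⟨b, e, r, he, hT, h1'⟩ := hWF u hu
  have ha := hsv v hc h1 hv
  have hb := hsv u he h1' hu
  have hav : a v ≠ 0 := by
    intro hav
    have : a.support = ∅ := by
      rw [Finset.eq_empty_iff_forall_notMem]
      intro x hx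
      have := ha hx
      rw [Finset.mem_singleton] at this
      subst this
      exact (Finsupp.mem_support_iff.1 hx) hav
    rw [this] at hc
    exact (Wt_supp (this.symm ▸ hc) h1 F0 hv).2.1 (hZ c hc F0)
  have hav1 : a v = 1 := by
    by_contra hne
    have hbv : b v = 0 := by
      by_contra hbv
      have := hb (Finsupp.mem_support_iff.2 hbv)
      exact hvu (Finset.mem_singleton.1 this)
    have := hS.H0 b e he (fun hle => by
      have := hle v
      simp [hbv] at this
      omega) F0
    exact (mul_ne_zero (Wt_supp hc h1 F0 hv).1 (Wt_supp he h1' F0 hu).2.1) this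
  have hae : a = Finsupp.single v 1 := by
    ext x
    by_cases hx : x = v
    · subst hx; simp [hav1]
    · rw [Finsupp.single_apply, if_neg (Ne.symm hx)]
      by_contra h
      exact hx (Finset.mem_singleton.1 (ha (Finsupp.mem_support_iff.2 h)))
  have hq : ∀ (ρ : Rd Δ d) (F G : Fc Δ d), F ≠ G → ρ.1 ⊆ F.1 → ρ.1 ⊆ G.1 →
      q F * eps G ρ = q G * - eps F ρ := by
    intro ρ F G hne hF hG
    have := hS.H1 (ind ρ.1) (pairC eps ρ F G) (ind ρ.1) (by rw [ind_support]; exact Zpair eps hne hF hG)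
      (by rw [hae, add_comm]) F G (by rw [ind_support]; exact hF) (by rw [ind_support]; exact hG)
    simpa only [pairC, if_pos, if_neg hne.symm] using this
  have hq0 : ∀ G, q G ≠ 0 := by
    intro G
    refine hC.conn ∅ Δ.empty_mem (fun G => q G ≠ 0) ?_ F0 G (Finset.empty_subset _) (Finset.empty_subset _) (Wt_supp hc h1 F0 hv).1
    intro F G ρ _ hF hG hne hG0
    by_cases hFG : F = G
    · exact hne (hFG ▸ hG0)
    have := hq ρ F G hFG hF hG
    rw [hG0, zero_mul] at this
    exact (mul_ne_zero hne ((heps G ρ).2 hG)) this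
  refine inv_ne_zero (hq0 F0) (hZ (fun F => (q F)⁻¹) ⟨fun _ _ => Finset.empty_subset _, fun ρ _ => ?_⟩ F0)
  obtain ⟨F, hF⟩ := hC.pure ρ.1 ρ.2.1
  obtain ⟨G, hG, hGF⟩ := nb ρ F hF
  rw [sum2 heps hGF.symm (h2 ρ F G hGF.symm hF hG)]
  have := hq ρ F G hGF.symm hF hG
  have := hq0 F
  have := hq0 G
  field_simp
  linear_combination ‹q F * eps G ρ = q G * - eps F ρ›

end Fwd


section Path
variable {k : Type} [Field k] {n : ℕ} {Δ : SC n}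

theorem fwd_path {eps : Fc Δ 2 → Rd Δ 2 → k} (heps : ∀ F ρ, eps F ρ ≠ 0 ↔ ρ.1 ⊆ F.1) (hC : CMc Δ 2)
    (hW : ∀ v, {v} ∈ Δ.faces → Wt eps (Finsupp.single v 1))
    (h0 : ¬ Wt eps 0) (ρ0 : Rd Δ 2) (F0 : Fc Δ 2) (hF0 : ρ0.1 ⊆ F0.1)
    (hu : ∀ H : Fc Δ 2, ρ0.1 ⊆ H.1 → H = F0) : ∃ m, 3 ≤ m ∧ Δ.IsPathComplex m := by
  classical
  have h2 := fwd_two_le heps le_rfl hW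
  obtain ⟨p0, hp0⟩ := Finset.card_eq_one.1 (show ρ0.1.card = 1 by have := ρ0.2.2; omega)
  have hp : p0 ∈ F0.1 := hF0 (by rw [hp0]; exact Finset.mem_singleton_self _)
  have hu' : ∀ H : Fc Δ 2, p0 ∈ H.1 → H = F0 := fun H hH => hu H (by rw [hp0]; exact Finset.singleton_subset_iff.2 hH)
  have hdeg : ∀ (x : Fin n) (E F G : Fc Δ 2), x ∈ F.1 → x ∈ G.1 → F ≠ G → x ∈ E.1 → E = F ∨ E = G := by
    intro x E F G hF hG hne hE
    have hx : {x} ∈ Δ.faces := Δ.down_closed E.2.1 (Finset.singleton_subset_iff.2 hE)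
    exact h2 ⟨{x}, hx, rfl⟩ F G hne (Finset.singleton_subset_iff.2 hF) (Finset.singleton_subset_iff.2 hG) E
      (Finset.singleton_subset_iff.2 hE)
  let Pm : ℕ → Prop := fun m => ∃ v : ℕ → Fin n, v 0 = p0 ∧ (∀ i ≤ m, ∀ j ≤ m, v i = v j → i = j) ∧
    ∀ i < m, {v i, v (i+1)} ∈ Δ.faces
  have hbd : ∀ m, Pm m → m ≤ n := by
    rintro m ⟨v, -, hv, -⟩
    have := Fintype.card_le_of_injective (fun i : Fin (m+1) => v i) (fun i j hij =>
      Fin.ext (hv i (by omega) j (by omega) hij))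
    simp at this
    omega
  have hP0 : Pm 0 := ⟨fun _ => p0, rfl, fun i hi j hj _ => by omega, fun i hi => by omega⟩
  obtain ⟨v, hv0, hvi, hve⟩ : Pm (Nat.findGreatest Pm n) := Nat.findGreatest_spec (Nat.zero_le n) hP0
  have hmax : ¬ Pm (Nat.findGreatest Pm n + 1) := by
    intro h
    have := Nat.le_findGreatest (hbd _ h) h
    omega
  generalize Nat.findGreatest Pm n = m at hvi hve hmax
  have hcard : ∀ i < m, ({v i, v (i+1)} : Finset (Fin n)).card = 2 := by
    intro i hi
    refine Finset.card_pair fun e => ?_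
    have := hvi i (by omega) (i+1) (by omega) e
    omega
  -- edges
  let E : ∀ i, i < m → Fc Δ 2 := fun i hi => ⟨{v i, v (i+1)}, hve i hi, hcard i hi⟩
  have hk1 : ∀ (G : Fc Δ 2) j, j < m → v j ∈ G.1 → ∃ i, ∃ hi : i < m, G = E i hi := by
    intro G j hj hG
    rcases Nat.eq_zero_or_pos j with rfl | hpos
    · refine ⟨0, hj, ?_⟩
      rw [hu' G (hv0 ▸ hG), hu' (E 0 hj) (by rw [← hv0]; simp [E])]
    · have hne : E (j-1) (by omega) ≠ E j hj := by
        intro e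
        have h1 : v (j-1) ∈ (E j hj).1 := by rw [← e]; simp [E]
        simp only [E, Finset.mem_insert, Finset.mem_singleton] at h1
        rcases h1 with h1 | h1
        · have := hvi _ (by omega) _ (by omega) h1; omega
        · have := hvi _ (by omega) _ (by omega) h1; omega
      rcases hdeg (v j) G (E (j-1) (by omega)) (E j hj) (by
        have : j - 1 + 1 = j := by omega
        simp [E, this]) (by simp [E]) hne hG with h | h
      · exact ⟨j - 1, by omega, h⟩
      · exact ⟨j, hj, h⟩
  have hk2 : ∀ (G : Fc Δ 2) j, j ≤ m → v j ∈ G.1 → ∃ i, ∃ hi : i < m, G = E i hi := by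
    intro G j hj hG
    rcases Nat.lt_or_ge j m with h | h
    · exact hk1 G j h hG
    obtain rfl : j = m := le_antisymm hj h
    by_cases hex : ∃ i < j, v i ∈ G.1
    · obtain ⟨i, hi, hiG⟩ := hex
      exact hk1 G i hi hiG
    push Not at hex
    exfalso
    apply hmax
    have hc : (G.1.erase (v j)).card = 1 := by rw [Finset.card_erase_of_mem hG, G.2.2]
    obtain ⟨x, hx⟩ := Finset.card_eq_one.1 hc
    have hGe : G.1 = {v j, x} := by rw [← Finset.insert_erase hG, hx]
    have hxm : x ∈ G.1.erase (v j) := by rw [hx]; exact Finset.mem_singleton_self _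
    rw [Finset.mem_erase] at hxm
    have hxv : ∀ i ≤ j, v i ≠ x := by
      intro i hi e
      rcases Nat.lt_or_ge i j with h | h
      · exact hex i h (e ▸ hxm.2)
      · have : i = j := by omega
        exact hxm.1 (by rw [← e, this])
    refine ⟨fun i => if i ≤ j then v i else x, by simp [hv0], ?_, ?_⟩
    · intro a ha b hb hab
      simp only at hab
      split_ifs at hab with h1 h2 h2
      · exact hvi a h1 b h2 hab
      · exact absurd hab (hxv a h1)
      · exact absurd hab.symm (hxv b h2)
      · omega
    · intro i hi
      rcases Nat.lt_or_ge i j with h | h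
      · simp only [if_pos h.le, if_pos (show i + 1 ≤ j from h)]
        exact hve i h
      · obtain rfl : i = j := by omega
        simp only [le_refl, if_pos, if_neg (show ¬ i + 1 ≤ i by omega)]
        rw [← hGe]; exact G.2.1
  have hall : ∀ G : Fc Δ 2, ∃ i, ∃ hi : i < m, G = E i hi := by
    intro G
    refine hC.conn ∅ Δ.empty_mem (fun G => ∃ i, ∃ hi : i < m, G = E i hi) ?_ F0 G (Finset.empty_subset _) (Finset.empty_subset _)
      (hk2 F0 0 (Nat.zero_le _) (hv0 ▸ hp))
    rintro F G ρ - hF hG ⟨i, hi, rfl⟩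
    obtain ⟨x, hx⟩ := Finset.card_eq_one.1 (show ρ.1.card = 1 by have := ρ.2.2; omega)
    have hxρ : x ∈ ρ.1 := by rw [hx]; exact Finset.mem_singleton_self _
    have h1 := hF hxρ
    simp only [E, Finset.mem_insert, Finset.mem_singleton] at h1
    rcases h1 with rfl | rfl
    · exact hk2 G i (by omega) (hG hxρ)
    · exact hk2 G (i+1) (by omega) (hG hxρ)
  have hm1 : 1 ≤ m := by
    obtain ⟨i, hi, -⟩ := hall F0
    omega
  refine ⟨m, ?_, fun i => v i, fun i j hij => Fin.ext (hvi i (by omega) j (by omega) hij), fun σ => ⟨fun hσ => ?_, ?_⟩⟩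
  · by_contra hlt
    apply h0
    refine Cone heps hC (w := v 1) ?_ ?_ (hW _ (Δ.down_closed (hve 0 hm1) (by simp)))
    · intro F
      obtain ⟨i, hi, rfl⟩ := hall F
      have : i = 0 ∨ i = 1 := by omega
      rcases this with rfl | rfl <;> simp [E]
    · intro F H hFH
      obtain ⟨i, hi, rfl⟩ := hall F
      obtain ⟨j, hj, rfl⟩ := hall H
      have hi' : i = 0 ∨ i = 1 := by omega
      have hj' : j = 0 ∨ j = 1 := by omega
      rcases hi' with rfl | rfl <;> rcases hj' with rfl | rfl
      · rfl
      · have h3 : v 0 ∈ (E 1 hj).1 := hFH (Finset.mem_erase.2 ⟨fun e => by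
          have := hvi 0 (by omega) 1 (by omega) e; omega, by simp [E]⟩)
        simp only [E, Finset.mem_insert, Finset.mem_singleton] at h3
        rcases h3 with h3 | h3
        · have := hvi _ (by omega) _ (by omega) h3; omega
        · have := hvi _ (by omega) _ (by omega) h3; omega
      · have h3 : v 2 ∈ (E 0 hj).1 := hFH (Finset.mem_erase.2 ⟨fun e => by
          have := hvi 2 (by omega) 1 (by omega) e; omega, by simp [E]⟩)
        simp only [E, Finset.mem_insert, Finset.mem_singleton] at h3
        rcases h3 with h3 | h3
        · have := hvi _ (by omega) _ (by omega) h3; omega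
        · have := hvi _ (by omega) _ (by omega) h3; omega
      · rfl
  · obtain ⟨G, hG⟩ := hC.pure σ hσ
    obtain ⟨i, hi, rfl⟩ := hall G
    have hG' : σ ⊆ {v i, v (i+1)} := hG
    have hG' : σ = ∅ ∨ σ = {v i} ∨ σ = {v (i+1)} ∨ σ = {v i, v (i+1)} := by
      have := Set.subset_pair_iff_eq (s := (σ : Set (Fin n))) (x := v i) (y := v (i+1))
      exact_mod_cast this.1 (fun z hz => by simpa using hG' hz)
    rcases hG' with h | h | h | h
    · exact Or.inl h
    · exact Or.inr (Or.inl ⟨⟨i, by omega⟩, h⟩)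
    · exact Or.inr (Or.inl ⟨⟨i+1, by omega⟩, h⟩)
    · exact Or.inr (Or.inr ⟨⟨i, hi⟩, h⟩)
  · rintro (rfl | ⟨i, rfl⟩ | ⟨i, rfl⟩)
    · exact Δ.empty_mem
    · rcases Nat.lt_or_ge i.1 m with h | h
      · exact Δ.down_closed (hve i.1 h) (by simp)
      · have : i.1 = m - 1 + 1 := by omega
        exact Δ.down_closed (hve (m-1) (by omega)) (by simp [this])
    · exact hve i.1 i.2

theorem fwd {d : ℕ} {eps : Fc Δ d → Rd Δ d → k} (heps : ∀ F ρ, eps F ρ ≠ 0 ↔ ρ.1 ⊆ F.1) (hC : CMc Δ d)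
    (hW : ∀ v, {v} ∈ Δ.faces → Wt eps (Finsupp.single v 1))
    (h0 : ¬ Wt eps 0) :
    (∃ m : ℕ, 3 ≤ m ∧ Δ.IsDisjointVertices m) ∨ (∃ m : ℕ, 3 ≤ m ∧ Δ.IsPathComplex m) := by
  rcases (show d = 0 ∨ d = 1 ∨ 2 ≤ d by omega) with rfl | rfl | hd
  · exact (fwd_zero heps hC h0).elim
  · exact Or.inl (fwd_one heps hC hW h0)
  · by_cases nb : ∀ (ρ : Rd Δ d) (F : Fc Δ d), ρ.1 ⊆ F.1 → ∃ G : Fc Δ d, ρ.1 ⊆ G.1 ∧ G ≠ F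
    · exact (fwd_nb heps hC hd hW h0 nb).elim
    push Not at nb
    obtain ⟨ρ, F, hF, hu⟩ := nb
    rcases (show d = 2 ∨ 3 ≤ d by omega) with rfl | hd3
    · exact Or.inr (fwd_path heps hC hW h0 ρ F hF hu)
    · exact (fwd_three heps hC hd3 hW h0 ρ F hF hu).elim

end Path


section Bwd
variable {k : Type} [Field k] {n : ℕ} {Δ : SC n}

theorem bwd_points {m : ℕ} (hm : 3 ≤ m) (hΔ : Δ.IsDisjointVertices m)
    {eps : Fc Δ 1 → Rd Δ 1 → k} (heps : ∀ F ρ, eps F ρ ≠ 0 ↔ ρ.1 ⊆ F.1) :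
    (∀ v, {v} ∈ Δ.faces → Wt eps (Finsupp.single v 1)) ∧ ¬ Wt eps 0 := by
  classical
  obtain ⟨v, hv, hf⟩ := hΔ
  let ρ : Rd Δ 1 := ⟨∅, Δ.empty_mem, rfl⟩
  let E : Fin m → Fc Δ 1 := fun i => ⟨{v i}, (hf _).2 (Or.inr ⟨i, rfl⟩), rfl⟩
  have hE : ∀ i j, E i = E j → i = j := by
    intro i j h
    have : ({v i} : Finset (Fin n)) = {v j} := congrArg Subtype.val h
    exact hv (Finset.singleton_injective this)
  constructor
  · intro x hx
    let Fx : Fc Δ 1 := ⟨{x}, hx, rfl⟩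
    have hFx : ∀ F : Fc Δ 1, x ∈ F.1 → F = Fx := fun F hF =>
      (OD.Fc_eq (F := Fx) (Finset.singleton_subset_iff.2 hF)).symm
    obtain ⟨G, hG⟩ : ∃ G, Fx ≠ G := by
      by_contra hcon
      push Not at hcon
      have := hE ⟨0, by omega⟩ ⟨1, by omega⟩ ((hcon _).symm.trans (hcon _))
      simp at this
    have hεG := (heps G ρ).2 (Finset.empty_subset _)
    refine ⟨0, pairC eps ρ Fx G, fun F => if F = Fx then (eps G ρ)⁻¹ else 0, ?_, ⟨?_, ?_, ?_⟩, ?_⟩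
    · rw [Finsupp.support_zero]
      exact Zpair eps (ρ := ρ) hG (Finset.empty_subset _) (Finset.empty_subset _)
    · intro F hF i hi
      by_cases h : F = Fx
      · subst h
        have : i ≠ x := fun e => hi (by rw [e]; exact Finset.mem_singleton_self x)
        rw [Finsupp.single_apply, if_neg this.symm]; rfl
      · simp [h] at hF
    · intro a' c' _ h
      exact absurd zero_le h
    · intro a' c' t _ ht F G hF hG
      have hxt : x ∈ t.support := by
        rw [Finsupp.mem_support_iff]
        have := DFunLike.congr_fun ht x
        simp at this
        omega
      rw [hFx F (hF hxt), hFx G (hG hxt)]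
    · intro F hF
      rw [single_supp] at hF
      rw [hFx F (Finset.singleton_subset_iff.1 hF)]
      simp [pairC, hεG]
  · rintro ⟨a, c, q, hc, hS, h1⟩
    rw [Finsupp.support_zero] at h1
    have h1' : ∀ F, q F * c F = 1 := fun F => h1 F (Finset.empty_subset _)
    have hsa : ∀ F : Fc Δ 1, a.support ⊆ F.1 := fun F => hc.1 F (fun h0 => by
      have := h1' F; rw [h0, mul_zero] at this; exact zero_ne_one this)
    have n01 : E ⟨0, by omega⟩ ≠ E ⟨1, by omega⟩ := fun h => by simpa using hE _ _ h
    have n20 : E ⟨2, by omega⟩ ≠ E ⟨0, by omega⟩ := fun h => by simpa using hE _ _ h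
    have n21 : E ⟨2, by omega⟩ ≠ E ⟨1, by omega⟩ := fun h => by simpa using hE _ _ h
    have ha : a = 0 := by
      rw [← Finsupp.support_eq_empty, ← Finset.subset_empty]
      have h := inter_eq (ρ := ρ) n01 (Finset.empty_subset _) (Finset.empty_subset _)
      exact (Finset.subset_inter (hsa _) (hsa _)).trans h.subset
    have := hS.H1 0 (pairC eps ρ (E ⟨0, by omega⟩) (E ⟨1, by omega⟩)) 0
      (by rw [Finsupp.support_zero]; exact Zpair eps (ρ := ρ) n01 (Finset.empty_subset _) (Finset.empty_subset _))
      (by rw [ha]) (E ⟨0, by omega⟩) (E ⟨2, by omega⟩)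
      (by rw [Finsupp.support_zero]; exact Finset.empty_subset _)
      (by rw [Finsupp.support_zero]; exact Finset.empty_subset _)
    simp only [pairC, if_pos, if_neg n20, if_neg n21, mul_zero] at this
    rcases mul_eq_zero.1 this with h | h
    · have h2 := h1' (E ⟨0, by omega⟩)
      rw [h, zero_mul] at h2
      exact zero_ne_one h2
    · exact (heps _ ρ).2 (Finset.empty_subset _) h

/-- end vertices of a graph -/
theorem bwd_end {eps : Fc Δ 2 → Rd Δ 2 → k} (heps : ∀ F ρ, eps F ρ ≠ 0 ↔ ρ.1 ⊆ F.1)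
    {x y : Fin n} {F0 F1 : Fc Δ 2} {ρx ρy : Rd Δ 2} (hxy : x ≠ y) (hF0 : F0.1 = {x, y}) (hx : ρx.1 = {x})
    (hy : ρy.1 = {y}) (hF1 : y ∈ F1.1) (hne : F0 ≠ F1) (hu : ∀ H : Fc Δ 2, x ∈ H.1 → H = F0) :
    Wt eps (Finsupp.single x 1) := by
  classical
  have hεG := (heps F1 ρy).2 (by rw [hy]; exact Finset.singleton_subset_iff.2 hF1)
  refine ⟨Finsupp.single y 1, pairC eps ρy F0 F1, fun F => if F = F0 then (eps F1 ρy)⁻¹ else 0, ?_, ⟨?_, ?_, ?_⟩, ?_⟩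
  · rw [single_supp, ← hy]
    exact Zpair eps hne (by rw [hy, hF0]; simp) (by rw [hy]; exact Finset.singleton_subset_iff.2 hF1)
  · intro F hF i hi
    by_cases h : F = F0
    · subst h
      rw [hF0] at hi
      simp only [Finset.mem_insert, Finset.mem_singleton, not_or] at hi
      simp [Finsupp.single_apply, Ne.symm hi.1, Ne.symm hi.2]
    · simp [h] at hF
  · intro a' c' hc' h F
    by_contra hcon
    have hF : F = F0 := by
      by_contra hF; simp [hF] at hcon
    subst hF
    have hc0 := right_ne_zero_of_mul hcon
    apply hc0
    refine bdry_zero heps (ρ := ρx) (by rw [hx, hF0]; simp) (fun H hH => hu H (hH (by rw [hx]; simp))) hc' ?_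
    intro z hz
    have hzF := hc'.1 F hc0 hz
    rw [hF0] at hzF
    simp only [Finset.mem_insert, Finset.mem_singleton] at hzF
    rw [hx, Finset.mem_singleton]
    rcases hzF with hzF | rfl
    · exact hzF
    · exfalso
      apply h
      rw [Finsupp.single_le_iff]
      rw [Finsupp.mem_support_iff] at hz
      rw [Finsupp.add_apply]
      omega
  · intro a' c' t _ ht F G hF hG
    have hxt : x ∈ t.support := by
      rw [Finsupp.mem_support_iff]
      have := DFunLike.congr_fun ht x
      simp [Finsupp.single_apply, hxy.symm] at this
      omega
    rw [hu F (hF hxt), hu G (hG hxt)]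
  · intro F hF
    rw [single_supp] at hF
    rw [hu F (Finset.singleton_subset_iff.1 hF)]
    simp [pairC, hεG]

theorem bwd_path_aux {m : ℕ} (hm : 3 ≤ m) (w : ℕ → Fin n) (hi : ∀ i ≤ m, ∀ j ≤ m, w i = w j → i = j)
    (E : ℕ → Fc Δ 2) (V : ℕ → Rd Δ 2) (hE : ∀ i < m, (E i).1 = {w i, w (i+1)}) (hV : ∀ i ≤ m, (V i).1 = {w i})
    (hall : ∀ F, ∃ i < m, F = E i) (hvert : ∀ x, {x} ∈ Δ.faces → ∃ i ≤ m, x = w i)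
    {eps : Fc Δ 2 → Rd Δ 2 → k} (heps : ∀ F ρ, eps F ρ ≠ 0 ↔ ρ.1 ⊆ F.1) :
    (∀ v, {v} ∈ Δ.faces → Wt eps (Finsupp.single v 1)) ∧ ¬ Wt eps 0 := by
  classical
  have hmem : ∀ i < m, ∀ j ≤ m, w j ∈ (E i).1 ↔ j = i ∨ j = i + 1 := by
    intro i hi1 j hj
    rw [hE i hi1]
    simp only [Finset.mem_insert, Finset.mem_singleton]
    constructor
    · rintro (h | h)
      · exact Or.inl (hi _ hj _ (by omega) h)
      · exact Or.inr (hi _ hj _ (by omega) h)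
    · rintro (rfl | rfl) <;> simp
  have hEi : ∀ i < m, ∀ j < m, E i = E j → i = j := by
    intro i hi1 j hj h
    have h1 := (hmem i hi1 i (by omega)).2 (Or.inl rfl)
    have h2 := (hmem i hi1 (i+1) (by omega)).2 (Or.inr rfl)
    rw [h, hmem j hj _ (by omega)] at h1 h2
    omega
  have hVs : ∀ i ≤ m, ∀ F : Fc Δ 2, (V i).1 ⊆ F.1 ↔ w i ∈ F.1 := by
    intro i hi1 F; rw [hV i hi1, Finset.singleton_subset_iff]
  have h2 : ∀ i, i + 1 < m → ∀ H : Fc Δ 2, (V (i+1)).1 ⊆ H.1 → H = E i ∨ H = E (i+1) := by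
    intro i hi1 H hH
    obtain ⟨j, hj, rfl⟩ := hall H
    rw [hVs _ (by omega), hmem _ hj _ (by omega)] at hH
    rcases hH with h | h
    · right; rw [h]
    · left; congr 1; omega
  have hu0 : ∀ H : Fc Δ 2, w 0 ∈ H.1 → H = E 0 := by
    intro H hH
    obtain ⟨j, hj, rfl⟩ := hall H
    rw [hmem _ hj _ (by omega)] at hH
    congr 1; omega
  have hum : ∀ H : Fc Δ 2, w m ∈ H.1 → H = E (m-1) := by
    intro H hH
    obtain ⟨j, hj, rfl⟩ := hall H
    rw [hmem _ hj _ (by omega)] at hH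
    congr 1; omega
  have he1 : ∀ i, i + 1 < m → eps (E i) (V (i+1)) ≠ 0 := fun i hi1 => by
    rw [heps, hVs _ (by omega), hmem _ (by omega) _ (by omega)]; omega
  have he2 : ∀ i, i + 1 < m → eps (E (i+1)) (V (i+1)) ≠ 0 := fun i hi1 => by
    rw [heps, hVs _ (by omega), hmem _ (by omega) _ (by omega)]; omega
  have hne : ∀ i, i + 1 < m → E i ≠ E (i+1) := fun i hi1 h => by
    have := hEi _ (by omega) _ (by omega) h; omega
  have hZ : ∀ c, Zp eps ∅ c → ∀ F, c F = 0 := by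
    intro c hc
    have : ∀ i, i < m → c (E i) = 0 := by
      intro i
      induction i with
      | zero =>
        intro _
        refine bdry_zero heps (ρ := V 0) ?_ ?_ hc (Finset.empty_subset _)
        · rw [hVs _ (by omega), hmem _ (by omega) _ (by omega)]; omega
        · intro H hH
          exact hu0 H ((hVs _ (by omega) _).1 hH)
      | succ i ih =>
        intro hi1
        have := hc.2 (V (i+1)) (Finset.empty_subset _)
        rw [sum2 heps (hne i hi1) (h2 i hi1), ih (by omega), mul_zero, zero_add] at this
        exact (mul_eq_zero.1 this).resolve_left (he2 i hi1)
    intro F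
    obtain ⟨i, hi1, rfl⟩ := hall F
    exact this i hi1
  constructor
  · intro x hx
    obtain ⟨j, hj, rfl⟩ := hvert x hx
    rcases (show j = 0 ∨ j = m ∨ (0 < j ∧ j < m) by omega) with rfl | rfl | ⟨hj0, hjm⟩
    · refine bwd_end heps (x := w 0) (y := w 1) (F0 := E 0) (F1 := E 1) (ρx := V 0) (ρy := V 1) ?_ (hE 0 (by omega))
        (hV 0 (by omega)) (hV 1 (by omega)) ?_ (hne 0 (by omega)) hu0
      · intro h; have := hi _ (by omega) _ (by omega) h; omega
      · rw [hmem _ (by omega) _ (by omega)]; omega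
    · refine bwd_end heps (x := w j) (y := w (j-1)) (F0 := E (j-1)) (F1 := E (j-2)) (ρx := V j) (ρy := V (j-1)) ?_ ?_
        (hV j (by omega)) (hV (j-1) (by omega)) ?_ ?_ hum
      · intro h; have := hi _ (by omega) _ (by omega) h; omega
      · rw [hE _ (by omega), Finset.pair_comm, show j - 1 + 1 = j by omega]
      · rw [hmem _ (by omega) _ (by omega)]; omega
      · intro h; have := hEi _ (by omega) _ (by omega) h; omega
    · obtain ⟨l, rfl⟩ : ∃ l, j = l + 1 := ⟨j - 1, by omega⟩
      let g : ℕ → k := fun i => if i + 1 < m then - eps (E (i+1)) (V (i+1)) / eps (E i) (V (i+1)) else 1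
      have hg0 : ∀ i, g i ≠ 0 := by
        intro i
        simp only [g]
        split_ifs with h
        · exact div_ne_zero (neg_ne_zero.2 (he2 i h)) (he1 i h)
        · exact one_ne_zero
      let r : ℕ → k := fun i => ∏ s ∈ Finset.range i, g s
      have hr0 : ∀ i, r i ≠ 0 := fun i => Finset.prod_ne_zero_iff.2 fun s _ => hg0 s
      have hr : ∀ i, i + 1 < m → r i * eps (E (i+1)) (V (i+1)) + r (i+1) * eps (E i) (V (i+1)) = 0 := by
        intro i h
        have h3 : r (i+1) = r i * g i := Finset.prod_range_succ _ _
        rw [h3]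
        simp only [g, if_pos h]
        have := he1 i h
        field_simp
        ring
      choose idx hidx1 hidx2 using hall
      have hidx : ∀ i < m, idx (E i) = i := fun i h => (hEi _ h _ (hidx1 _) (hidx2 (E i))).symm
      let κ : k := (r l * eps (E (l+1)) (V (l+1)))⁻¹
      have hκ : κ * (r l * eps (E (l+1)) (V (l+1))) = 1 := inv_mul_cancel₀ (mul_ne_zero (hr0 _) (he2 l hjm))
      refine ⟨Finsupp.single (w (l+1)) 1, pairC eps (V (l+1)) (E l) (E (l+1)), fun F => κ * r (idx F), ?_, ⟨?_, ?_, ?_⟩, ?_⟩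
      · rw [single_supp, ← hV _ hj]
        refine Zpair eps (hne l hjm) ?_ ?_
        · rw [hVs _ hj, hmem _ (by omega) _ hj]; omega
        · rw [hVs _ hj, hmem _ (by omega) _ hj]; omega
      · intro _ _ _ _; rfl
      · intro a' c' _ h
        exact absurd le_self_add h
      · intro a' c' t hc' ht F G hF hG
        obtain rfl : t = a' := by rw [add_comm] at ht; exact add_left_cancel ht
        -- adjacent edges
        have key : ∀ i, i + 1 < m → t.support ⊆ (E i).1 → t.support ⊆ (E (i+1)).1 →
            κ * r i * c' (E i) = κ * r (i+1) * c' (E (i+1)) := by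
          intro i hi1 hs1 hs2
          have hsub : t.support ⊆ (V (i+1)).1 := by
            rw [← inter_eq (ρ := V (i+1)) (hne i hi1) ((heps _ _).1 (he1 i hi1)) ((heps _ _).1 (he2 i hi1))]
            exact Finset.subset_inter hs1 hs2
          have e1 := hc'.2 (V (i+1)) hsub
          rw [sum2 heps (hne i hi1) (h2 i hi1)] at e1
          have e2 := hr i hi1
          apply mul_left_cancel₀ (he1 i hi1)
          linear_combination κ * r i * e1 - κ * c' (E (i+1)) * e2
        by_cases hemp : t.support = ∅
        · rw [hemp] at hc'
          rw [hZ c' hc' F, hZ c' hc' G, mul_zero, mul_zero]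
        obtain ⟨y, hy⟩ := Finset.nonempty_iff_ne_empty.2 hemp
        obtain ⟨j', hj', rfl⟩ := hvert y (Δ.down_closed F.2.1 (Finset.singleton_subset_iff.2 (hF hy)))
        have yF := hF hy
        have yG := hG hy
        obtain ⟨i1, hi1, rfl⟩ : ∃ i < m, F = E i := ⟨_, hidx1 F, hidx2 F⟩
        obtain ⟨i2, hi2, rfl⟩ : ∃ i < m, G = E i := ⟨_, hidx1 G, hidx2 G⟩
        rw [hmem _ hi1 _ hj'] at yF
        rw [hmem _ hi2 _ hj'] at yG
        simp only [hidx i1 hi1, hidx i2 hi2]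
        rcases (show i1 = i2 ∨ i2 = i1 + 1 ∨ i1 = i2 + 1 by omega) with rfl | rfl | rfl
        · rfl
        · exact key i1 hi2 hF hG
        · exact (key i2 hi1 hG hF).symm
      · intro F hF
        rw [single_supp, Finset.singleton_subset_iff, ← hVs _ hj] at hF
        rcases h2 l hjm F hF with rfl | rfl
        · simp only [pairC, if_pos, hidx l (by omega)]
          rw [mul_assoc]; exact hκ
        · simp only [pairC, if_pos, if_neg (hne l hjm).symm, hidx (l+1) hjm]
          linear_combination hκ - κ * hr l hjm
  · rintro ⟨a, c, q, hc, hS, h1⟩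
    rw [Finsupp.support_zero] at h1
    have h1' : ∀ F, q F * c F = 1 := fun F => h1 F (Finset.empty_subset _)
    have hcn : ∀ F, c F ≠ 0 := fun F h0 => by
      have := h1' F; rw [h0, mul_zero] at this; exact zero_ne_one this
    have ha : a.support = ∅ := by
      rw [Finset.eq_empty_iff_forall_notMem]
      intro x hx
      have m0 := hc.1 (E 0) (hcn _) hx
      have m2 := hc.1 (E 2) (hcn _) hx
      obtain ⟨j, hj, rfl⟩ := hvert x (Δ.down_closed (E 0).2.1 (Finset.singleton_subset_iff.2 m0))
      rw [hmem _ (by omega) _ hj] at m0 m2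
      omega
    rw [ha] at hc
    exact hcn _ (hZ c hc (E 0))

theorem bwd_path {m : ℕ} (hm : 3 ≤ m) (hΔ : Δ.IsPathComplex m)
    {eps : Fc Δ 2 → Rd Δ 2 → k} (heps : ∀ F ρ, eps F ρ ≠ 0 ↔ ρ.1 ⊆ F.1) :
    (∀ v, {v} ∈ Δ.faces → Wt eps (Finsupp.single v 1)) ∧ ¬ Wt eps 0 := by
  classical
  obtain ⟨v, hv, hf⟩ := hΔ
  let w : ℕ → Fin n := fun i => v ⟨min i m, by omega⟩
  have hw : ∀ i (h : i < m + 1), w i = v ⟨i, h⟩ := by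
    intro i h
    simp only [w]
    congr 2
    omega
  have hi : ∀ i ≤ m, ∀ j ≤ m, w i = w j → i = j := by
    intro i hi j hj h
    rw [hw i (by omega), hw j (by omega)] at h
    exact congrArg Fin.val (hv h)
  have hVf : ∀ i, {w i} ∈ Δ.faces := fun i => (hf _).2 (Or.inr (Or.inl ⟨_, rfl⟩))
  have hEf : ∀ i < m, {w i, w (i+1)} ∈ Δ.faces := fun i h =>
    (hf _).2 (Or.inr (Or.inr ⟨⟨i, h⟩, by rw [hw i (by omega), hw (i+1) (by omega)]; rfl⟩))
  have hEc : ∀ i < m, ({w i, w (i+1)} : Finset (Fin n)).card = 2 := fun i h =>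
    Finset.card_pair (fun e => by have := hi _ (by omega) _ (by omega) e; omega)
  have hEx : ∀ i, ∃ E : Fc Δ 2, i < m → E.1 = {w i, w (i+1)} := by
    intro i
    by_cases h : i < m
    · exact ⟨⟨_, hEf i h, hEc i h⟩, fun _ => rfl⟩
    · exact ⟨⟨_, hEf 0 (by omega), hEc 0 (by omega)⟩, fun h' => absurd h' h⟩
  choose E hE using hEx
  refine bwd_path_aux hm w hi E (fun i => ⟨{w i}, hVf i, rfl⟩) hE (fun _ _ => rfl) ?_ ?_ heps
  · intro F
    rcases (hf F.1).1 F.2.1 with h | ⟨i, h⟩ | ⟨i, h⟩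
    · have := F.2.2; rw [h] at this; simp at this
    · have := F.2.2; rw [h] at this; simp at this
    · refine ⟨i, i.2, Subtype.ext ?_⟩
      rw [hE i i.2, h, hw i (by omega), hw (i+1) (by omega)]; rfl
  · intro x hx
    rcases (hf {x}).1 hx with h | ⟨i, h⟩ | ⟨i, h⟩
    · simp at h
    · refine ⟨i, by omega, ?_⟩
      rw [hw i (by omega)]
      exact Finset.singleton_injective h
    · have := congrArg Finset.card h
      rw [Finset.card_singleton, Finset.card_pair (fun e => by
        have := congrArg Fin.val (hv e); simp at this)] at this
      omega

theorem sup_points {m : ℕ} (hm : 3 ≤ m) (hΔ : Δ.IsDisjointVertices m) : Δ.faces.sup Finset.card = 1 := by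
  obtain ⟨v, hv, hf⟩ := hΔ
  apply le_antisymm
  · refine Finset.sup_le fun σ hσ => ?_
    rcases (hf σ).1 hσ with rfl | ⟨i, rfl⟩ <;> simp
  · have := Finset.le_sup (f := Finset.card) ((hf {v ⟨0, by omega⟩}).2 (Or.inr ⟨_, rfl⟩))
    simpa using this

theorem sup_path {m : ℕ} (hm : 3 ≤ m) (hΔ : Δ.IsPathComplex m) : Δ.faces.sup Finset.card = 2 := by
  obtain ⟨v, hv, hf⟩ := hΔ
  apply le_antisymm
  · refine Finset.sup_le fun σ hσ => ?_
    rcases (hf σ).1 hσ with rfl | ⟨i, rfl⟩ | ⟨i, rfl⟩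
    · simp
    · simp
    · exact Finset.card_le_two
  · have := Finset.le_sup (f := Finset.card) ((hf _).2 (Or.inr (Or.inr ⟨⟨0, by omega⟩, rfl⟩)))
    rwa [Finset.card_pair (fun e => by
        have := congrArg Fin.val (hv e); simp at this)] at this

theorem bwd {d : ℕ} (hd : Δ.faces.sup Finset.card = d) {eps : Fc Δ d → Rd Δ d → k} (heps : ∀ F ρ, eps F ρ ≠ 0 ↔ ρ.1 ⊆ F.1)
    (h : (∃ m : ℕ, 3 ≤ m ∧ Δ.IsDisjointVertices m) ∨ (∃ m : ℕ, 3 ≤ m ∧ Δ.IsPathComplex m)) :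
    (∀ v, {v} ∈ Δ.faces → Wt eps (Finsupp.single v 1)) ∧ ¬ Wt eps 0 := by
  rcases h with ⟨m, hm, h⟩ | ⟨m, hm, h⟩
  · obtain rfl : d = 1 := hd.symm.trans (sup_points hm h)
    exact bwd_points hm h heps
  · obtain rfl : d = 2 := hd.symm.trans (sup_path hm h)
    exact bwd_path hm h heps

end Bwd

section Wrap
variable (k : Type) [Field k] {n : ℕ}

theorem main_low (Δ : SC n) (hCM : IsCohenMacaulayAt (mQ k Δ.low) (quotMax k (mI k Δ.low)))
    (ω : Type) [AddCommGroup ω] [Module (mQ k Δ.low) ω]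
    (hω : IsCanonicalModuleQ k (mI k Δ.low) ω) :
    traceIdeal (mQ k Δ.low) ω = quotMax k (mI k Δ.low) ↔
      ((∃ m : ℕ, 3 ≤ m ∧ Δ.IsDisjointVertices m) ∨ (∃ m : ℕ, 3 ≤ m ∧ Δ.IsPathComplex m)) := by
  obtain ⟨-, d, hd, e⟩ := hω
  have hd' : Δ.faces.sup Finset.card = d := by
    have h : ((Δ.faces.sup Finset.card : ℕ) : WithBot (WithTop ℕ)) = d := (dim_low k Δ).symm.trans hd
    exact_mod_cast h
  have hdn : d ≤ n := by
    rw [← hd']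
    exact Finset.sup_le fun σ _ => by simpa using Finset.card_le_univ σ
  obtain ⟨O⟩ := OD_exists Δ d hd' hdn ω e
  have hC : CMc Δ d := hd' ▸ CM_CMc Δ hCM
  rw [O.trace_iff hC.pure]
  exact ⟨fun h => fwd O.heps hC h.1 h.2, fun h => bwd hd' O.heps h⟩

theorem main_gen (Δ : SC n) (I : Ideal (MvPolynomial (Fin n) k)) (hI : mI k Δ.low = I)
    (hCM : IsCohenMacaulayAt (MvPolynomial (Fin n) k ⧸ I) (quotMax k I))
    (ω : Type) [AddCommGroup ω] [Module (MvPolynomial (Fin n) k ⧸ I) ω]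
    (hω : IsCanonicalModuleQ k I ω) :
    traceIdeal (MvPolynomial (Fin n) k ⧸ I) ω = quotMax k I ↔
      ((∃ m : ℕ, 3 ≤ m ∧ Δ.IsDisjointVertices m) ∨ (∃ m : ℕ, 3 ≤ m ∧ Δ.IsPathComplex m)) := by
  subst hI
  exact main_low k Δ hCM ω hω

end Wrap

set_option maxHeartbeats 1000000 in
set_option synthInstance.maxHeartbeats 1000000 in
/-- Let `R = k[Δ]` be a Cohen--Macaulay Stanley--Reisner ring.  Then
`tr(ω_R) = 𝔐_R` (i.e. `R` is nearly Gorenstein but not Gorenstein) if and only if `Δ` is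
isomorphic to a disjoint union of `m ≥ 3` vertices or to a path of length `m ≥ 3`. -/
theorem trace_eq_maxIdeal_iff
    (k : Type) [Field k] {n : ℕ} (Δ : SC n)
    (hCM : IsCohenMacaulayAt (SRRing k Δ) (srMax k Δ))
    (ω : Type) [AddCommGroup ω] [Module (SRRing k Δ) ω]
    (hω : IsCanonicalModuleQ k (srIdeal k Δ) ω) :
    traceIdeal (SRRing k Δ) ω = srMax k Δ ↔
      ((∃ m : ℕ, 3 ≤ m ∧ Δ.IsDisjointVertices m) ∨ (∃ m : ℕ, 3 ≤ m ∧ Δ.IsPathComplex m)) := by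
  exact main_gen k Δ (srIdeal k Δ) rfl hCM ω hω
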